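/- Approximation of submanifolds with boundary in non-critical low codimension: let 1 ≤ k ≤ n−1, let O ⊂ ℍ^n be open and let S be an oriented k-codimensional C¹_ℍ-regular submanifold with boundary in O such that S and ∂S have locally finite measures on O (𝒮^{Q−k}⌊S and 𝒮^{Q−k−1}⌊∂S locally finite). Then for each p ∈ O ∩ ∂S there exist an open set U with p ∈ U and a sequence (S_h)_{h∈ℕ} of oriented smooth (Euclidean C^∞) submanifolds of codimension k which are also C¹_ℍ-regular, with smooth and C¹_ℍ-regular boundaries ∂S_h in O and locally finite measures in O, such that ⟦S_h⟧(ω) → ⟦S⟧(ω) for every ω ∈ 𝒟^{2n+1−k}_ℍ(U) and ⟦∂S_h⟧(α) → ⟦∂S⟧(α) for every α ∈ 𝒟^{2n−k}_ℍ(U), as h → ∞. -/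

import Mathlib

open MeasureTheory Topology Filter Set ENNReal

noncomputable section
namespace Heis

/-- Points of the `n`-th Heisenberg group `ℍⁿ ≡ ℝⁿ × ℝⁿ × ℝ`, `p = (x, y, t)`. -/
abbrev Hpt (n : ℕ) : Type := (Fin n → ℝ) × (Fin n → ℝ) × ℝ

variable {n : ℕ}

/-- The Heisenberg group operation. -/
def hmul (p q : Hpt n) : Hpt n :=
  (p.1 + q.1, p.2.1 + q.2.1,
    p.2.2 + q.2.2 + (∑ j, p.1 j * q.2.1 j) / 2 - (∑ j, q.1 j * p.2.1 j) / 2)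

/-- Group inverse. -/
def hinv (p : Hpt n) : Hpt n := (-p.1, -p.2.1, -p.2.2)

/-- Anisotropic dilations `δ_λ(x,y,t) = (λx, λy, λ²t)`. -/
def hdil (l : ℝ) (p : Hpt n) : Hpt n := (l • p.1, l • p.2.1, l ^ 2 * p.2.2)

/-- The value at `p` of the `j`-th left invariant frame field `X₁,…,Xₙ,Y₁,…,Yₙ,T`,
expressed in the coordinates of `ℝ^{2n+1}`. -/
def frameVec (j : Fin (2*n+1)) (p : Hpt n) : Hpt n :=
  if h : (j : ℕ) < n then
    (Pi.single (⟨j, h⟩ : Fin n) 1, 0, -(p.2.1 ⟨j, h⟩) / 2)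
  else if h' : (j : ℕ) < 2*n then
    (0, Pi.single (⟨(j:ℕ) - n, by omega⟩ : Fin n) 1, p.1 ⟨(j:ℕ) - n, by omega⟩ / 2)
  else (0, 0, 1)

/-- Inclusion of horizontal indices. -/
def hIdx (j : Fin (2*n)) : Fin (2*n+1) := Fin.castLE (by omega) j

/-- Horizontal gradient `∇_ℍ f = (X₁f,…,Xₙf,Y₁f,…,Yₙf)` (pointwise derivatives along the
horizontal left-invariant fields). -/
def gradH (f : Hpt n → ℝ) (p : Hpt n) : Fin (2*n) → ℝ :=
  fun j => lineDeriv ℝ f p (frameVec (hIdx j) p)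

/-- `f` is of class `C¹_ℍ` on `U`: it is continuous and its horizontal derivatives exist and
are (represented by) continuous functions on `U`. -/
structure IsC1H (U : Set (Hpt n)) (f : Hpt n → ℝ) : Prop where
  contOn : ContinuousOn f U
  ldiff : ∀ p ∈ U, ∀ j : Fin (2*n), LineDifferentiableAt ℝ f p (frameVec (hIdx j) p)
  contGrad : ∀ j : Fin (2*n), ContinuousOn (fun p => gradH f p j) U

/-- Horizontal gradient as a frame-coefficient vector in `ℝ^{2n+1}` (with zero `T`-component). -/
def gradF (f : Hpt n → ℝ) (q : Hpt n) : Fin (2*n+1) → ℝ :=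
  fun j => if h : (j:ℕ) < 2*n then gradH f q ⟨j, h⟩ else 0

/-- Horizontal derivative indexed by a natural number (0 outside the horizontal range). -/
def gradNat (f : Hpt n → ℝ) (q : Hpt n) (i : ℕ) : ℝ :=
  if h : i < 2*n then gradH f q ⟨i, h⟩ else 0

/-- The Pansu differential of a `C¹_ℍ` function: `d_ℍf_p(x,y,t) = Σⱼ(xⱼXⱼf(p) + yⱼYⱼf(p))`. -/
def pansuD (f : Hpt n → ℝ) (p : Hpt n) (q : Hpt n) : ℝ :=
  ∑ j : Fin n, (q.1 j * gradH f p ⟨(j:ℕ), by omega⟩ + q.2.1 j * gradH f p ⟨n + (j:ℕ), by omega⟩)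

/-- `S` is a `k`-codimensional `C¹_ℍ`-regular submanifold. -/
def IsC1HCodim (k : ℕ) (S : Set (Hpt n)) : Prop :=
  ∀ p ∈ S, ∃ U : Set (Hpt n), IsOpen U ∧ p ∈ U ∧
    ∃ f : Fin k → Hpt n → ℝ,
      (∀ i, IsC1H U (f i)) ∧
      (∀ q ∈ U, LinearIndependent ℝ (fun i => gradH (f i) q)) ∧
      S ∩ U = {q ∈ U | ∀ i, f i q = 0}

/-- `L : ℝ^k → ℍⁿ` is a group homomorphism. -/
def IsGroupHomH {k : ℕ} (L : (Fin k → ℝ) → Hpt n) : Prop :=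
  ∀ a b, L (a + b) = hmul (L a) (L b)

/-- Pansu differentiability of `f : ℝ^k → ℍⁿ` at `a`:
`δ_{1/λ}(f(a)⁻¹ ⬝ f(a + λb)) → L(b)` locally uniformly in `b`, with `L` a group homomorphism. -/
def HasPansuDerivAt {k : ℕ} (f : (Fin k → ℝ) → Hpt n) (L : (Fin k → ℝ) → Hpt n)
    (a : Fin k → ℝ) : Prop :=
  IsGroupHomH L ∧
    TendstoLocallyUniformly
      (fun (l : ℝ) (b : Fin k → ℝ) => hdil l⁻¹ (hmul (hinv (f a)) (f (a + l • b)))) L (𝓝[>] 0)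

/-- `S` is a `k`-dimensional (`k ≤ n`) `C¹_ℍ`-regular submanifold: locally the injective image
of an open set of `ℝ^k` under a continuously Pansu differentiable map with injective
Pansu differential. -/
def IsC1HDim (k : ℕ) (S : Set (Hpt n)) : Prop :=
  ∀ p ∈ S, ∃ U : Set (Hpt n), IsOpen U ∧ p ∈ U ∧
    ∃ V : Set (Fin k → ℝ), IsOpen V ∧
    ∃ (f : (Fin k → ℝ) → Hpt n) (Df : (Fin k → ℝ) → (Fin k → ℝ) → Hpt n),
      Set.InjOn f V ∧ Set.MapsTo f V U ∧
      (∀ a ∈ V, HasPansuDerivAt f (Df a) a ∧ Function.Injective (Df a)) ∧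
      (∀ b, ContinuousOn (fun a => Df a b) V) ∧
      S ∩ U = f '' V

/-- `C¹_ℍ`-regular submanifold of codimension `k`, for any `1 ≤ k ≤ 2n+1` (for `k ≥ n+1` this
means a low-dimensional submanifold of dimension `2n+1-k`). -/
def IsC1HSub (k : ℕ) (S : Set (Hpt n)) : Prop :=
  if k ≤ n then IsC1HCodim k S else IsC1HDim (2*n+1-k) S

/-! ## Distances and measures -/

/-- Open ball of a distance function. -/
def rawBall (d : Hpt n → Hpt n → ℝ) (p : Hpt n) (r : ℝ) : Set (Hpt n) := {q | d p q < r}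

/-- The gauge used to define the spherical Hausdorff measure of dimension `m` at scale `r`. -/
def sphGauge (d : Hpt n → Hpt n → ℝ) (m r : ℝ) (s : Set (Hpt n)) : ℝ≥0∞ :=
  ⨅ (c : Hpt n) (ρ : ℝ) (_ : 0 < ρ) (_ : ρ < r) (_ : s ⊆ rawBall d c ρ),
    ENNReal.ofReal ((2*ρ) ^ m)

/-- Spherical pre-measure at scale `r`. -/
def sphPre (d : Hpt n → Hpt n → ℝ) (m r : ℝ) : OuterMeasure (Hpt n) :=
  OuterMeasure.boundedBy (sphGauge d m r)

/-- The spherical Hausdorff outer measure `𝒮^m` associated with `d`. -/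
def sphOuter (d : Hpt n → Hpt n → ℝ) (m : ℝ) : OuterMeasure (Hpt n) :=
  ⨆ (r : ℝ) (_ : 0 < r), sphPre d m r

/-- A left invariant, homogeneous, rotationally invariant distance on `ℍⁿ`.
(The field `carat` records the — automatically true — fact that Borel sets are
Carathéodory measurable for the associated spherical measures.) -/
structure HomDist (n : ℕ) where
  d : Hpt n → Hpt n → ℝ
  symm : ∀ p q, d p q = d q p
  triangle : ∀ p q r, d p r ≤ d p q + d q r
  eq_iff : ∀ p q, d p q = 0 ↔ p = q
  leftInv : ∀ g p q, d (hmul g p) (hmul g q) = d p q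
  homog : ∀ l : ℝ, 0 < l → ∀ p q, d (hdil l p) (hdil l q) = l * d p q
  rotInv : ∀ p q : Hpt n,
    (∑ j, (p.1 j ^ 2 + p.2.1 j ^ 2)) = (∑ j, (q.1 j ^ 2 + q.2.1 j ^ 2)) →
    p.2.2 = q.2.2 → d 0 p = d 0 q
  carat : ∀ m : ℝ,
    (inferInstance : MeasurableSpace (Hpt n)) ≤ (sphOuter d m).caratheodory

/-- Open ball `U(p,r)` of a homogeneous distance. -/
def hball (D : HomDist n) (p : Hpt n) (r : ℝ) : Set (Hpt n) := rawBall D.d p r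

/-- The spherical Hausdorff measure `𝒮^m` of a homogeneous distance, as a measure. -/
def sphMeasure (D : HomDist n) (m : ℝ) : Measure (Hpt n) :=
  (sphOuter D.d m).toMeasure (D.carat m)

/-- `μ⌊A` is locally finite on `O`. -/
def LocFin (μ : Measure (Hpt n)) (A O : Set (Hpt n)) : Prop :=
  ∀ p ∈ O, ∃ U : Set (Hpt n), IsOpen U ∧ p ∈ U ∧ μ (A ∩ U) < ⊤

/-! ## Euclidean coordinates and Euclidean Hausdorff measures -/

/-- Realization of a coordinate vector `c ∈ ℝ^{2n+1}` as a point/tangent vector of `ℍⁿ`. -/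
def rE (c : Fin (2*n+1) → ℝ) : Hpt n :=
  (fun i => c ⟨(i:ℕ), by omega⟩, fun i => c ⟨n + (i:ℕ), by omega⟩, c ⟨2*n, by omega⟩)

/-- Coordinates of a point/tangent vector of `ℍⁿ` as a vector of `ℝ^{2n+1}`. -/
def toEc (q : Hpt n) : Fin (2*n+1) → ℝ := fun j =>
  if h : (j:ℕ) < n then q.1 ⟨j, h⟩
  else if h' : (j:ℕ) < 2*n then q.2.1 ⟨(j:ℕ) - n, by omega⟩
  else q.2.2

/-- Identification of `ℍⁿ` with the Euclidean space `ℝ^{2n+1}`. -/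
def ofE (q : EuclideanSpace ℝ (Fin (2*n+1))) : Hpt n := rE (fun j => q j)

/-- The `m`-dimensional Euclidean Hausdorff measure on `ℍⁿ ≡ ℝ^{2n+1}`. -/
def muE (n : ℕ) (m : ℝ) : Measure (Hpt n) :=
  Measure.map ofE (μH[m] : Measure (EuclideanSpace ℝ (Fin (2*n+1))))

/-! ## Multivectors -/

/-- Index sets for a basis of `Λ_k 𝔥`. -/
def IdxSet (n k : ℕ) := {s : Finset (Fin (2*n+1)) // s.card = k}

instance (n k : ℕ) : Fintype (IdxSet n k) := by unfold IdxSet; infer_instance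

/-- The increasing enumeration of an index set. -/
def idxTuple {k : ℕ} (s : IdxSet n k) (i : Fin k) : Fin (2*n+1) :=
  ((s.1.orderIsoOfFin s.2) i).1

/-- `k`-vectors, as coefficients with respect to the canonical basis of `Λ_k ℝ^{2n+1}`. -/
abbrev MVec (n k : ℕ) := IdxSet n k → ℝ

/-- The simple `k`-vector `v₁ ∧ ⋯ ∧ v_k`. -/
def simpleWedge {k : ℕ} (v : Fin k → (Fin (2*n+1) → ℝ)) : MVec n k :=
  fun s => Matrix.det (Matrix.of fun i j => v i (idxTuple s j))

/-- Degree cast for multivectors. -/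
def mvCast {a b : ℕ} (h : a = b) (t : MVec n a) : MVec n b :=
  fun s => t ⟨s.1, by rw [h]; exact s.2⟩

/-- Euclidean scalar product of coefficient vectors. -/
def dotC (a b : Fin (2*n+1) → ℝ) : ℝ := ∑ j, a j * b j

/-- Pairing `⟨t | η⟩` at `p` of a `k`-vector (in the left invariant frame `X₁,…,Yₙ,T`)
with a `k`-form. -/
def pairF {k : ℕ} (t : MVec n k) (p : Hpt n) (η : (Fin k → Hpt n) → ℝ) : ℝ :=
  ∑ s, t s * η (fun i => frameVec (idxTuple s i) p)

/-- The `j`-th coordinate basis vector of `ℝ^{2n+1}`. -/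
def coordC (j : Fin (2*n+1)) : Fin (2*n+1) → ℝ := fun j' => if j' = j then 1 else 0

/-- Pairing `⟨t | η⟩` of a `k`-vector (in the coordinate basis `∂x,∂y,∂t`) with a `k`-form. -/
def pairE {k : ℕ} (t : MVec n k) (η : (Fin k → Hpt n) → ℝ) : ℝ :=
  ∑ s, t s * η (fun i => rE (coordC (idxTuple s i)))

/-- Realization of a frame-coefficient vector as a tangent vector at `p`. -/
def rF (c : Fin (2*n+1) → ℝ) (p : Hpt n) : Hpt n := ∑ j, c j • frameVec j p

/-! ## Covectors and Heisenberg forms -/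

/-- `k`-covectors on `ℍⁿ`. -/
abbrev Cov (n k : ℕ) := AlternatingMap ℝ (Hpt n) ℝ (Fin k)

/-- Wedge product of covectors. -/
def cwedge {k l : ℕ} (α : Cov n k) (β : Cov n l) : Cov n (k + l) :=
  AlternatingMap.domDomCongr finSumFinEquiv
    ((TensorProduct.lid ℝ ℝ).toLinearMap.compAlternatingMap (AlternatingMap.domCoprod α β))

/-- Degree cast for covectors. -/
def covCast {a b : ℕ} (h : a = b) (α : Cov n a) : Cov n b :=
  AlternatingMap.domDomCongr (finCongr h) α

def projX (j : Fin n) : Hpt n →ₗ[ℝ] ℝ := (LinearMap.proj j).comp (LinearMap.fst ℝ _ _)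

def projY (j : Fin n) : Hpt n →ₗ[ℝ] ℝ :=
  (LinearMap.proj j).comp ((LinearMap.fst ℝ _ _).comp (LinearMap.snd ℝ _ _))

def projT : Hpt n →ₗ[ℝ] ℝ := (LinearMap.snd ℝ _ _).comp (LinearMap.snd ℝ _ _)

/-- The contact form `θ = dt + ½Σⱼ(yⱼdxⱼ − xⱼdyⱼ)` at `p`, as a linear functional. -/
def thetaLin (p : Hpt n) : Hpt n →ₗ[ℝ] ℝ :=
  projT + (2:ℝ)⁻¹ • (∑ j : Fin n, (p.2.1 j • projX j - p.1 j • projY j))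

/-- A linear functional as a `1`-covector. -/
def cov1 (L : Hpt n →ₗ[ℝ] ℝ) : Cov n 1 :=
  AlternatingMap.ofSubsingleton ℝ (Hpt n) ℝ (0 : Fin 1) L

/-- `θ` as a `1`-covector. -/
def thetaC (p : Hpt n) : Cov n 1 := cov1 (thetaLin p)

/-- `dθ = −Σⱼ dxⱼ∧dyⱼ` as a (constant) `2`-covector. -/
def dthetaC : Cov n 2 := -∑ j : Fin n, cwedge (cov1 (projX j)) (cov1 (projY j))

/-- Membership in the Rumin ideal `ℐ^k = {λ∧θ + μ∧dθ}` at the point `p`. -/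
def memI {k : ℕ} (p : Hpt n) (ω : Cov n k) : Prop :=
  ∃ (a : Cov n (k-1)) (ω₂ : Cov n k) (h1 : (k-1)+1 = k),
    ω = covCast h1 (cwedge a (thetaC p)) + ω₂ ∧
    (ω₂ = 0 ∨ ∃ (b : Cov n (k-2)) (h2 : (k-2)+2 = k), ω₂ = covCast h2 (cwedge b dthetaC))

/-- Membership in `𝒥^k = {λ : λ∧θ = λ∧dθ = 0}` at the point `p`. -/
def memJ {k : ℕ} (p : Hpt n) (ω : Cov n k) : Prop :=
  cwedge ω (thetaC p) = 0 ∧ cwedge ω dthetaC = 0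

/-- A compactly supported smooth Heisenberg `k`-form on `O` (for `k ≤ n` the values are
representatives of classes modulo `ℐ^k`; for `k ≥ n+1` they lie in `𝒥^k`). -/
structure IsHFormD (k : ℕ) (O : Set (Hpt n)) (ω : Hpt n → Cov n k) : Prop where
  smooth : ∀ v : Fin k → Hpt n, ContDiff ℝ (⊤ : ℕ∞) fun p => ω p v
  cptSupp : ∃ K : Set (Hpt n), IsCompact K ∧ K ⊆ O ∧ ∀ p ∉ K, ω p = 0
  vert : n + 1 ≤ k → ∀ p, memJ p (ω p)

/-- Exterior derivative (as a raw multilinear expression):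
`dω_p(v₀,…,v_k) = Σᵢ (−1)ⁱ ∂_{vᵢ}(q ↦ ω_q(v₀,…,v̂ᵢ,…,v_k))(p)`. -/
def extD {k : ℕ} (ω : Hpt n → Cov n k) (p : Hpt n) (v : Fin (k+1) → Hpt n) : ℝ :=
  ∑ i : Fin (k+1), (-1 : ℝ)^(i:ℕ) * fderiv ℝ (fun q => ω q (v ∘ i.succAbove)) p (v i)

/-- `η` is the Rumin operator `D` applied to `ω` (only meaningful in degree `k = n`):
`Dω = d(ω − θ∧β)` where `β = L⁻¹((dω)_{𝔥₁})`, i.e. `β` is horizontal and `β∧dθ` agrees with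
`dω` on horizontal vectors. -/
def IsRuminD {k : ℕ} (ω : Hpt n → Cov n k) (η : Hpt n → (Fin (k+1) → Hpt n) → ℝ) : Prop :=
  ∃ (β : Hpt n → Cov n (k-1)) (h1 : 1 + (k-1) = k) (h2 : (k-1)+2 = k+1),
    (∀ v, ContDiff ℝ (⊤ : ℕ∞) fun p => β p v) ∧
    (∀ (p : Hpt n) (v : Fin (k-1) → Hpt n) (i : Fin (k-1)),
      v i = ((0:Fin n → ℝ), (0:Fin n → ℝ), (1:ℝ)) → β p v = 0) ∧
    (∀ (p : Hpt n) (v : Fin (k+1) → Hpt n), (∀ i, thetaLin p (v i) = 0) →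
      extD ω p v = covCast h2 (cwedge (β p) dthetaC) v) ∧
    η = extD (fun p => ω p - covCast h1 (cwedge (thetaC p) (β p)))

/-- The Rumin differential `d_c`: the exterior derivative in degree `k ≠ n`, the second order
operator `D` in the critical degree `k = n`. -/
def IsDc {k : ℕ} (ω : Hpt n → Cov n k) (η : Hpt n → (Fin (k+1) → Hpt n) → ℝ) : Prop :=
  if k = n then IsRuminD ω η else η = extD ω

/-- Degree cast for raw forms. -/
def rawCast {a b : ℕ} (h : a = b) (η : (Fin a → Hpt n) → ℝ) : (Fin b → Hpt n) → ℝ :=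
  fun v => η (fun i => v (Fin.cast h i))

/-! ## Orientations and currents -/

/-- `t` is a unit tangent `m`-vector of the `k`-codimensional `C¹_ℍ` submanifold `S` at `p`,
i.e. `t = ±*n^ℍ_S(p)`: `t` is the wedge of an orthonormal basis of `ker d_ℍf_p`
(in the left invariant frame). -/
def IsHTangentVecAt (k m : ℕ) (S : Set (Hpt n)) (p : Hpt n) (t : MVec n m) : Prop :=
  ∃ (U : Set (Hpt n)) (f : Fin k → Hpt n → ℝ), IsOpen U ∧ p ∈ U ∧
    (∀ i, IsC1H U (f i)) ∧
    (∀ q ∈ U, LinearIndependent ℝ (fun i => gradH (f i) q)) ∧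
    S ∩ U = {q ∈ U | ∀ i, f i q = 0} ∧
    ∃ v : Fin m → (Fin (2*n+1) → ℝ),
      (∀ i j, dotC (v i) (v j) = if i = j then 1 else 0) ∧
      (∀ i l, dotC (v i) (gradF (f l) p) = 0) ∧
      t = simpleWedge v

/-- An orientation of a `k`-codimensional `C¹_ℍ` submanifold: a continuous global choice of
the unit tangent `(2n+1−k)`-vector `t^ℍ_S` (here of formal degree `m`). -/
def IsHOrient (k m : ℕ) (S : Set (Hpt n)) (t : Hpt n → MVec n m) : Prop :=
  ContinuousOn t S ∧ ∀ p ∈ S, IsHTangentVecAt k m S p (t p)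

/-- Classical Euclidean unit tangent `m`-vector at a point of an `m`-dimensional submanifold
(coefficients in the coordinate basis). -/
def IsEuclTangentVecAt (m : ℕ) (S : Set (Hpt n)) (p : Hpt n) (t : MVec n m) : Prop :=
  ∃ v : Fin m → (Fin (2*n+1) → ℝ),
    (∀ i j, dotC (v i) (v j) = if i = j then 1 else 0) ∧
    (∀ i, rE (v i) ∈ tangentConeAt ℝ S p) ∧ t = simpleWedge v

/-- Classical (Euclidean) orientation of a low-dimensional submanifold. -/
def IsEuclOrient (m : ℕ) (S : Set (Hpt n)) (t : Hpt n → MVec n m) : Prop :=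
  ContinuousOn t S ∧ ∀ p ∈ S, IsEuclTangentVecAt m S p (t p)

/-- The standard vertical subgroup `𝕎` of codimension `k`. -/
def Wstd (n k : ℕ) : Set (Hpt n) := {p | ∀ i : Fin n, (i:ℕ) < k → p.1 i = 0}

/-- Embedding realizing `𝕎` as a Euclidean space. -/
def wEmbed (n k : ℕ) (a : ({i : Fin n // k ≤ (i:ℕ)} → ℝ) × (Fin n → ℝ) × ℝ) : Hpt n :=
  (fun i => if h : k ≤ (i:ℕ) then a.1 ⟨i, h⟩ else 0, a.2.1, a.2.2)

/-- Lebesgue measure `ℒ^{2n+1−k}` on the vertical subgroup `𝕎`. -/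
def wLeb (n k : ℕ) : Measure (Hpt n) := Measure.map (wEmbed n k) volume

/-- The geometric constant
`C_{n,k} = (sup{ℒ^{2n+1−k}(𝕎 ∩ U(p,1)) : p ∈ U(0,1)})⁻¹`. -/
def CnkC (D : HomDist n) (k : ℕ) : ℝ :=
  (sSup {v : ℝ | ∃ p ∈ hball D 0 1, v = (wLeb n k (Wstd n k ∩ hball D p 1)).toReal})⁻¹

/-- The Heisenberg current `⟦S⟧` of an oriented `k`-codimensional (`k ≤ n`) submanifold:
`⟦S⟧(ω) = (1/C_{n,k}) ∫_S ⟨t^ℍ_S | ω⟩ d𝒮^{Q−k}`. -/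
def currF (D : HomDist n) (k : ℕ) (S : Set (Hpt n)) (t : Hpt n → MVec n (2*n+1-k))
    (η : Hpt n → (Fin (2*n+1-k) → Hpt n) → ℝ) : ℝ :=
  (CnkC D k)⁻¹ * ∫ p in S, pairF (t p) p (η p) ∂(sphMeasure D ((2*n+2 : ℝ) - (k : ℝ)))

/-- The current of an oriented low-dimensional (`m ≤ n`) submanifold: the classical integral
`⟦S⟧(ω) = ∫_S ⟨τ_S | ω⟩ d𝓗^m_E`. -/
def currE {n : ℕ} (m : ℕ) (S : Set (Hpt n)) (t : Hpt n → MVec n m)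
    (η : Hpt n → (Fin m → Hpt n) → ℝ) : ℝ :=
  ∫ p in S, pairE (t p) (η p) ∂(muE n (m : ℝ))

/-- The Heisenberg current of an oriented `m`-dimensional submanifold (any `m`). -/
def hCurr (D : HomDist n) (m : ℕ) (S : Set (Hpt n)) (t : Hpt n → MVec n m)
    (η : Hpt n → (Fin m → Hpt n) → ℝ) : ℝ :=
  if m ≤ n then currE m S t η
  else if h2 : m ≤ 2*n+1 then
    currF D (2*n+1-m) S (fun p => mvCast (by omega) (t p)) (fun p => rawCast (by omega) (η p))
  else 0

/-- Orientation of an `m`-dimensional submanifold (any `m`): Euclidean in low dimension,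
the continuous unit tangent field `t^ℍ_S` in low codimension. -/
def IsOrientS (m : ℕ) (S : Set (Hpt n)) (t : Hpt n → MVec n m) : Prop :=
  if m ≤ n then IsEuclOrient m S t else IsHOrient (2*n+1-m) m S t

/-! ## Submanifolds with boundary -/

/-- The boundary `∂S = S̄ ∖ S`. -/
def bdry (S : Set (Hpt n)) : Set (Hpt n) := closure S \ S

/-- `S` is a `k`-codimensional `C¹_ℍ`-regular submanifold with boundary in `O`. -/
def IsC1HSubWithBdry (D : HomDist n) (k : ℕ) (O : Set (Hpt n)) (S : Set (Hpt n)) : Prop :=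
  (O ∩ S).Nonempty ∧ IsC1HSub k (O ∩ S) ∧
  (O ∩ bdry S).Nonempty ∧ IsC1HSub (k+1) (O ∩ bdry S) ∧
  ∀ p ∈ O ∩ bdry S, ∃ U : Set (Hpt n), IsOpen U ∧ p ∈ U ∧
    ∃ S' : Set (Hpt n), S' ⊆ U ∧ IsC1HSub k S' ∧ U ∩ closure S ⊆ S' ∧
      ∀ r : ℝ, 0 < r → (hball D p r ∩ (S' \ closure S)).Nonempty

/-- A family `f₁,…,f_{k+1}` of local defining functions at a boundary point `p`, as in the
characterization of `k`-codimensional submanifolds with boundary: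
`U ∩ S = {f₁ = ⋯ = f_k = 0, f_{k+1} > 0}` and `f_{k+1}(p) = 0`. -/
def IsBdryFrame (k : ℕ) (S : Set (Hpt n)) (p : Hpt n) (U : Set (Hpt n))
    (f : Fin (k+1) → Hpt n → ℝ) : Prop :=
  IsOpen U ∧ p ∈ U ∧ (∀ i, IsC1H U (f i)) ∧
  (∀ q ∈ U, LinearIndependent ℝ (fun i => gradH (f i) q)) ∧
  U ∩ S = {q ∈ U | (∀ i : Fin k, f i.castSucc q = 0) ∧ 0 < f (Fin.last k) q} ∧
  f (Fin.last k) p = 0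

/-! ## Smooth and Euclidean submanifolds -/

/-- `S` is a smooth (Euclidean `C^∞`) submanifold of codimension `k`. -/
def IsSmoothCodim (k : ℕ) (S : Set (Hpt n)) : Prop :=
  ∀ p ∈ S, ∃ U : Set (Hpt n), IsOpen U ∧ p ∈ U ∧ ∃ f : Fin k → Hpt n → ℝ,
    (∀ i, ContDiff ℝ (⊤ : ℕ∞) (f i)) ∧
    (∀ q ∈ U, LinearIndependent ℝ (fun i => fderiv ℝ (f i) q)) ∧
    S ∩ U = {q ∈ U | ∀ i, f i q = 0}

/-- `S` is a Euclidean `C¹` submanifold of codimension `k`. -/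
def IsC1ECodim (k : ℕ) (S : Set (Hpt n)) : Prop :=
  ∀ p ∈ S, ∃ U : Set (Hpt n), IsOpen U ∧ p ∈ U ∧ ∃ f : Fin k → Hpt n → ℝ,
    (∀ i, ContDiff ℝ 1 (f i)) ∧
    (∀ q ∈ U, LinearIndependent ℝ (fun i => fderiv ℝ (f i) q)) ∧
    S ∩ U = {q ∈ U | ∀ i, f i q = 0}

/-- `M` is a Euclidean `k`-dimensional `C¹` submanifold with boundary (`M` closed in its
charts; boundary charts are half-spaces). -/
def IsC1EuclSubWithBdryDim (k : ℕ) (M : Set (Hpt n)) : Prop :=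
  ∀ p ∈ M, ∃ (V : Set (Fin k → ℝ)) (φ : (Fin k → ℝ) → Hpt n) (U : Set (Hpt n)) (a : Fin k → ℝ)
      (i₀ : Fin k),
    IsOpen V ∧ IsOpen U ∧ p ∈ U ∧ a ∈ V ∧ φ a = p ∧
    ContDiffOn ℝ 1 φ V ∧ Set.InjOn φ V ∧
    (∀ b ∈ V, Function.Injective (fderivWithin ℝ φ V b)) ∧
    (M ∩ U = φ '' (V ∩ {x | 0 ≤ x i₀}) ∨ M ∩ U = φ '' V)

/-! ## Isometries -/

/-- A rotation of the horizontal layer: a linear group automorphism commuting with dilations,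
preserving the vertical coordinate and the horizontal Euclidean norm. -/
def IsRotation (R : Hpt n → Hpt n) : Prop :=
  IsLinearMap ℝ R ∧ (∀ p q, R (hmul p q) = hmul (R p) (R q)) ∧
  (∀ l p, R (hdil l p) = hdil l (R p)) ∧
  (∀ p, (R p).2.2 = p.2.2) ∧
  (∀ p, (∑ j, ((R p).1 j ^ 2 + (R p).2.1 j ^ 2)) = ∑ j, (p.1 j ^ 2 + p.2.1 j ^ 2))

/-- An isometry of `ℍⁿ`: the composition of a left translation and a rotation. -/
def IsHIsom (φ : Hpt n → Hpt n) : Prop :=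
  ∃ (g : Hpt n) (R : Hpt n → Hpt n), IsRotation R ∧ φ = fun p => hmul g (R p)

/-! ## Tangent cones and blow-ups -/

/-- The tangent cone `T^ℍ_0 E` at the origin. -/
def tangentConeH (E : Set (Hpt n)) : Set (Hpt n) :=
  {x | ∃ (xh : ℕ → Hpt n) (rh : ℕ → ℝ), (∀ h, xh h ∈ E) ∧ Tendsto rh atTop atTop ∧
        Tendsto (fun h => hdil (rh h) (xh h)) atTop (𝓝 x)}

/-- The tangent cone `T^ℍ_p E = T^ℍ_0(p⁻¹ ⬝ E)`. -/
def tangentConeHAt (E : Set (Hpt n)) (p : Hpt n) : Set (Hpt n) :=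
  tangentConeH ((fun q => hmul (hinv p) q) '' E)

/-- Local Hausdorff convergence of the sets `F l` to `E` as `l → 0⁺`, with respect to the
homogeneous distance `D`. -/
def LocHausConv (D : HomDist n) (F : ℝ → Set (Hpt n)) (E : Set (Hpt n)) : Prop :=
  ∀ (c : Hpt n) (R ε : ℝ), 0 < R → 0 < ε → ∃ l0 : ℝ, 0 < l0 ∧ ∀ l : ℝ, 0 < l → l < l0 →
    (∀ x ∈ F l ∩ {q | D.d c q ≤ R}, ∃ e ∈ E, D.d x e < ε) ∧
    (∀ x ∈ E ∩ {q | D.d c q ≤ R}, ∃ y ∈ F l, D.d x y < ε)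

/-! ## Induced orientation on the boundary -/

/-- `tB` is the value at `p ∈ ∂S` of the orientation induced on `∂S` by the orientation `tS`
of the `m`-dimensional submanifold with boundary `S`. -/
def InducedBdryOrientAt (D : HomDist n) (m : ℕ) (S : Set (Hpt n)) (p : Hpt n)
    (tS : MVec n m) (tB : MVec n (m-1)) : Prop :=
  if m ≤ n then
    -- low dimension: classical Euclidean induced orientation via the outward normal
    ∃ (νc : Fin (2*n+1) → ℝ) (w : Fin (m-1) → (Fin (2*n+1) → ℝ)) (h : (m-1)+1 = m),
      (∀ i j : Fin ((m-1)+1), dotC (Matrix.vecCons νc w i) (Matrix.vecCons νc w j) = if i = j then 1 else 0) ∧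
      rE νc ∉ tangentConeAt ℝ (closure S) p ∧
      -(rE νc) ∈ tangentConeAt ℝ (closure S) p ∧
      (∀ i, rE (w i) ∈ tangentConeAt ℝ (bdry S) p) ∧
      tB = simpleWedge w ∧ tS = mvCast h (simpleWedge (Matrix.vecCons νc w))
  else if m = n+1 then
    -- critical codimension: `±T ∧ τ_{∂S} = t^ℍ_S` according to whether `S` lies below/above ∂S
    ∃ (U : Set (Hpt n)) (f : Fin n → Hpt n → ℝ), IsOpen U ∧ p ∈ U ∧
      (∀ i, IsC1H U (f i)) ∧ (∀ q ∈ U, LinearIndependent ℝ (fun i => gradH (f i) q)) ∧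
      U ∩ closure S ⊆ {q ∈ U | ∀ i, f i q = 0} ∧
      (∀ r : ℝ, 0 < r →
        (hball D p r ∩ ({q ∈ U | ∀ i, f i q = 0} \ closure S)).Nonempty) ∧
      ∃ (ε : ℝ) (w : Fin (m-1) → (Fin (2*n+1) → ℝ)) (h : (m-1)+1 = m),
        (ε = 1 ∨ ε = -1) ∧
        (∀ i j, dotC (w i) (w j) = if i = j then 1 else 0) ∧
        (∀ i, w i ⟨2*n, by omega⟩ = 0) ∧
        (∀ i, rF (w i) p ∈ tangentConeAt ℝ (bdry S) p) ∧
        -- `ε = −1` iff `S` lies above its boundary around `p`: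
        -- the blow-up of `S` at `p` is the corresponding open half of `T^ℍ_pS`
        LocHausConv D (fun l => (fun q => hdil l⁻¹ (hmul (hinv p) q)) '' S)
          ({v | ∀ i, pansuD (f i) p v = 0} ∩ {q | 0 < (-ε) * q.2.2}) ∧
        tB = simpleWedge (fun i => toEc (rF (w i) p)) ∧
        tS = mvCast h (simpleWedge (Matrix.vecCons (fun j => if (j:ℕ) = 2*n then ε else 0) w))
  else
    -- non-critical low codimension: `ν_{∂S} ∧ t^ℍ_{∂S} = t^ℍ_S` with `ν` the outward normal
    ∃ (U : Set (Hpt n)) (f : Fin (2*n+1-m+1) → Hpt n → ℝ),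
      IsBdryFrame (2*n+1-m) S p U f ∧
      ∃ (νc : Fin (2*n+1) → ℝ) (w : Fin (m-1) → (Fin (2*n+1) → ℝ)) (h : (m-1)+1 = m),
        (∀ i j : Fin ((m-1)+1), dotC (Matrix.vecCons νc w i) (Matrix.vecCons νc w j) = if i = j then 1 else 0) ∧
        (∀ i : Fin (2*n+1-m), pansuD (f i.castSucc) p (rE νc) = 0) ∧
        pansuD (f (Fin.last (2*n+1-m))) p (rE νc) < 0 ∧
        (∀ i, ∀ l : Fin (2*n+1-m+1), pansuD (f l) p (rE (w i)) = 0) ∧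
        tB = simpleWedge w ∧ tS = mvCast h (simpleWedge (Matrix.vecCons νc w))

/-! ## Miscellaneous -/

/-- The projection `π_p(q) = Σⱼ xⱼXⱼ(p) + Σⱼ yⱼYⱼ(p) ∈ H_pℍⁿ`. -/
def piProj (p q : Hpt n) : Hpt n :=
  (∑ j : Fin n, q.1 j • frameVec ⟨(j:ℕ), by omega⟩ p) +
  (∑ j : Fin n, q.2.1 j • frameVec ⟨n + (j:ℕ), by omega⟩ p)

/-- The norm `|·|_p` on the horizontal fibre `H_pℍⁿ` making `X₁(p),…,Yₙ(p)` orthonormal. -/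
def hnormAt (_p : Hpt n) (v : Hpt n) : ℝ :=
  Real.sqrt (∑ j, ((v.1 j) ^ 2 + (v.2.1 j) ^ 2))

/-- The left-invariant scalar product making `X₁,…,Yₙ,T` orthonormal. -/
def dotH (v w : Hpt n) : ℝ :=
  (∑ j, v.1 j * w.1 j) + (∑ j, v.2.1 j * w.2.1 j) + v.2.2 * w.2.2

end Heis
end


open MeasureTheory Topology Filter Set ENNReal
set_option autoImplicit false
noncomputable section
namespace Heis
variable {n : ℕ}

/-! ### Group algebra -/

lemma hmul_fst (p q : Hpt n) : (hmul p q).1 = p.1 + q.1 := rfl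
lemma hmul_snd (p q : Hpt n) : (hmul p q).2.1 = p.2.1 + q.2.1 := rfl
lemma hmul_t (p q : Hpt n) : (hmul p q).2.2 =
    p.2.2 + q.2.2 + (∑ j, p.1 j * q.2.1 j) / 2 - (∑ j, q.1 j * p.2.1 j) / 2 := rfl

lemma hpt_ext {p q : Hpt n} (h1 : p.1 = q.1) (h2 : p.2.1 = q.2.1) (h3 : p.2.2 = q.2.2) :
    p = q := Prod.ext h1 (Prod.ext h2 h3)

lemma hmul_assoc' (p q r : Hpt n) : hmul (hmul p q) r = hmul p (hmul q r) := by
  refine hpt_ext ?_ ?_ ?_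
  · simp only [hmul_fst, add_assoc]
  · simp only [hmul_snd, add_assoc]
  · simp only [hmul_t, hmul_fst, hmul_snd, Pi.add_apply, add_mul, mul_add,
      Finset.sum_add_distrib]
    ring

@[simp] lemma hmul_zero' (p : Hpt n) : hmul p 0 = p := by
  refine hpt_ext ?_ ?_ ?_ <;> simp [hmul]

@[simp] lemma zero_hmul' (p : Hpt n) : hmul 0 p = p := by
  refine hpt_ext ?_ ?_ ?_ <;> simp [hmul]

@[simp] lemma hmul_hinv (p : Hpt n) : hmul p (hinv p) = 0 := by
  refine hpt_ext ?_ ?_ ?_ <;> simp [hmul, hinv]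

@[simp] lemma hinv_hmul (p : Hpt n) : hmul (hinv p) p = 0 := by
  refine hpt_ext ?_ ?_ ?_ <;> simp [hmul, hinv]

@[simp] lemma hinv_hmul_cancel (p q : Hpt n) : hmul (hinv p) (hmul p q) = q := by
  rw [← hmul_assoc', hinv_hmul, zero_hmul']

@[simp] lemma hmul_hinv_cancel (p q : Hpt n) : hmul p (hmul (hinv p) q) = q := by
  rw [← hmul_assoc', hmul_hinv, zero_hmul']

lemma hinv_mul (p q : Hpt n) : hinv (hmul p q) = hmul (hinv q) (hinv p) := by
  refine hpt_ext ?_ ?_ ?_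
  · simp [hmul, hinv, add_comm]
  · simp [hmul, hinv, add_comm]
  · simp only [hmul_t, hinv, Pi.neg_apply, neg_mul_neg]
    ring

@[simp] lemma hinv_hinv (p : Hpt n) : hinv (hinv p) = p := by
  refine hpt_ext ?_ ?_ ?_ <;> simp [hinv]

@[simp] lemma hinv_zero : hinv (0 : Hpt n) = 0 := by
  refine hpt_ext ?_ ?_ ?_ <;> simp [hinv]

lemma hdil_hmul (l : ℝ) (p q : Hpt n) : hdil l (hmul p q) = hmul (hdil l p) (hdil l q) := by
  refine hpt_ext ?_ ?_ ?_
  · simp [hmul, hdil]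
  · simp [hmul, hdil]
  · simp only [hmul_t, hdil, Pi.smul_apply, smul_eq_mul]
    have h1 : ∀ a b : Fin n → ℝ, ∑ j, l * a j * (l * b j) = l ^ 2 * ∑ j, a j * b j := by
      intro a b
      rw [Finset.mul_sum]
      exact Finset.sum_congr rfl fun j _ => by ring
    rw [h1, h1]
    ring

lemma hdil_hdil (l m : ℝ) (p : Hpt n) : hdil l (hdil m p) = hdil (l * m) p := by
  refine hpt_ext ?_ ?_ ?_
  · simp [hdil, mul_smul]
  · simp [hdil, mul_smul]
  · simp only [hdil]; ring

@[simp] lemma hdil_one (p : Hpt n) : hdil 1 p = p := by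
  refine hpt_ext ?_ ?_ ?_ <;> simp [hdil]

@[simp] lemma hdil_zero (l : ℝ) : hdil l (0 : Hpt n) = 0 := by
  refine hpt_ext ?_ ?_ ?_ <;> simp [hdil]

lemma hdil_inv_cancel {l : ℝ} (hl : l ≠ 0) (p : Hpt n) : hdil l (hdil l⁻¹ p) = p := by
  rw [hdil_hdil, mul_inv_cancel₀ hl, hdil_one]

lemma hdil_inv_cancel' {l : ℝ} (hl : l ≠ 0) (p : Hpt n) : hdil l⁻¹ (hdil l p) = p := by
  rw [hdil_hdil, inv_mul_cancel₀ hl, hdil_one]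

lemma hinv_hdil (l : ℝ) (p : Hpt n) : hinv (hdil l p) = hdil l (hinv p) := by
  refine hpt_ext ?_ ?_ ?_ <;> simp [hdil, hinv]

lemma continuous_hmul2 : Continuous fun z : Hpt n × Hpt n => hmul z.1 z.2 := by
  unfold hmul; fun_prop

lemma Continuous.hmul' {X : Type*} [TopologicalSpace X] {f g : X → Hpt n} (hf : Continuous f)
    (hg : Continuous g) : Continuous fun x => hmul (f x) (g x) :=
  continuous_hmul2.comp (hf.prodMk hg)

lemma continuous_hinv : Continuous (hinv : Hpt n → Hpt n) := by
  unfold hinv; fun_prop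

lemma continuous_hdil (l : ℝ) : Continuous (hdil l : Hpt n → Hpt n) := by
  unfold hdil; fun_prop

lemma continuous_hdil2 : Continuous fun z : ℝ × Hpt n => hdil z.1 z.2 := by
  unfold hdil; fun_prop

/-! ### The homogeneous norm -/

/-- homogeneous norm -/
def nm (D : HomDist n) (p : Hpt n) : ℝ := D.d 0 p

lemma d_self (D : HomDist n) (p : Hpt n) : D.d p p = 0 := (D.eq_iff p p).2 rfl

lemma d_nonneg (D : HomDist n) (p q : Hpt n) : 0 ≤ D.d p q := by
  have h := D.triangle p q p
  rw [d_self, D.symm q p] at h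
  linarith

lemma d_eq_nm (D : HomDist n) (p q : Hpt n) : D.d p q = nm D (hmul (hinv p) q) := by
  rw [nm, ← D.leftInv (hinv p) p q, hinv_hmul]

lemma nm_nonneg (D : HomDist n) (p : Hpt n) : 0 ≤ nm D p := d_nonneg D 0 p

@[simp] lemma nm_zero (D : HomDist n) : nm D 0 = 0 := d_self D 0

lemma nm_eq_zero (D : HomDist n) {p : Hpt n} : nm D p = 0 ↔ p = 0 := by
  rw [nm, D.eq_iff]; exact eq_comm

lemma nm_mul_le (D : HomDist n) (p q : Hpt n) : nm D (hmul p q) ≤ nm D p + nm D q := by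
  have h := D.triangle 0 p (hmul p q)
  rwa [d_eq_nm D p, hinv_hmul_cancel] at h

@[simp] lemma nm_hinv (D : HomDist n) (p : Hpt n) : nm D (hinv p) = nm D p := by
  have h := D.leftInv (hinv p) p 0
  rw [hinv_hmul, hmul_zero'] at h
  rw [nm, h, D.symm, nm]

lemma nm_hdil (D : HomDist n) {l : ℝ} (hl : 0 < l) (p : Hpt n) :
    nm D (hdil l p) = l * nm D p := by
  have := D.homog l hl 0 p
  rwa [hdil_zero] at this

lemma d_hmul_right (D : HomDist n) (p h : Hpt n) : D.d p (hmul p h) = nm D h := by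
  rw [d_eq_nm, hinv_hmul_cancel]

/-- explicit quasi-norm -/
def qn (p : Hpt n) : ℝ := ‖p.1‖ + ‖p.2.1‖ + √|p.2.2|

lemma qn_nonneg (p : Hpt n) : 0 ≤ qn p := by unfold qn; positivity

lemma continuous_qn : Continuous (qn : Hpt n → ℝ) := by unfold qn; fun_prop

lemma qn_hdil {l : ℝ} (hl : 0 < l) (p : Hpt n) : qn (hdil l p) = l * qn p := by
  simp only [qn, hdil, norm_smul, Real.norm_eq_abs, abs_mul, abs_pow, abs_of_pos hl]
  rw [Real.sqrt_mul (by positivity), Real.sqrt_sq hl.le]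
  ring

lemma qn_eq_zero {p : Hpt n} (h : qn p = 0) : p = 0 := by
  unfold qn at h
  have h1 := norm_nonneg p.1
  have h2 := norm_nonneg p.2.1
  have h3 := Real.sqrt_nonneg |p.2.2|
  refine hpt_ext ?_ ?_ ?_
  · exact norm_eq_zero.1 (by linarith)
  · exact norm_eq_zero.1 (by linarith)
  · have : √|p.2.2| = 0 := by linarith
    rw [Real.sqrt_eq_zero (abs_nonneg _)] at this
    exact abs_eq_zero.1 this

lemma nm_horiz (D : HomDist n) (hn : 1 ≤ n) (p : Hpt n) (hp : p.2.2 = 0) :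
    nm D p = √(∑ j, (p.1 j ^ 2 + p.2.1 j ^ 2)) * nm D ((Pi.single ⟨0, hn⟩ 1, 0, 0) : Hpt n) := by
  set r := √(∑ j, (p.1 j ^ 2 + p.2.1 j ^ 2)) with hr
  have hnn : 0 ≤ ∑ j, (p.1 j ^ 2 + p.2.1 j ^ 2) := Finset.sum_nonneg fun j _ => by positivity
  have hrsq : r ^ 2 = ∑ j, (p.1 j ^ 2 + p.2.1 j ^ 2) := Real.sq_sqrt hnn
  have key : nm D p = nm D (hdil r ((Pi.single ⟨0, hn⟩ 1, 0, 0) : Hpt n)) := by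
    refine D.rotInv _ _ ?_ ?_
    · rw [← hrsq]
      simp [hdil, Pi.single_apply]
    · simp [hdil, hp]
  rw [key]
  rcases (Real.sqrt_nonneg _ : 0 ≤ r).eq_or_lt with h0 | h0
  · rw [show r = 0 from h0.symm]
    have : hdil 0 ((Pi.single ⟨0, hn⟩ 1, 0, 0) : Hpt n) = 0 := by
      refine hpt_ext ?_ ?_ ?_ <;> simp [hdil]
    rw [this]; simp
  · exact nm_hdil D h0 _

lemma nm_vert (D : HomDist n) (t : ℝ) :
    nm D ((0, 0, t) : Hpt n) ≤
      √|t| * (nm D ((0, 0, 1) : Hpt n) + nm D ((0, 0, -1) : Hpt n)) := by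
  have h1 := nm_nonneg D ((0, 0, 1) : Hpt n)
  have h2 := nm_nonneg D ((0, 0, -1) : Hpt n)
  rcases lt_trichotomy t 0 with h | h | h
  · have : ((0, 0, t) : Hpt n) = hdil (√|t|) (0, 0, -1) := by
      refine hpt_ext ?_ ?_ ?_ <;> simp [hdil, abs_of_neg h, Real.sq_sqrt (neg_nonneg.2 h.le)]
    rw [this, nm_hdil D (by rw [Real.sqrt_pos]; exact abs_pos.2 h.ne)]
    have := Real.sqrt_nonneg |t|
    nlinarith
  · subst h
    have : ((0, 0, 0) : Hpt n) = 0 := rfl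
    simp [this]
  · have : ((0, 0, t) : Hpt n) = hdil (√|t|) (0, 0, 1) := by
      refine hpt_ext ?_ ?_ ?_ <;> simp [hdil, abs_of_pos h, Real.sq_sqrt h.le]
    rw [this, nm_hdil D (by rw [Real.sqrt_pos]; exact abs_pos.2 h.ne')]
    have := Real.sqrt_nonneg |t|
    nlinarith

lemma exists_nm_le_qn (D : HomDist n) (hn : 1 ≤ n) : ∃ C > 0, ∀ p, nm D p ≤ C * qn p := by
  set a := nm D ((Pi.single ⟨0, hn⟩ 1, 0, 0) : Hpt n)
  set b := nm D ((0, 0, 1) : Hpt n) + nm D ((0, 0, -1) : Hpt n)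
  have ha : 0 ≤ a := nm_nonneg _ _
  have hb : 0 ≤ b := add_nonneg (nm_nonneg _ _) (nm_nonneg _ _)
  refine ⟨n * a + b + 1, by positivity, fun p => ?_⟩
  have hp : p = hmul ((p.1, p.2.1, 0) : Hpt n) (0, 0, p.2.2) := by
    refine hpt_ext ?_ ?_ ?_ <;> simp [hmul]
  have h1 : nm D p ≤ nm D ((p.1, p.2.1, 0) : Hpt n) + nm D ((0, 0, p.2.2) : Hpt n) := by
    conv_lhs => rw [hp]
    exact nm_mul_le _ _ _
  have h2 := nm_horiz D hn ((p.1, p.2.1, 0) : Hpt n) rfl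
  have h3 := nm_vert D p.2.2
  have h4 : √(∑ j, (p.1 j ^ 2 + p.2.1 j ^ 2)) ≤ n * (‖p.1‖ + ‖p.2.1‖) := by
    rw [Real.sqrt_le_left (by positivity)]
    calc ∑ j, (p.1 j ^ 2 + p.2.1 j ^ 2) ≤ ∑ j : Fin n, (‖p.1‖ + ‖p.2.1‖) ^ 2 := by
          refine Finset.sum_le_sum fun j _ => ?_
          have e1 : p.1 j ^ 2 ≤ ‖p.1‖ ^ 2 := by
            rw [← sq_abs]; gcongr; exact norm_le_pi_norm p.1 j
          have e2 : p.2.1 j ^ 2 ≤ ‖p.2.1‖ ^ 2 := by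
            rw [← sq_abs]; gcongr; exact norm_le_pi_norm p.2.1 j
          nlinarith [mul_nonneg (norm_nonneg p.1) (norm_nonneg p.2.1)]
      _ = n * (‖p.1‖ + ‖p.2.1‖) ^ 2 := by simp
      _ ≤ (n * (‖p.1‖ + ‖p.2.1‖)) ^ 2 := by
          rw [mul_pow]
          have : (1:ℝ) ≤ n := by exact_mod_cast hn
          gcongr
          nlinarith
  have h5 := Real.sqrt_nonneg |p.2.2|
  have h6 := norm_nonneg p.1
  have h7 := norm_nonneg p.2.1
  have h8 : √(∑ j, (p.1 j ^ 2 + p.2.1 j ^ 2)) * a ≤ n * (‖p.1‖ + ‖p.2.1‖) * a := by gcongr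
  change nm D ((p.1, p.2.1, 0) : Hpt n) = √(∑ j, (p.1 j ^ 2 + p.2.1 j ^ 2)) * a at h2
  unfold qn
  have h9 : (0:ℝ) ≤ n * a := by positivity
  have e : (n * a + b + 1) * (‖p.1‖ + ‖p.2.1‖ + √|p.2.2|) =
    n * (‖p.1‖ + ‖p.2.1‖) * a + √|p.2.2| * b + (n * a * √|p.2.2| + (b + 1) * (‖p.1‖ + ‖p.2.1‖)
      + √|p.2.2|) := by ring
  rw [e]
  have : 0 ≤ n * a * √|p.2.2| + (b + 1) * (‖p.1‖ + ‖p.2.1‖) + √|p.2.2| := by positivity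
  linarith

lemma nm_sub_le (D : HomDist n) (p q : Hpt n) : |nm D p - nm D q| ≤ nm D (hmul (hinv p) q) := by
  rw [← d_eq_nm]
  have h1 := D.triangle 0 p q
  have h2 := D.triangle 0 q p
  rw [D.symm q p] at h2
  unfold nm
  rw [abs_le]; constructor <;> linarith

lemma continuous_nm (D : HomDist n) (hn : 1 ≤ n) : Continuous (nm D) := by
  obtain ⟨C, hC, h⟩ := exists_nm_le_qn D hn
  rw [continuous_iff_continuousAt]
  intro p
  rw [ContinuousAt, tendsto_iff_dist_tendsto_zero]
  have h0 : Tendsto (fun q => C * qn (hmul (hinv p) q)) (𝓝 p) (𝓝 0) := by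
    have : Continuous fun q => C * qn (hmul (hinv p) q) :=
      continuous_const.mul (continuous_qn.comp (Continuous.hmul' continuous_const continuous_id))
    have h2 := this.tendsto p
    simpa [qn] using h2
  refine squeeze_zero (fun _ => dist_nonneg) (fun q => ?_) h0
  rw [dist_comm, Real.dist_eq]
  exact (nm_sub_le D p q).trans (h _)

lemma exists_qn_le_nm (D : HomDist n) (hn : 1 ≤ n) : ∃ C > 0, ∀ p, qn p ≤ C * nm D p := by
  have hcomp : IsCompact {p : Hpt n | qn p = 1} := by
    refine Metric.isCompact_of_isClosed_isBounded
      (isClosed_eq continuous_qn continuous_const) ?_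
    refine (Metric.isBounded_closedBall (x := (0 : Hpt n)) (r := 1)).subset fun p hp => ?_
    rw [mem_closedBall_zero_iff]
    have hp' : ‖p.1‖ + ‖p.2.1‖ + √|p.2.2| = 1 := hp
    have h1 := norm_nonneg p.1
    have h2 := norm_nonneg p.2.1
    have h3 := Real.sqrt_nonneg |p.2.2|
    have h4 : |p.2.2| ≤ 1 := by
      have : √|p.2.2| ≤ 1 := by linarith
      rwa [Real.sqrt_le_one] at this
    simp only [Prod.norm_def, sup_le_iff]
    exact ⟨by linarith, by linarith, h4⟩
  have hne : ({p : Hpt n | qn p = 1}).Nonempty := ⟨(0, 0, 1), by simp [qn]⟩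
  obtain ⟨p0, hp0, hmin⟩ := hcomp.exists_isMinOn hne (continuous_nm D hn).continuousOn
  have hpos : 0 < nm D p0 := by
    refine lt_of_le_of_ne (nm_nonneg _ _) fun h => ?_
    have : p0 = 0 := (nm_eq_zero D).1 h.symm
    rw [this] at hp0
    simp [qn] at hp0
  refine ⟨(nm D p0)⁻¹, by positivity, fun p => ?_⟩
  rcases (qn_nonneg p).eq_or_lt with h | h
  · rw [← h]; have := nm_nonneg D p; positivity
  · have h1 : qn (hdil (qn p)⁻¹ p) = 1 := by
      rw [qn_hdil (by positivity), inv_mul_cancel₀ h.ne']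
    have h2 : nm D p0 ≤ nm D (hdil (qn p)⁻¹ p) := hmin h1
    rw [nm_hdil D (by positivity), inv_mul_eq_div, le_div_iff₀ h] at h2
    rw [inv_mul_eq_div, le_div_iff₀ hpos]
    linarith

lemma continuous_d (D : HomDist n) (hn : 1 ≤ n) :
    Continuous fun z : Hpt n × Hpt n => D.d z.1 z.2 := by
  simp only [d_eq_nm]
  exact (continuous_nm D hn).comp
    (Continuous.hmul' (continuous_hinv.comp continuous_fst) continuous_snd)

lemma isOpen_hball (D : HomDist n) (hn : 1 ≤ n) (p : Hpt n) (r : ℝ) : IsOpen (hball D p r) :=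
  isOpen_lt ((continuous_d D hn).comp (continuous_const.prodMk continuous_id)) continuous_const

lemma mem_hball (D : HomDist n) (p q : Hpt n) (r : ℝ) : q ∈ hball D p r ↔ D.d p q < r := Iff.rfl

lemma hball_mem_nhds (D : HomDist n) (hn : 1 ≤ n) (p : Hpt n) {r : ℝ} (hr : 0 < r) :
    hball D p r ∈ 𝓝 p :=
  (isOpen_hball D hn p r).mem_nhds (by rw [mem_hball, d_self]; exact hr)

/-- norm convergence to zero of `nm` forces topological convergence -/
lemma exists_nm_ball_subset (D : HomDist n) (hn : 1 ≤ n) {s : Set (Hpt n)} (hs : s ∈ 𝓝 0) :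
    ∃ r > 0, ∀ p, nm D p < r → p ∈ s := by
  obtain ⟨C, hC, h⟩ := exists_qn_le_nm D hn
  obtain ⟨ε, hε, hεs⟩ := Metric.mem_nhds_iff.1 hs
  refine ⟨min ε 1 / (2 * C) , by positivity, fun p hp => hεs ?_⟩
  have hp2 : C * nm D p < min ε 1 := by
    rw [lt_div_iff₀ (by positivity)] at hp
    have := nm_nonneg D p
    nlinarith
  have h1 := (h p).trans_lt hp2
  rw [mem_ball_zero_iff]
  have e1 := norm_nonneg p.1
  have e2 := norm_nonneg p.2.1
  have e3 := Real.sqrt_nonneg |p.2.2|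
  have m1 := min_le_left ε 1
  have m2 := min_le_right ε 1
  unfold qn at h1
  have e4 : |p.2.2| ≤ √|p.2.2| := by
    have h5 : √|p.2.2| * √|p.2.2| = |p.2.2| := Real.mul_self_sqrt (abs_nonneg _)
    have h6 : √|p.2.2| ≤ 1 := by linarith
    nlinarith
  simp only [Prod.norm_def, sup_lt_iff]
  exact ⟨by linarith, by linarith, by rw [Real.norm_eq_abs]; linarith⟩

lemma exists_hball_subset (D : HomDist n) (hn : 1 ≤ n) {p : Hpt n} {s : Set (Hpt n)}
    (hs : s ∈ 𝓝 p) : ∃ r > 0, hball D p r ⊆ s := by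
  have h0 : (fun h => hmul p h) ⁻¹' s ∈ 𝓝 (0 : Hpt n) := by
    have : Continuous fun h => hmul p h := Continuous.hmul' continuous_const continuous_id
    apply this.continuousAt
    simpa using hs
  obtain ⟨r, hr, h⟩ := exists_nm_ball_subset D hn h0
  refine ⟨r, hr, fun q hq => ?_⟩
  rw [mem_hball, d_eq_nm] at hq
  have := h _ hq
  simpa using this

/-- closed balls are compact -/
lemma isCompact_closed_hball (D : HomDist n) (hn : 1 ≤ n) (p : Hpt n) (r : ℝ) :
    IsCompact {q | D.d p q ≤ r} := by
  have hc0 : IsCompact {h : Hpt n | nm D h ≤ r} := by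
    obtain ⟨C, hC, h⟩ := exists_qn_le_nm D hn
    refine Metric.isCompact_of_isClosed_isBounded
      (isClosed_le (continuous_nm D hn) continuous_const) ?_
    refine (Metric.isBounded_closedBall (x := (0 : Hpt n)) (r := C * r + (C * r) ^ 2)).subset
      fun q hq => ?_
    rw [mem_closedBall_zero_iff]
    have hq' : nm D q ≤ r := hq
    have h0 : qn q ≤ C * r := (h q).trans (by gcongr)
    have e1 := norm_nonneg q.1
    have e2 := norm_nonneg q.2.1
    have e3 := Real.sqrt_nonneg |q.2.2|
    have h5 : √|q.2.2| ^ 2 = |q.2.2| := Real.sq_sqrt (abs_nonneg _)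
    unfold qn at h0
    have h6 : √|q.2.2| ^ 2 ≤ (C * r) ^ 2 := by gcongr; linarith
    have h7 : 0 ≤ (C * r) ^ 2 := by positivity
    simp only [Prod.norm_def, sup_le_iff]
    exact ⟨by linarith, by linarith, by rw [Real.norm_eq_abs]; linarith⟩
  have : {q | D.d p q ≤ r} = (fun h => hmul p h) '' {h : Hpt n | nm D h ≤ r} := by
    ext q
    simp only [mem_setOf_eq, mem_image, d_eq_nm]
    constructor
    · intro h; exact ⟨_, h, by simp⟩
    · rintro ⟨h, hh, rfl⟩; simpa using hh
  rw [this]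
  exact hc0.image (Continuous.hmul' continuous_const continuous_id)

/-- The Heisenberg group with the metric given by `D`. -/
def HD (_D : HomDist n) : Type := Hpt n

instance (D : HomDist n) : TopologicalSpace (HD D) := inferInstanceAs (TopologicalSpace (Hpt n))
instance (D : HomDist n) : MeasurableSpace (HD D) := inferInstanceAs (MeasurableSpace (Hpt n))
instance (D : HomDist n) : BorelSpace (HD D) := inferInstanceAs (BorelSpace (Hpt n))
instance (D : HomDist n) : SecondCountableTopology (HD D) :=
  inferInstanceAs (SecondCountableTopology (Hpt n))

/-- the metric structure on `HD D`, with the topology unchanged -/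
@[reducible] def hdMetric (D : HomDist n) (hn : 1 ≤ n) : MetricSpace (HD D) :=
  MetricSpace.ofDistTopology (fun p q => D.d p q) (fun p => d_self D p) (fun p q => D.symm p q)
    (fun p q r => D.triangle p q r)
    (fun s => by
      constructor
      · intro hs x hx
        obtain ⟨r, hr, h⟩ := exists_hball_subset D hn (IsOpen.mem_nhds (X := Hpt n) hs hx)
        exact ⟨r, hr, fun y hy => h hy⟩
      · intro h
        refine isOpen_iff_mem_nhds.2 fun x hx => ?_
        obtain ⟨r, hr, hs⟩ := h x hx
        exact Filter.mem_of_superset (hball_mem_nhds D hn x hr) (fun y hy => hs y hy))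
    (fun p q h => (D.eq_iff p q).1 h)

end Heis
end


open MeasureTheory Topology Filter Set ENNReal
set_option autoImplicit false
noncomputable section
namespace Heis
variable {n : ℕ}

/-! ### Invariance of Lebesgue measure -/

lemma mp_shear (a b : Fin n → ℝ) (u : (Fin n → ℝ) → (Fin n → ℝ) → ℝ)
    (hu : Continuous fun z : (Fin n → ℝ) × (Fin n → ℝ) => u z.1 z.2) :
    MeasurePreserving (fun q : Hpt n => ((q.1 + a, q.2.1 + b, q.2.2 + u q.1 q.2.1) : Hpt n))
      volume volume := by
  refine MeasurePreserving.skew_product (f := fun x : Fin n → ℝ => x + a)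
    (g := fun x (z : (Fin n → ℝ) × ℝ) => (z.1 + b, z.2 + u x z.1))
    (measurePreserving_add_right volume a) ?_ ?_
  · refine Continuous.measurable ?_
    have : Continuous fun z : (Fin n → ℝ) × (Fin n → ℝ) × ℝ => u z.1 z.2.1 :=
      hu.comp (continuous_fst.prodMk (continuous_fst.comp continuous_snd))
    exact ((continuous_fst.comp continuous_snd).add continuous_const).prodMk
      ((continuous_snd.comp continuous_snd).add this)
  · refine Filter.Eventually.of_forall fun x => ?_
    refine (MeasurePreserving.skew_product (f := fun y : Fin n → ℝ => y + b)
      (g := fun y (t : ℝ) => t + u x y) (measurePreserving_add_right volume b) ?_ ?_).map_eq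
    · refine Continuous.measurable ?_
      have : Continuous fun z : (Fin n → ℝ) × ℝ => u x z.1 :=
        hu.comp (continuous_const.prodMk continuous_fst)
      exact continuous_snd.add this
    · exact Filter.Eventually.of_forall fun y => (measurePreserving_add_right volume (u x y)).map_eq

lemma mp_left (p : Hpt n) : MeasurePreserving (fun q : Hpt n => hmul p q) volume volume := by
  have h := mp_shear p.1 p.2.1
    (fun x y => p.2.2 + (∑ j, p.1 j * y j) / 2 - (∑ j, x j * p.2.1 j) / 2) (by fun_prop)
  convert h using 2 with q
  refine hpt_ext ?_ ?_ ?_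
  · simp [hmul, add_comm]
  · simp [hmul, add_comm]
  · simp only [hmul_t]; ring

lemma mp_right (p : Hpt n) : MeasurePreserving (fun q : Hpt n => hmul q p) volume volume := by
  have h := mp_shear p.1 p.2.1
    (fun x y => p.2.2 + (∑ j, x j * p.2.1 j) / 2 - (∑ j, p.1 j * y j) / 2) (by fun_prop)
  convert h using 2 with q
  refine hpt_ext ?_ ?_ ?_
  · simp [hmul]
  · simp [hmul]
  · simp only [hmul_t]; ring

lemma map_hdil {l : ℝ} (hl : 0 < l) :
    Measure.map (hdil l) (volume : Measure (Hpt n)) =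
      ENNReal.ofReal ((l ^ (2 * n + 2))⁻¹) • volume := by
  have e1 : Measure.map (fun x : Fin n → ℝ => l • x) volume
      = ENNReal.ofReal ((l ^ n)⁻¹) • volume := by
    rw [Measure.map_addHaar_smul _ hl.ne']
    simp [abs_of_pos hl]
  have e2 : Measure.map (fun x : ℝ => l ^ 2 * x) volume
      = ENNReal.ofReal ((l ^ 2)⁻¹) • volume := by
    have := Measure.map_addHaar_smul (volume : Measure ℝ) (pow_ne_zero 2 hl.ne')
    simpa [abs_of_pos hl] using this
  have e3 : (hdil l : Hpt n → Hpt n) = Prod.map (fun x : Fin n → ℝ => l • x)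
      (Prod.map (fun x : Fin n → ℝ => l • x) (fun x : ℝ => l ^ 2 * x)) := rfl
  have hv : (volume : Measure (Hpt n)) = (volume : Measure (Fin n → ℝ)).prod
    ((volume : Measure (Fin n → ℝ)).prod (volume : Measure ℝ)) := rfl
  have hm1 : Measurable (fun x : Fin n → ℝ => l • x) := by fun_prop
  have hm2 : Measurable (fun x : ℝ => l ^ 2 * x) := by fun_prop
  rw [e3, hv, ← Measure.map_prod_map _ _ hm1 (hm1.prodMap hm2),
    ← Measure.map_prod_map _ _ hm1 hm2, e1, e2]
  simp only [Measure.prod_smul_left, Measure.prod_smul_right, smul_smul]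
  congr 1
  rw [← ENNReal.ofReal_mul (by positivity), ← ENNReal.ofReal_mul (by positivity)]
  congr 1
  rw [← mul_inv, ← mul_inv]
  congr 1
  ring

/-! ### Fibrations -/

/-- isotropic linear embedding -/
structure IsoV {j : ℕ} (v : (Fin j → ℝ) →ₗ[ℝ] Hpt n) : Prop where
  t0 : ∀ a, (v a).2.2 = 0
  mul : ∀ a b, hmul (v a) (v b) = v (a + b)

/-- `F` is a transversal family along the fibres of `v`. -/
structure Fib {j : ℕ} (v : (Fin j → ℝ) →ₗ[ℝ] Hpt n) (F : Hpt n → Fin j → ℝ) : Prop where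
  iso : IsoV v
  cont : Continuous F
  fib : ∀ q a, ‖F (hmul q (v a)) - F q - a‖ ≤ (1/2) * ‖a‖

section fib
variable {j : ℕ} {v : (Fin j → ℝ) →ₗ[ℝ] Hpt n} {F G : Hpt n → Fin j → ℝ}

lemma continuous_v (v : (Fin j → ℝ) →ₗ[ℝ] Hpt n) : Continuous v :=
  v.continuous_of_finiteDimensional

lemma IsoV.dil (hv : IsoV v) (l : ℝ) (a : Fin j → ℝ) : v (l • a) = hdil l (v a) := by
  rw [map_smul]
  refine hpt_ext rfl rfl ?_
  simp [hdil, hv.t0]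

lemma Fib.diff (h : Fib v F) (q : Hpt n) (a b : Fin j → ℝ) :
    ‖F (hmul q (v b)) - F (hmul q (v a)) - (b - a)‖ ≤ (1/2) * ‖b - a‖ := by
  have := h.fib (hmul q (v a)) (b - a)
  rwa [hmul_assoc', h.iso.mul, add_sub_cancel] at this

lemma Fib.expand (h : Fib v F) (q : Hpt n) (a b : Fin j → ℝ) :
    ‖b - a‖ ≤ 2 * ‖F (hmul q (v b)) - F (hmul q (v a))‖ := by
  have h1 := h.diff q a b
  have h2 := norm_sub_norm_le (b - a) (F (hmul q (v b)) - F (hmul q (v a)))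
  rw [norm_sub_rev (b - a)] at h2
  linarith

lemma Fib.exists_sol (h : Fib v F) (q : Hpt n) (c : Fin j → ℝ) :
    ∃ a, F (hmul q (v a)) = c := by
  have hc : ContractingWith (1/2) (fun a : Fin j → ℝ => a - (F (hmul q (v a)) - c)) := by
    refine ⟨by norm_num, LipschitzWith.of_dist_le_mul fun a b => ?_⟩
    rw [dist_eq_norm, dist_eq_norm, norm_sub_rev a b]
    have := h.diff q a b
    have e : a - (F (hmul q (v a)) - c) - (b - (F (hmul q (v b)) - c))
      = F (hmul q (v b)) - F (hmul q (v a)) - (b - a) := by abel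
    rw [e]
    simpa using this
  refine ⟨hc.fixedPoint, ?_⟩
  have := hc.fixedPoint_isFixedPt
  have h2 : F (hmul q (v hc.fixedPoint)) - c = 0 := by
    have h3 := this.eq
    simpa [sub_eq_self] using h3
  exact sub_eq_zero.1 h2

open Classical in
/-- fibre solution -/
def sol (v : (Fin j → ℝ) →ₗ[ℝ] Hpt n) (F : Hpt n → Fin j → ℝ) (q : Hpt n) (c : Fin j → ℝ) :
    Fin j → ℝ :=
  if h : ∃ a, F (hmul q (v a)) = c then h.choose else 0

lemma Fib.sol_spec (h : Fib v F) (q : Hpt n) (c : Fin j → ℝ) :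
    F (hmul q (v (sol v F q c))) = c := by
  have h1 := h.exists_sol q c
  rw [sol, dif_pos h1]
  exact h1.choose_spec

lemma Fib.sol_unique (h : Fib v F) {q : Hpt n} {c a : Fin j → ℝ} (ha : F (hmul q (v a)) = c) :
    a = sol v F q c := by
  have := h.expand q (sol v F q c) a
  rw [ha, h.sol_spec, sub_self, norm_zero, mul_zero] at this
  exact sub_eq_zero.1 (norm_le_zero_iff.1 this)

lemma Fib.sol_dist (h : Fib v F) (q : Hpt n) (c a : Fin j → ℝ) :
    ‖sol v F q c - a‖ ≤ 2 * ‖c - F (hmul q (v a))‖ := by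
  have := h.expand q a (sol v F q c)
  rwa [h.sol_spec] at this

lemma Fib.continuous_sol (h : Fib v F) :
    Continuous fun z : Hpt n × (Fin j → ℝ) => sol v F z.1 z.2 := by
  rw [continuous_iff_continuousAt]
  rintro ⟨q, c⟩
  rw [ContinuousAt, tendsto_iff_norm_sub_tendsto_zero]
  have hc : Continuous fun z : Hpt n × (Fin j → ℝ) =>
      2 * ‖z.2 - F (hmul z.1 (v (sol v F q c)))‖ := by
    have : Continuous fun z : Hpt n × (Fin j → ℝ) => F (hmul z.1 (v (sol v F q c))) :=
      h.cont.comp (Continuous.hmul' continuous_fst continuous_const)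
    exact continuous_const.mul (continuous_snd.sub this).norm
  have h0 := hc.tendsto (q, c)
  simp only [h.sol_spec, sub_self, norm_zero, mul_zero] at h0
  exact squeeze_zero (fun _ => norm_nonneg _) (fun z => h.sol_dist z.1 z.2 _) h0

/-- fibre coordinate -/
def sF (v : (Fin j → ℝ) →ₗ[ℝ] Hpt n) (F : Hpt n → Fin j → ℝ) (q : Hpt n) : Fin j → ℝ :=
  sol v F q 0

/-- projection on the zero set along the fibres -/
def PF (v : (Fin j → ℝ) →ₗ[ℝ] Hpt n) (F : Hpt n → Fin j → ℝ) (q : Hpt n) : Hpt n :=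
  hmul q (v (sF v F q))

lemma Fib.F_PF (h : Fib v F) (q : Hpt n) : F (PF v F q) = 0 := h.sol_spec q 0

lemma Fib.continuous_sF (h : Fib v F) : Continuous (sF v F) :=
  h.continuous_sol.comp (continuous_id.prodMk continuous_const)

lemma Fib.continuous_PF (h : Fib v F) : Continuous (PF v F) :=
  Continuous.hmul' continuous_id ((continuous_v v).comp h.continuous_sF)

lemma Fib.sF_mul (h : Fib v F) (q : Hpt n) (a : Fin j → ℝ) :
    sF v F (hmul q (v a)) = sF v F q - a := by
  symm
  apply h.sol_unique
  rw [hmul_assoc', h.iso.mul, add_sub_cancel]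
  exact h.sol_spec q 0

lemma Fib.PF_mul (h : Fib v F) (q : Hpt n) (a : Fin j → ℝ) :
    PF v F (hmul q (v a)) = PF v F q := by
  rw [PF, h.sF_mul, hmul_assoc', h.iso.mul, add_sub_cancel, PF]

lemma Fib.norm_sF (h : Fib v F) (q : Hpt n) : ‖sF v F q‖ ≤ 2 * ‖F q‖ := by
  have := h.sol_dist q 0 0
  simpa [sF] using this

lemma Fib.sF_eq_zero (h : Fib v F) {q : Hpt n} (hq : F q = 0) : sF v F q = 0 := by
  have := h.norm_sF q
  rw [hq, norm_zero, mul_zero] at this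
  exact norm_le_zero_iff.1 this

lemma Fib.PF_eq_self (h : Fib v F) {q : Hpt n} (hq : F q = 0) : PF v F q = q := by
  rw [PF, h.sF_eq_zero hq, map_zero, hmul_zero']

lemma Fib.PF_PF (h : Fib v F) (q : Hpt n) : PF v F (PF v F q) = PF v F q :=
  h.PF_eq_self (h.F_PF q)

lemma Fib.PG_PF (hG : Fib v G) (q : Hpt n) : PF v G (PF v F q) = PF v G q :=
  hG.PF_mul q _

lemma IsoV.cancel (hv : IsoV v) (q : Hpt n) (a : Fin j → ℝ) :
    hmul (hmul q (v a)) (v (-a)) = q := by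
  rw [hmul_assoc', hv.mul, add_neg_cancel, map_zero, hmul_zero']

lemma Fib.recover (h : Fib v F) (q : Hpt n) : hmul (PF v F q) (v (-sF v F q)) = q :=
  h.iso.cancel q _

end fib

end Heis
end


open MeasureTheory Topology Filter Set ENNReal
set_option autoImplicit false
noncomputable section
namespace Heis
variable {n : ℕ}

section lam
variable {j : ℕ} {v : (Fin j → ℝ) →ₗ[ℝ] Hpt n} {F G : Hpt n → Fin j → ℝ}

/-- unit cube in the fibre -/
def Qc (j : ℕ) : Set (Fin j → ℝ) := Metric.closedBall 0 (1/2)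

lemma volume_Qc (j : ℕ) : volume (Qc j) = 1 := by
  rw [Qc, Real.volume_pi_closedBall _ (by norm_num)]; norm_num

lemma measurableSet_Qc (j : ℕ) : MeasurableSet (Qc j) := Metric.isClosed_closedBall.measurableSet

/-- the measure on the zero set of `F` -/
def lam (v : (Fin j → ℝ) →ₗ[ℝ] Hpt n) (F : Hpt n → Fin j → ℝ) : Measure (Hpt n) :=
  Measure.map (PF v F) (volume.restrict (sF v F ⁻¹' Qc j))

lemma Fib.lam_apply (h : Fib v F) {A : Set (Hpt n)} (hA : MeasurableSet A) :
    lam v F A = volume (PF v F ⁻¹' A ∩ sF v F ⁻¹' Qc j) := by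
  rw [lam, Measure.map_apply h.continuous_PF.measurable hA,
    Measure.restrict_apply (h.continuous_PF.measurable hA)]

lemma Fib.prod_aux (h : Fib v F) {A : Set (Hpt n)} (hA : MeasurableSet A)
    (hb : Bornology.IsBounded A) {B : Set (Fin j → ℝ)} (hB : MeasurableSet B) :
    volume (PF v F ⁻¹' A ∩ sF v F ⁻¹' B) = lam v F A * volume B := by
  have mP := h.continuous_PF.measurable
  have mS := h.continuous_sF.measurable
  set ν : Measure (Fin j → ℝ) := Measure.map (sF v F) (volume.restrict (PF v F ⁻¹' A)) with hν
  have hνB : ∀ B, MeasurableSet B → ν B = volume (PF v F ⁻¹' A ∩ sF v F ⁻¹' B) := by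
    intro B hB
    rw [hν, Measure.map_apply mS hB, Measure.restrict_apply (mS hB), inter_comm]
  have : IsFiniteMeasureOnCompacts ν := by
    refine ⟨fun K hK => ?_⟩
    rw [hνB K hK.measurableSet]
    have hc : IsCompact ((fun z : Hpt n × (Fin j → ℝ) => hmul z.1 (v (-z.2))) ''
        (closure A ×ˢ K)) := by
      refine (hb.isCompact_closure.prod hK).image ?_
      exact Continuous.hmul' continuous_fst ((continuous_v v).comp continuous_snd.neg)
    refine (measure_mono ?_).trans_lt hc.measure_lt_top
    rintro q ⟨h1, h2⟩
    exact ⟨(PF v F q, sF v F q), ⟨subset_closure h1, h2⟩, h.recover q⟩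
  have : ν.IsAddLeftInvariant := by
    refine ⟨fun a => ?_⟩
    refine Measure.ext fun B hB => ?_
    rw [Measure.map_apply (measurable_const_add a) hB, hνB _ hB,
      hνB _ (measurable_const_add a hB)]
    have h2 := (mp_right (v (-a))).measure_preimage
      ((mP hA).inter (mS hB)).nullMeasurableSet
    rw [← h2]
    congr 1
    ext q
    simp only [mem_inter_iff, mem_preimage, h.PF_mul, h.sF_mul, sub_neg_eq_add, add_comm a]
  have hu := Measure.isAddLeftInvariant_eq_smul ν volume
  have hQ : ν (Qc j) = lam v F A := by
    rw [hνB _ (measurableSet_Qc j), h.lam_apply hA]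
  rw [← hνB B hB, ← hQ]
  rw [hu]
  simp [volume_Qc]

lemma Fib.lam_compact (h : Fib v F) {K : Set (Hpt n)} (hK : IsCompact K) : lam v F K < ⊤ := by
  rw [h.lam_apply hK.measurableSet]
  have hc : IsCompact ((fun z : Hpt n × (Fin j → ℝ) => hmul z.1 (v (-z.2))) ''
      (K ×ˢ Qc j)) := by
    refine (hK.prod (isCompact_closedBall _ _)).image ?_
    exact Continuous.hmul' continuous_fst ((continuous_v v).comp continuous_snd.neg)
  refine (measure_mono ?_).trans_lt hc.measure_lt_top
  rintro q ⟨h1, h2⟩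
  exact ⟨(PF v F q, sF v F q), ⟨h1, h2⟩, h.recover q⟩

lemma Fib.finite_lam (h : Fib v F) : IsFiniteMeasureOnCompacts (lam v F) :=
  ⟨fun _ hK => h.lam_compact hK⟩

lemma Fib.prod_rect (h : Fib v F) {A : Set (Hpt n)} (hA : MeasurableSet A)
    {B : Set (Fin j → ℝ)} (hB : MeasurableSet B) :
    volume (PF v F ⁻¹' A ∩ sF v F ⁻¹' B) = lam v F A * volume B := by
  have mP := h.continuous_PF.measurable
  have mS := h.continuous_sF.measurable
  have key : Measure.map (PF v F) (volume.restrict (sF v F ⁻¹' B)) = volume B • lam v F := by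
    refine (Measure.ext_iff_of_iUnion_eq_univ
      (s := fun N : ℕ => Metric.closedBall (0 : Hpt n) N) (Metric.iUnion_closedBall_nat 0)).2 ?_
    intro N
    refine Measure.ext fun C hC => ?_
    have hC' : MeasurableSet (C ∩ Metric.closedBall (0 : Hpt n) N) :=
      hC.inter Metric.isClosed_closedBall.measurableSet
    rw [Measure.restrict_apply hC, Measure.restrict_apply hC, Measure.map_apply mP hC',
      Measure.restrict_apply (mP hC'), h.prod_aux hC'
        (Metric.isBounded_closedBall.subset inter_subset_right) hB, Measure.smul_apply,
      smul_eq_mul, mul_comm]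
  have := congrArg (fun m => m A) key
  simp only [Measure.smul_apply, smul_eq_mul] at this
  rw [Measure.map_apply mP hA, Measure.restrict_apply (mP hA)] at this
  rw [this, mul_comm]

lemma Fib.prod_formula (h : Fib v F) :
    Measure.map (fun q => (PF v F q, sF v F q)) volume = (lam v F).prod volume := by
  have := h.finite_lam
  symm
  refine Measure.prod_eq fun A B hA hB => ?_
  rw [Measure.map_apply (h.continuous_PF.prodMk h.continuous_sF).measurable (hA.prod hB)]
  exact h.prod_rect hA hB

lemma Fib.lam_transfer (hF : Fib v F) (hG : Fib v G) :
    lam v G = Measure.map (PF v G) (lam v F) := by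
  have := hF.finite_lam
  have mP := hG.continuous_PF.measurable
  have mS := hG.continuous_sF.measurable
  refine Measure.ext fun A hA => ?_
  rw [hG.lam_apply hA, Measure.map_apply mP hA]
  set W : Set (Hpt n × (Fin j → ℝ)) := {z | PF v G z.1 ∈ A ∧ sF v G z.1 + z.2 ∈ Qc j} with hW
  have hWm : MeasurableSet W := by
    refine ((mP.comp measurable_fst) hA).inter ?_
    exact ((mS.comp measurable_fst).add measurable_snd) (measurableSet_Qc j)
  have e1 : PF v G ⁻¹' A ∩ sF v G ⁻¹' Qc j = (fun q => (PF v F q, sF v F q)) ⁻¹' W := by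
    ext q
    simp only [hW, mem_inter_iff, mem_preimage, mem_ofPred_eq, hG.PG_PF]
    have : sF v G (PF v F q) + sF v F q = sF v G q := by
      rw [PF, hG.sF_mul, sub_add_cancel]
    rw [this]
  rw [e1, ← Measure.map_apply (hF.continuous_PF.prodMk hF.continuous_sF).measurable hWm,
    hF.prod_formula, Measure.prod_apply hWm]
  have e2 : ∀ x, volume (Prod.mk x ⁻¹' W) = (PF v G ⁻¹' A).indicator (fun _ => 1) x := by
    intro x
    by_cases hx : PF v G x ∈ A
    · have : Prod.mk x ⁻¹' W = (fun b => sF v G x + b) ⁻¹' Qc j := by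
        ext b; simp [hW, hx]
      rw [this, measure_preimage_add, volume_Qc, indicator_of_mem (by exact hx)]
    · have : Prod.mk x ⁻¹' W = ∅ := by
        ext b; simp [hW, hx]
      rw [this, measure_empty, indicator_of_notMem (by exact hx)]
  simp only [e2]
  rw [lintegral_indicator (mP hA)]
  simp

lemma Fib.lam_zeroSet (h : Fib v F) : lam v F {q | F q = 0}ᶜ = 0 := by
  have hm : MeasurableSet {q | F q = 0}ᶜ :=
    (isClosed_eq h.cont continuous_const).measurableSet.compl
  rw [h.lam_apply hm]
  convert measure_empty (μ := (volume : Measure (Hpt n)))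
  ext q
  simp [h.F_PF]

lemma Fib.ae_zero (h : Fib v F) : ∀ᵐ q ∂(lam v F), F q = 0 := h.lam_zeroSet

lemma Fib.lam_le (hF : Fib v F) (hG : Fib v G) {A A' : Set (Hpt n)} 
    (hA' : MeasurableSet A') (hAA : ∀ σ ∈ A, F σ = 0 → PF v G σ ∈ A') :
    lam v F A ≤ lam v G A' := by
  rw [hF.lam_transfer hG, Measure.map_apply hG.continuous_PF.measurable hA']
  refine measure_mono_ae ?_
  filter_upwards [hF.ae_zero] with σ hσ hσA
  exact hAA σ hσA hσ

/-- rescaled defining function -/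
def resc (g : Hpt n) (r : ℝ) (F : Hpt n → Fin j → ℝ) (q : Hpt n) : Fin j → ℝ :=
  r⁻¹ • F (hmul g (hdil r q))

lemma continuous_gdil (g : Hpt n) (r : ℝ) : Continuous fun q : Hpt n => hmul g (hdil r q) :=
  Continuous.hmul' continuous_const (continuous_hdil r)

lemma Fib.resc (h : Fib v F) (g : Hpt n) {r : ℝ} (hr : 0 < r) : Fib v (resc g r F) := by
  refine ⟨h.iso, by
    have hc := h.cont.comp (continuous_gdil g r)
    exact hc.const_smul r⁻¹, fun q a => ?_⟩
  have h1 := h.fib (hmul g (hdil r q)) (r • a)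
  rw [h.iso.dil, hmul_assoc', ← hdil_hmul] at h1
  have e : Heis.resc g r F (hmul q (v a)) - Heis.resc g r F q - a =
      r⁻¹ • (F (hmul g (hdil r (hmul q (v a)))) - F (hmul g (hdil r q)) - r • a) := by
    simp only [Heis.resc, smul_sub, smul_smul, inv_mul_cancel₀ hr.ne', one_smul]
  rw [e, norm_smul, norm_inv, Real.norm_eq_abs, abs_of_pos hr]
  rw [norm_smul, Real.norm_eq_abs, abs_of_pos hr] at h1
  rw [inv_mul_le_iff₀ hr]
  linarith

lemma Fib.sF_resc (h : Fib v F) (g : Hpt n) {r : ℝ} (hr : 0 < r) (q : Hpt n) :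
    sF v F (hmul g (hdil r q)) = r • sF v (Heis.resc g r F) q := by
  symm
  apply h.sol_unique
  have := (h.resc g hr).F_PF q
  rw [PF, Heis.resc, smul_eq_zero] at this
  rw [h.iso.dil, hmul_assoc', ← hdil_hmul]
  exact this.resolve_left (inv_ne_zero hr.ne')

lemma Fib.PF_resc (h : Fib v F) (g : Hpt n) {r : ℝ} (hr : 0 < r) (q : Hpt n) :
    PF v F (hmul g (hdil r q)) = hmul g (hdil r (PF v (Heis.resc g r F) q)) := by
  rw [PF, h.sF_resc g hr, h.iso.dil, hmul_assoc', ← hdil_hmul, ← PF]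

lemma volume_gdil (g : Hpt n) {r : ℝ} (hr : 0 < r) {A : Set (Hpt n)} (hA : MeasurableSet A) :
    volume A = ENNReal.ofReal (r ^ (2 * n + 2)) * volume ((fun q => hmul g (hdil r q)) ⁻¹' A) := by
  have hm : MeasurableSet ((fun q => hmul g q) ⁻¹' A) := (mp_left g).measurable hA
  have h1 : (fun q => hmul g (hdil r q)) ⁻¹' A = hdil r ⁻¹' ((fun q => hmul g q) ⁻¹' A) := rfl
  rw [h1, ← Measure.map_apply (continuous_hdil r).measurable hm, map_hdil hr, Measure.smul_apply,
    (mp_left g).measure_preimage hA.nullMeasurableSet, smul_eq_mul, ← mul_assoc,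
    ← ENNReal.ofReal_mul (by positivity), mul_inv_cancel₀ (by positivity), ENNReal.ofReal_one,
    one_mul]

lemma Fib.lam_resc (h : Fib v F) (g : Hpt n) {r : ℝ} (hr : 0 < r) {A : Set (Hpt n)}
    (hA : MeasurableSet A) :
    lam v F A = ENNReal.ofReal (r ^ ((2 * n + 2 : ℝ) - j)) *
      lam v (Heis.resc g r F) ((fun q => hmul g (hdil r q)) ⁻¹' A) := by
  have hR := h.resc g hr
  have mP := h.continuous_PF.measurable
  have mS := h.continuous_sF.measurable
  rw [h.lam_apply hA, volume_gdil g hr ((mP hA).inter (mS (measurableSet_Qc j)))]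
  have e : (fun q => hmul g (hdil r q)) ⁻¹' (PF v F ⁻¹' A ∩ sF v F ⁻¹' Qc j) =
      PF v (Heis.resc g r F) ⁻¹' ((fun q => hmul g (hdil r q)) ⁻¹' A) ∩
        sF v (Heis.resc g r F) ⁻¹' (Metric.closedBall 0 (r⁻¹ * (1 / 2))) := by
    ext q
    simp only [mem_preimage, mem_inter_iff, h.PF_resc g hr, h.sF_resc g hr, Qc,
      mem_closedBall_zero_iff, norm_smul, Real.norm_eq_abs, abs_of_pos hr]
    rw [le_inv_mul_iff₀ hr]
  rw [e, hR.prod_rect ((continuous_gdil g r).measurable hA)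
    Metric.isClosed_closedBall.measurableSet, Real.volume_pi_closedBall _ (by positivity)]
  rw [mul_comm (lam v _ _), ← mul_assoc, ← ENNReal.ofReal_mul (by positivity)]
  congr 2
  rw [Real.rpow_sub hr, Fintype.card_fin, Real.rpow_natCast]
  have : r ^ (2 * (n:ℝ) + 2) = r ^ (2 * n + 2) := by
    rw [← Real.rpow_natCast]; congr 1; push_cast; ring
  rw [this, show 2 * (r⁻¹ * (1 / 2)) = r⁻¹ by ring, inv_pow, div_eq_mul_inv]

/-- positivity of `lam` on neighbourhoods of zeros -/
lemma Fib.lam_pos (h : Fib v F) {A : Set (Hpt n)} (hA : IsOpen A) {x : Hpt n} (hx : F x = 0)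
    (hxA : x ∈ A) : 0 < lam v F A := by
  rw [h.lam_apply hA.measurableSet]
  have ho : IsOpen (PF v F ⁻¹' A ∩ sF v F ⁻¹' (Metric.ball 0 (1/2))) :=
    (hA.preimage h.continuous_PF).inter (Metric.isOpen_ball.preimage h.continuous_sF)
  refine (ho.measure_pos volume ⟨x, ?_, ?_⟩).trans_le (measure_mono ?_)
  · rw [mem_preimage, h.PF_eq_self hx]; exact hxA
  · rw [mem_preimage, h.sF_eq_zero hx]; simp
  · exact inter_subset_inter_right _ (preimage_mono Metric.ball_subset_closedBall)

end lam

end Heis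
end


open MeasureTheory Topology Filter Set ENNReal
set_option autoImplicit false
noncomputable section
namespace Heis
variable {n : ℕ}

/-! ### An abstract area formula for spherical measures in metric spaces -/
section area
open Metric
variable {X : Type*} [MetricSpace X]

/-- spherical gauge -/
def gaugeA (X : Type*) [MetricSpace X] (m r : ℝ) (s : Set X) : ℝ≥0∞ :=
  ⨅ (c : X) (ρ : ℝ) (_ : 0 < ρ) (_ : ρ < r) (_ : s ⊆ {q | dist c q < ρ}),
    ENNReal.ofReal ((2*ρ) ^ m)

/-- spherical premeasure -/
def preA (X : Type*) [MetricSpace X] (m r : ℝ) : OuterMeasure X :=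
  OuterMeasure.boundedBy (gaugeA X m r)

/-- spherical outer measure -/
def outA (X : Type*) [MetricSpace X] (m : ℝ) : OuterMeasure X :=
  ⨆ (r : ℝ) (_ : 0 < r), preA X m r

lemma preA_le_outA (m : ℝ) {r : ℝ} (hr : 0 < r) (s : Set X) : preA X m r s ≤ outA X m s := by
  have : preA X m r ≤ outA X m := le_iSup₂ (f := fun r (_ : 0 < r) => preA X m r) r hr
  exact this s

lemma outA_le {m : ℝ} {s : Set X} {a : ℝ≥0∞} (h : ∀ r > 0, preA X m r s ≤ a) :
    outA X m s ≤ a := by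
  simp only [outA, OuterMeasure.iSup_apply]
  exact iSup₂_le h

lemma preA_le_of_subset (m : ℝ) {r ρ : ℝ} (hρ : 0 < ρ) (hρr : ρ < r) {s : Set X} {c : X}
    (hs : s ⊆ ball c ρ) : preA X m r s ≤ ENNReal.ofReal ((2*ρ) ^ m) := by
  refine (OuterMeasure.boundedBy_le s).trans ?_
  refine iInf_le_of_le c (iInf_le_of_le ρ (iInf_le_of_le hρ (iInf_le_of_le hρr
    (iInf_le_of_le ?_ le_rfl))))
  intro q hq
  have := hs hq
  rw [mem_ball, dist_comm] at this
  exact this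

variable [MeasurableSpace X] [BorelSpace X] [SecondCountableTopology X]

lemma area_ge {lm : Measure X} {A : Set X} {m r0 : ℝ} (hr0 : 0 < r0) {b : ℝ≥0∞}
    (hb0 : b ≠ 0) (hb : b ≠ ⊤)
    (hU : ∀ y ρ, 0 < ρ → ρ < r0 → (ball y ρ ∩ A).Nonempty →
      lm (ball y ρ) ≤ b * ENNReal.ofReal ((2*ρ) ^ m)) :
    lm A ≤ b * outA X m A := by
  have h1 : b⁻¹ • (OuterMeasure.restrict A lm.toOuterMeasure) ≤ preA X m r0 := by
    refine OuterMeasure.le_boundedBy.2 fun s => ?_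
    refine le_iInf fun c => le_iInf fun ρ => le_iInf fun hρ => le_iInf fun hρr =>
      le_iInf fun hs => ?_
    rw [OuterMeasure.smul_apply, OuterMeasure.restrict_apply, smul_eq_mul]
    rw [ENNReal.inv_mul_le_iff hb0 hb]
    have hs' : s ⊆ ball c ρ := fun q hq => by
      rw [mem_ball, dist_comm]; exact hs hq
    rcases (ball c ρ ∩ A).eq_empty_or_nonempty with h | h
    · have : s ∩ A = ∅ := by
        rw [← subset_empty_iff, ← h]; exact inter_subset_inter_left _ hs'
      simp [this]
    · exact (measure_mono (inter_subset_left.trans hs')).trans (hU c ρ hρ hρr h)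
  have h2 := (h1 A).trans (preA_le_outA m hr0 A)
  rw [OuterMeasure.smul_apply, OuterMeasure.restrict_apply, smul_eq_mul, inter_self,
    ENNReal.inv_mul_le_iff hb0 hb] at h2
  exact h2

lemma area_null {lm : Measure X} [IsLocallyFiniteMeasure lm] {A : Set X} {m r0 : ℝ}
    (hm : 0 < m) (hr0 : 0 < r0) {b : ℝ≥0∞} (hb : b ≠ ⊤)
    (hL : ∀ x ∈ A, ∀ ρ, 0 < ρ → ρ < r0 → ∃ y, dist x y ≤ ρ ∧
      ENNReal.ofReal ((2*ρ) ^ m) ≤ b * lm (ball y ρ))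
    (hA : lm A = 0) : outA X m A = 0 := by
  refine le_antisymm (outA_le fun r hr => ?_) zero_le
  set K : ℝ≥0∞ := ENNReal.ofReal (10 ^ m) * b with hK
  have hKt : K ≠ ⊤ := ENNReal.mul_ne_top ENNReal.ofReal_ne_top hb
  refine ENNReal.le_of_forall_pos_le_add fun ε hε _ => ?_
  rw [zero_add]
  obtain ⟨V, hAV, hVo, hV⟩ : ∃ V, A ⊆ V ∧ IsOpen V ∧ lm V ≤ ε / (K + 1) := by
    have hpos : (0 : ℝ≥0∞) < ε / (K + 1) := by
      refine ENNReal.div_pos (by exact_mod_cast hε.ne') ?_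
      exact ENNReal.add_ne_top.2 ⟨hKt, by simp⟩
    obtain ⟨V, h1, h2, h3⟩ := A.exists_isOpen_lt_of_lt (μ := lm) _ (hA ▸ hpos)
    exact ⟨V, h1, h2, h3.le⟩
  have hch : ∀ x : A, ∃ (ρ : ℝ) (y : X), 0 < ρ ∧ ρ < r0 ∧ ρ ≤ 1 ∧ 10 * ρ < r ∧ 
      closedBall (x : X) (2 * ρ) ⊆ V ∧ dist (x : X) y ≤ ρ ∧
      ENNReal.ofReal ((2*ρ) ^ m) ≤ b * lm (ball y ρ) := by
    rintro ⟨x, hx⟩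
    obtain ⟨δ, hδ, hδV⟩ := Metric.isOpen_iff.1 hVo x (hAV hx)
    set ρ := min (min (r0 / 2) 1) (min (r / 20) (δ / 4)) with hρ
    have hρ0 : 0 < ρ := by positivity
    have e1 : ρ ≤ r0 / 2 := (min_le_left _ _).trans (min_le_left _ _)
    have e2 : ρ ≤ 1 := (min_le_left _ _).trans (min_le_right _ _)
    have e3 : ρ ≤ r / 20 := (min_le_right _ _).trans (min_le_left _ _)
    have e4 : ρ ≤ δ / 4 := (min_le_right _ _).trans (min_le_right _ _)
    obtain ⟨y, hy1, hy2⟩ := hL x hx ρ hρ0 (by linarith)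
    exact ⟨ρ, y, hρ0, by linarith, e2, by linarith,
      (closedBall_subset_ball (by linarith)).trans hδV, hy1, hy2⟩
  choose ρ y h0 hr0' h1 hr' hV' hd hb' using hch
  obtain ⟨u, -, hdis, hcov⟩ := Vitali.exists_disjoint_subfamily_covering_enlargement_closedBall
    (univ : Set A) (fun x => (x : X)) (fun x => 2 * ρ x) 2 (fun x _ => by linarith [h1 x]) 4
    (by norm_num)
  have hcount : u.Countable := by
    refine hdis.countable_of_nonempty_interior fun a _ => ?_
    exact ⟨a, ball_subset_interior_closedBall (mem_ball_self (by linarith [h0 a]))⟩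
  have hsub : A ⊆ ⋃ a ∈ u, closedBall (a : X) (4 * (2 * ρ a)) := by
    intro x hx
    obtain ⟨b, hbu, hb⟩ := hcov ⟨x, hx⟩ (mem_univ _)
    refine mem_iUnion₂.2 ⟨b, hbu, hb (mem_closedBall_self ?_)⟩
    linarith [h0 ⟨x, hx⟩]
  have := hcount.to_subtype
  calc preA X m r A ≤ preA X m r (⋃ a ∈ u, closedBall (a : X) (4 * (2 * ρ a))) := measure_mono hsub
    _ ≤ ∑' a : u, preA X m r (closedBall ((a : A) : X) (4 * (2 * ρ a))) :=
        measure_biUnion_le _ hcount _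
    _ ≤ ∑' a : u, K * lm (ball (y a) (ρ a)) := by
        refine ENNReal.tsum_le_tsum fun a => ?_
        have ha0 := h0 a
        refine (preA_le_of_subset m (ρ := 10 * ρ a) (by linarith) (hr' a)
          (c := ((a : A) : X)) (closedBall_subset_ball (by linarith))).trans ?_
        have e : (2 * (10 * ρ a)) ^ m = 10 ^ m * (2 * ρ a) ^ m := by
          rw [← Real.mul_rpow (by norm_num) (by positivity)]; congr 1; ring
        rw [e, ENNReal.ofReal_mul (by positivity), hK, mul_assoc]
        gcongr
        exact hb' a
    _ = K * ∑' a : u, lm (ball (y a) (ρ a)) := ENNReal.tsum_mul_left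
    _ ≤ K * lm V := by
        gcongr
        have hdj : Pairwise (Function.onFun Disjoint fun a : u => ball (y a) (ρ a)) := by
          intro a c hac
          have := hdis a.2 c.2 (fun h => hac (Subtype.ext h))
          refine this.mono ?_ ?_
          · intro z hz
            rw [mem_closedBall]
            have h3 := dist_triangle z (y a) (a : A)
            have h4 := hd a
            rw [dist_comm] at h4
            rw [mem_ball] at hz
            linarith
          · intro z hz
            rw [mem_closedBall]
            have h3 := dist_triangle z (y c) (c : A)
            have h4 := hd c
            rw [dist_comm] at h4
            rw [mem_ball] at hz
            linarith
        rw [← measure_iUnion hdj fun a => measurableSet_ball]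
        refine measure_mono (iUnion_subset fun a => ?_)
        refine Subset.trans ?_ (hV' a)
        intro z hz
        rw [mem_closedBall]
        have h3 := dist_triangle z (y a) (a : A)
        have h4 := hd a
        rw [dist_comm] at h4
        rw [mem_ball] at hz
        linarith
    _ ≤ K * (ε / (K + 1)) := by gcongr
    _ ≤ ε := by
        calc K * (ε / (K + 1)) ≤ (K + 1) * (ε / (K + 1)) := by gcongr; exact le_self_add
          _ ≤ ε := ENNReal.mul_div_le

lemma area_le {lm : Measure X} [IsLocallyFiniteMeasure lm] {A : Set X} {m r0 : ℝ}
    (hm : 0 < m) (hr0 : 0 < r0) {b b2 : ℝ≥0∞} (hb : b ≠ ⊤) (hb2 : b2 ≠ ⊤)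
    (hL : ∀ x ∈ A, ∀ ρ, 0 < ρ → ρ < r0 → ∃ y, dist x y ≤ ρ ∧
      ENNReal.ofReal ((2*ρ) ^ m) ≤ b * lm (ball y ρ))
    (hU : ∀ y ρ, 0 < ρ → ρ < r0 → (ball y ρ ∩ A).Nonempty →
      lm (ball y ρ) ≤ b2 * ENNReal.ofReal ((2*ρ) ^ m)) :
    outA X m A ≤ b * lm A := by
  by_cases hb0 : b = 0
  · rcases A.eq_empty_or_nonempty with rfl | ⟨x, hx⟩
    · simp
    · obtain ⟨y, -, h⟩ := hL x hx (r0 / 2) (by linarith) (by linarith)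
      rw [hb0, zero_mul, le_zero_iff, ENNReal.ofReal_eq_zero] at h
      have : 0 < (2 * (r0 / 2)) ^ m := by positivity
      linarith
  -- factor `1+η`
  have key : ∀ η : ℝ, 0 < η → η ≤ 1 →
      outA X m A ≤ ENNReal.ofReal ((1 + η) ^ m) * (b * lm A) := by
    intro η hη hη1
    refine outA_le fun r hr => ?_
    refine ENNReal.le_of_forall_pos_le_add fun ε hε hfin => ?_
    have hlA : lm A ≠ ⊤ := by
      intro h
      rw [h, ENNReal.mul_top hb0, ENNReal.mul_top] at hfin
      · exact absurd hfin (by simp)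
      · rw [Ne, ENNReal.ofReal_eq_zero, not_le]; positivity
    set K : ℝ≥0∞ := ENNReal.ofReal ((1 + η) ^ m) * b with hK
    have hKt : K ≠ ⊤ := ENNReal.mul_ne_top ENNReal.ofReal_ne_top hb
    obtain ⟨V, hAV, hVo, hV⟩ : ∃ V, A ⊆ V ∧ IsOpen V ∧ lm V ≤ lm A + ε / (K + 1) := by
      have hpos : (ε : ℝ≥0∞) / (K + 1) ≠ 0 := by
        refine (ENNReal.div_pos (by exact_mod_cast hε.ne') ?_).ne'
        exact ENNReal.add_ne_top.2 ⟨hKt, by simp⟩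
      obtain ⟨V, h1, h2, h3⟩ := A.exists_isOpen_lt_of_lt (μ := lm) _
        (ENNReal.lt_add_right hlA hpos)
      exact ⟨V, h1, h2, h3.le⟩
    set t : Set (X × X × ℝ) := {z | z.1 ∈ A ∧ 0 < z.2.2 ∧ 7 * z.2.2 < r0 ∧ 2 * z.2.2 < r ∧
      dist z.1 z.2.1 ≤ z.2.2 ∧ closedBall z.1 (2 * z.2.2) ⊆ V ∧
      ENNReal.ofReal ((2*z.2.2) ^ m) ≤ b * lm (ball z.2.1 z.2.2)} with ht
    set C : ℝ≥0∞ := b2 * ENNReal.ofReal (7 ^ m) * b with hC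
    have hCt : C ≠ ⊤ := ENNReal.mul_ne_top (ENNReal.mul_ne_top hb2 ENNReal.ofReal_ne_top) hb
    have hin : ∀ z ∈ t, closedBall z.2.1 z.2.2 ⊆ closedBall z.1 (2 * z.2.2) := by
      rintro ⟨x, y, ρ⟩ ⟨_, _, _, _, h5, _⟩
      refine closedBall_subset_closedBall' ?_
      rw [dist_comm]
      simp only at h5 ⊢
      linarith
    obtain ⟨u, hut, hcount, hdis, hnull⟩ := Vitali.exists_disjoint_covering_ae lm A t C.toNNReal
      (fun z => 2 * z.2.2) (fun z => z.1) (fun z => closedBall z.2.1 z.2.2) hin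
      (by
        rintro ⟨x, y, ρ⟩ ⟨h1, h2, h3, h4, h5, h6, h7⟩
        simp only at h1 h2 h3 h4 h5 h6 h7 ⊢
        rw [ENNReal.coe_toNNReal hCt]
        calc lm (closedBall x (3 * (2 * ρ))) ≤ lm (ball x (7 * ρ)) :=
              measure_mono (closedBall_subset_ball (by linarith))
          _ ≤ b2 * ENNReal.ofReal ((2 * (7 * ρ)) ^ m) :=
              hU x (7 * ρ) (by linarith) h3 ⟨x, mem_ball_self (by linarith), h1⟩
          _ = b2 * ENNReal.ofReal (7 ^ m) * ENNReal.ofReal ((2 * ρ) ^ m) := by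
              rw [mul_assoc, ← ENNReal.ofReal_mul (by positivity),
                ← Real.mul_rpow (by norm_num) (by positivity)]
              congr 3; ring
          _ ≤ b2 * ENNReal.ofReal (7 ^ m) * (b * lm (ball y ρ)) := by gcongr
          _ ≤ C * lm (closedBall y ρ) := by
              rw [hC, mul_assoc _ b]; gcongr; exact ball_subset_closedBall)
      (by
        rintro ⟨x, y, ρ⟩ ⟨h1, h2, h3, h4, h5, h6, h7⟩
        exact ⟨y, ball_subset_interior_closedBall (mem_ball_self h2)⟩)
      (by intro z _; exact isClosed_closedBall)
      (by
        intro x hx δ hδ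
        obtain ⟨δ', hδ', hδV⟩ := Metric.isOpen_iff.1 hVo x (hAV hx)
        set ρ := min (min (r0 / 14) (δ / 2)) (min (r / 4) (δ' / 4)) with hρ
        have hρ0 : 0 < ρ := by positivity
        have e1 : ρ ≤ r0 / 14 := (min_le_left _ _).trans (min_le_left _ _)
        have e2 : ρ ≤ δ / 2 := (min_le_left _ _).trans (min_le_right _ _)
        have e3 : ρ ≤ r / 4 := (min_le_right _ _).trans (min_le_left _ _)
        have e4 : ρ ≤ δ' / 4 := (min_le_right _ _).trans (min_le_right _ _)
        obtain ⟨y, hy1, hy2⟩ := hL x hx ρ hρ0 (by linarith)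
        refine ⟨(x, y, ρ), ⟨hx, hρ0, ?_, ?_, hy1,
          (closedBall_subset_ball ?_).trans hδV, hy2⟩, ?_, rfl⟩ <;> simp only <;> linarith)
    set N := A \ ⋃ a ∈ u, closedBall a.2.1 a.2.2 with hN
    have hN0 : outA X m N = 0 :=
      area_null hm hr0 hb (fun x hx => hL x hx.1) hnull
    have hN0' : preA X m r N = 0 := le_antisymm (hN0 ▸ preA_le_outA m hr N) zero_le
    have := hcount.to_subtype
    calc preA X m r A ≤ preA X m r ((⋃ a ∈ u, closedBall a.2.1 a.2.2) ∪ N) := by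
          refine measure_mono fun x hx => ?_
          by_cases h : x ∈ ⋃ a ∈ u, closedBall a.2.1 a.2.2
          · exact Or.inl h
          · exact Or.inr ⟨hx, h⟩
      _ ≤ preA X m r (⋃ a ∈ u, closedBall a.2.1 a.2.2) + preA X m r N := measure_union_le _ _
      _ = preA X m r (⋃ a ∈ u, closedBall a.2.1 a.2.2) := by rw [hN0', add_zero]
      _ ≤ ∑' a : u, preA X m r (closedBall a.1.2.1 a.1.2.2) := measure_biUnion_le _ hcount _
      _ ≤ ∑' a : u, K * lm (closedBall a.1.2.1 a.1.2.2) := by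
          refine ENNReal.tsum_le_tsum fun a => ?_
          obtain ⟨h1, h2, h3, h4, h5, h6, h7⟩ := hut a.2
          refine (preA_le_of_subset m (ρ := (1 + η) * a.1.2.2) (by positivity) (by nlinarith)
            (c := a.1.2.1) (closedBall_subset_ball (by nlinarith))).trans ?_
          have e : (2 * ((1 + η) * a.1.2.2)) ^ m = (1 + η) ^ m * (2 * a.1.2.2) ^ m := by
            rw [← Real.mul_rpow (by positivity) (by positivity)]; congr 1; ring
          rw [e, ENNReal.ofReal_mul (by positivity), hK, mul_assoc]
          gcongr
          refine h7.trans ?_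
          gcongr
          exact ball_subset_closedBall
      _ = K * ∑' a : u, lm (closedBall a.1.2.1 a.1.2.2) := ENNReal.tsum_mul_left
      _ ≤ K * lm V := by
          gcongr
          have hdj : Pairwise (Function.onFun Disjoint fun a : u =>
              closedBall a.1.2.1 a.1.2.2) := by
            intro a c hac
            exact hdis a.2 c.2 (fun h => hac (Subtype.ext h))
          rw [← measure_iUnion hdj fun a => measurableSet_closedBall]
          refine measure_mono (iUnion_subset fun a => ?_)
          obtain ⟨h1, h2, h3, h4, h5, h6, h7⟩ := hut a.2
          exact (hin _ (hut a.2)).trans h6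
      _ ≤ K * (lm A + ε / (K + 1)) := by gcongr
      _ ≤ ENNReal.ofReal ((1 + η) ^ m) * (b * lm A) + ε := by
          rw [mul_add, hK, mul_assoc, ← hK]
          gcongr
          calc K * (ε / (K + 1)) ≤ (K + 1) * (ε / (K + 1)) := by gcongr; exact le_self_add
            _ ≤ ε := ENNReal.mul_div_le
  have hlim : Tendsto (fun η : ℝ => ENNReal.ofReal ((1 + η) ^ m) * (b * lm A)) (𝓝[>] 0)
      (𝓝 (b * lm A)) := by
    have h1 : Tendsto (fun η : ℝ => ENNReal.ofReal ((1 + η) ^ m)) (𝓝[>] 0) (𝓝 1) := by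
      have : Continuous fun η : ℝ => (1 + η) ^ m :=
        (continuous_const.add continuous_id).rpow_const (fun _ => Or.inr hm.le)
      have h2 := ENNReal.tendsto_ofReal ((this.tendsto 0).mono_left
        (nhdsWithin_le_nhds (s := Ioi 0)))
      simpa using h2
    have := ENNReal.Tendsto.mul_const (b := b * lm A) h1 (Or.inl (by simp))
    simpa using this
  refine ge_of_tendsto hlim ?_
  filter_upwards [Ioc_mem_nhdsGT (show (0:ℝ) < 1 by norm_num)] with η hη
  exact key η hη.1 hη.2

end area

end Heis
end


open MeasureTheory Topology Filter Set ENNReal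
set_option autoImplicit false
noncomputable section
namespace Heis
variable {n : ℕ}

section area2
open Metric

lemma measure_le_of_local {X : Type*} [TopologicalSpace X] [SecondCountableTopology X]
    [MeasurableSpace X] [BorelSpace X] {μ ν : Measure X} {Sg : Set X} {K : ℝ≥0∞}
    (h : ∀ x ∈ Sg, ∃ W, IsOpen W ∧ x ∈ W ∧ ∀ A, MeasurableSet A → A ⊆ W ∩ Sg → μ A ≤ K * ν A)
    {A : Set X} (hA : MeasurableSet A) (hAS : A ⊆ Sg) : μ A ≤ K * ν A := by
  choose! W hWo hxW hW using h
  obtain ⟨t, hts, htc, hcov⟩ := TopologicalSpace.countable_cover_nhdsWithin (s := Sg) (f := W)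
    (fun x hx => mem_nhdsWithin_of_mem_nhds ((hWo x hx).mem_nhds (hxW x hx)))
  rcases t.eq_empty_or_nonempty with rfl | hne
  · have : A = ∅ := by
      rw [← subset_empty_iff]; exact hAS.trans (hcov.trans (by simp))
    simp [this]
  obtain ⟨f, rfl⟩ := htc.exists_eq_range hne
  have hf : ∀ i, f i ∈ Sg := fun i => hts (mem_range_self i)
  have hdm : ∀ i, MeasurableSet (disjointed (fun i => W (f i)) i) :=
    MeasurableSet.disjointed fun i => (hWo _ (hf i)).measurableSet
  have hAu : A = ⋃ i, A ∩ disjointed (fun i => W (f i)) i := by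
    rw [← inter_iUnion, iUnion_disjointed]
    refine (inter_eq_left.2 ?_).symm
    refine hAS.trans (hcov.trans ?_)
    simp
  have hdj : Pairwise (Function.onFun Disjoint fun i => A ∩ disjointed (fun i => W (f i)) i) := by
    intro i k hik
    exact (disjoint_disjointed (fun i => W (f i)) hik).mono inter_subset_right inter_subset_right
  have e1 : μ A = ∑' i, μ (A ∩ disjointed (fun i => W (f i)) i) := by
    conv_lhs => rw [hAu]
    exact measure_iUnion hdj fun i => hA.inter (hdm i)
  have e2 : ν A = ∑' i, ν (A ∩ disjointed (fun i => W (f i)) i) := by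
    conv_lhs => rw [hAu]
    exact measure_iUnion hdj fun i => hA.inter (hdm i)
  rw [e1, e2, ← ENNReal.tsum_mul_left]
  refine ENNReal.tsum_le_tsum fun i => ?_
  refine hW _ (hf i) _ (hA.inter (hdm i)) ?_
  exact fun z hz => ⟨disjointed_subset (fun i => W (f i)) i hz.2, hAS hz.1⟩

variable {X : Type*} [MetricSpace X] [MeasurableSpace X] [BorelSpace X] [SecondCountableTopology X]

theorem area_formula {lm S : Measure X} [IsLocallyFiniteMeasure lm] {m : ℝ} (hm : 0 < m)
    (hS : ∀ A, MeasurableSet A → S A = outA X m A) {Sg : Set X} 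
    {θ : X → NNReal} (hθ : ContinuousOn θ Sg) (hpos : ∀ x ∈ Sg, 0 < θ x)
    (hU : ∀ x ∈ Sg, ∀ c : NNReal, 1 < c → ∃ r0 > 0, ∀ ρ, 0 < ρ → ρ < r0 → ∀ y, dist x y < r0 →
      (θ x : ℝ≥0∞) * lm (ball y ρ) ≤ c * ENNReal.ofReal ((2*ρ) ^ m))
    (hL : ∀ x ∈ Sg, ∀ c : NNReal, 1 < c → ∃ r0 > 0, ∀ ρ, 0 < ρ → ρ < r0 → ∀ x' ∈ Sg,
      dist x x' < r0 → ∃ y, dist x' y ≤ ρ ∧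
      ENNReal.ofReal ((2*ρ) ^ m) ≤ c * ((θ x : ℝ≥0∞) * lm (ball y ρ)))
    {A : Set X} (hA : MeasurableSet A) (hAS : A ⊆ Sg) :
    S A = ∫⁻ x in A, θ x ∂lm := by
  -- local estimates
  have loc : ∀ c : NNReal, 1 < c → ∀ x ∈ Sg, ∃ W, IsOpen W ∧ x ∈ W ∧
      ∀ A, MeasurableSet A → A ⊆ W ∩ Sg →
        (S A ≤ (c * c : ℝ≥0∞) * ∫⁻ x in A, θ x ∂lm) ∧
        (∫⁻ x in A, θ x ∂lm ≤ (c * c : ℝ≥0∞) * S A) := by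
    intro c hc x hx
    obtain ⟨r1, hr1, h1⟩ := hU x hx c hc
    obtain ⟨r2, hr2, h2⟩ := hL x hx c hc
    have hθx := hpos x hx
    have hev : ∀ᶠ z in 𝓝[Sg] x, θ z < c * θ x ∧ θ x < c * θ z := by
      have e1 : θ x < c * θ x := lt_mul_of_one_lt_left hθx hc
      have t1 : Tendsto (fun z => c * θ z) (𝓝[Sg] x) (𝓝 (c * θ x)) := (hθ x hx).const_mul c
      exact ((hθ x hx).eventually_lt_const e1).and (t1.eventually_const_lt e1)
    obtain ⟨r3, hr3, h3⟩ := Metric.mem_nhdsWithin_iff.1 hev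
    set r := min (min r1 r2) r3 with hr
    have hr0 : 0 < r := by positivity
    have q1 : r ≤ r1 := (min_le_left _ _).trans (min_le_left _ _)
    have q2 : r ≤ r2 := (min_le_left _ _).trans (min_le_right _ _)
    have q3 : r ≤ r3 := min_le_right _ _
    refine ⟨ball x (r / 2), isOpen_ball, mem_ball_self (by linarith), fun A hA hAW => ?_⟩
    have hAx : ∀ z ∈ A, dist x z < r / 2 ∧ z ∈ Sg := fun z hz => by
      have := (hAW hz).1
      rw [mem_ball, dist_comm] at this
      exact ⟨this, (hAW hz).2⟩
    have hAθ : ∀ z ∈ A, θ z < c * θ x ∧ θ x < c * θ z := fun z hz => by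
      refine h3 ⟨?_, (hAx z hz).2⟩
      rw [mem_ball, dist_comm]
      linarith [(hAx z hz).1]
    have HL : ∀ z ∈ A, ∀ ρ, 0 < ρ → ρ < r / 2 → ∃ y, dist z y ≤ ρ ∧
        ENNReal.ofReal ((2*ρ) ^ m) ≤ (c * θ x : ℝ≥0∞) * lm (ball y ρ) := by
      intro z hz ρ hρ hρr
      obtain ⟨y, hy1, hy2⟩ := h2 ρ hρ (by linarith) z (hAx z hz).2 (by linarith [(hAx z hz).1])
      exact ⟨y, hy1, by rw [mul_assoc]; exact hy2⟩
    have hθ0 : (θ x : ℝ≥0∞) ≠ 0 := by exact_mod_cast hθx.ne'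
    have HU : ∀ y ρ, 0 < ρ → ρ < r / 2 → (ball y ρ ∩ A).Nonempty →
        lm (ball y ρ) ≤ (c / θ x : ℝ≥0∞) * ENNReal.ofReal ((2*ρ) ^ m) := by
      rintro y ρ hρ hρr ⟨z, hz1, hz2⟩
      have hd : dist x y < r1 := by
        have := dist_triangle x z y
        rw [mem_ball] at hz1
        linarith [(hAx z hz2).1]
      have h4 := h1 ρ hρ (by linarith) y hd
      rw [div_eq_mul_inv, mul_right_comm, ← div_eq_mul_inv,
        ENNReal.le_div_iff_mul_le (Or.inl hθ0) (Or.inl (by simp)), mul_comm]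
      exact h4
    have hcθt : (c * θ x : ℝ≥0∞) ≠ ⊤ := ENNReal.mul_ne_top (by simp) (by simp)
    have hcθt2 : (c / θ x : ℝ≥0∞) ≠ ⊤ := ENNReal.div_ne_top (by simp) hθ0
    have hc0 : (c : ℝ≥0∞) ≠ 0 := by
      have : (0 : NNReal) < c := lt_trans zero_lt_one hc
      exact_mod_cast this.ne'
    have hcθ0 : (c / θ x : ℝ≥0∞) ≠ 0 := ENNReal.div_ne_zero.2 ⟨hc0, by simp⟩
    have R1 := area_le hm (half_pos hr0) hcθt hcθt2 HL HU
    have R2 := area_ge (half_pos hr0) hcθ0 hcθt2 HU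
    rw [← hS A hA] at R1 R2
    constructor
    · refine R1.trans ?_
      rw [mul_assoc, mul_assoc]
      refine mul_le_mul' le_rfl ?_
      have e : (θ x : ℝ≥0∞) * lm A = ∫⁻ _ in A, (θ x : ℝ≥0∞) ∂lm := by simp
      rw [e, ← lintegral_const_mul' _ _ (by simp)]
      refine setLIntegral_mono' hA fun z hz => ?_
      exact_mod_cast (hAθ z hz).2.le
    · have e : ∫⁻ x in A, θ x ∂lm ≤ ∫⁻ _ in A, ((c * θ x : NNReal) : ℝ≥0∞) ∂lm := by
        refine setLIntegral_mono' hA fun z hz => ?_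
        exact_mod_cast (hAθ z hz).1.le
      refine e.trans ?_
      rw [setLIntegral_const]
      push_cast
      calc (c * θ x : ℝ≥0∞) * lm A ≤ (c * θ x : ℝ≥0∞) * (c / θ x * S A) := by gcongr
        _ = (c * c : ℝ≥0∞) * S A * (θ x / θ x) := by
            rw [div_eq_mul_inv, div_eq_mul_inv]; ring
        _ = (c * c : ℝ≥0∞) * S A := by rw [ENNReal.div_self hθ0 (by simp), mul_one]
  set ν : Measure X := lm.withDensity (fun x => (θ x : ℝ≥0∞)) with hν
  have hνA : ∀ A, MeasurableSet A → ν A = ∫⁻ x in A, θ x ∂lm := fun A hA =>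
    withDensity_apply _ hA
  have g1 : ∀ c : NNReal, 1 < c → S A ≤ (c * c : ℝ≥0∞) * ν A := fun c hc => by
    refine measure_le_of_local (Sg := Sg) (fun x hx => ?_) hA hAS
    obtain ⟨W, w1, w2, w3⟩ := loc c hc x hx
    exact ⟨W, w1, w2, fun B hB hBW => by rw [hνA B hB]; exact (w3 B hB hBW).1⟩
  have g2 : ∀ c : NNReal, 1 < c → ν A ≤ (c * c : ℝ≥0∞) * S A := fun c hc => by
    refine measure_le_of_local (Sg := Sg) (fun x hx => ?_) hA hAS
    obtain ⟨W, w1, w2, w3⟩ := loc c hc x hx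
    exact ⟨W, w1, w2, fun B hB hBW => by rw [hνA B hB]; exact (w3 B hB hBW).2⟩
  have lim : ∀ a b : ℝ≥0∞, (∀ c : NNReal, 1 < c → a ≤ (c * c : ℝ≥0∞) * b) → a ≤ b := by
    intro a b hab
    have h1 : Tendsto (fun c : NNReal => ((c * c : NNReal) : ℝ≥0∞)) (𝓝[>] 1) (𝓝 1) := by
      have : Continuous fun c : NNReal => ((c * c : NNReal) : ℝ≥0∞) :=
        ENNReal.continuous_coe.comp (continuous_id.mul continuous_id)
      have h2 := (this.tendsto 1).mono_left (nhdsWithin_le_nhds (s := Ioi 1))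
      simpa using h2
    have h2 := ENNReal.Tendsto.mul_const (b := b) h1 (Or.inl (by simp))
    rw [one_mul] at h2
    refine ge_of_tendsto h2 ?_
    filter_upwards [self_mem_nhdsWithin] with c hc
    have := hab c hc
    push_cast
    exact this
  rw [← hνA A hA]
  exact le_antisymm (lim _ _ g1) (lim _ _ g2)

end area2

theorem area_H (D : HomDist n) (hn : 1 ≤ n) {lm : Measure (Hpt n)} [IsLocallyFiniteMeasure lm]
    {m : ℝ} (hm : 0 < m) {Sg : Set (Hpt n)}
    {θ : Hpt n → NNReal} (hθ : ContinuousOn θ Sg) (hpos : ∀ x ∈ Sg, 0 < θ x)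
    (hU : ∀ x ∈ Sg, ∀ c : NNReal, 1 < c → ∃ r0 > 0, ∀ ρ, 0 < ρ → ρ < r0 → ∀ y, D.d x y < r0 →
      (θ x : ℝ≥0∞) * lm (hball D y ρ) ≤ c * ENNReal.ofReal ((2*ρ) ^ m))
    (hL : ∀ x ∈ Sg, ∀ c : NNReal, 1 < c → ∃ r0 > 0, ∀ ρ, 0 < ρ → ρ < r0 → ∀ x' ∈ Sg,
      D.d x x' < r0 → ∃ y, D.d x' y ≤ ρ ∧
      ENNReal.ofReal ((2*ρ) ^ m) ≤ c * ((θ x : ℝ≥0∞) * lm (hball D y ρ)))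
    {A : Set (Hpt n)} (hA : MeasurableSet A) (hAS : A ⊆ Sg) :
    sphMeasure D m A = ∫⁻ x in A, θ x ∂lm := by
  letI : MetricSpace (HD D) := hdMetric D hn
  have hball : ∀ (y : Hpt n) (ρ : ℝ), hball D y ρ = (Metric.ball (α := HD D) y ρ) := by
    intro y ρ
    ext q
    change D.d y q < ρ ↔ D.d q y < ρ
    rw [D.symm]
  have hS : ∀ A : Set (HD D), MeasurableSet A →
      (sphMeasure D m : Measure (HD D)) A = outA (HD D) m A := by
    intro A hA
    have h1 : sphMeasure D m A = sphOuter D.d m A := by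
      rw [sphMeasure]; exact toMeasure_apply _ _ hA
    rw [h1]
    rfl
  have : IsLocallyFiniteMeasure (α := HD D) lm := ‹IsLocallyFiniteMeasure lm›
  simp only [hball] at hU hL
  haveI b1 : @BorelSpace (HD D) (hdMetric D hn).toPseudoMetricSpace.toUniformSpace.toTopologicalSpace _ :=
    inferInstanceAs (BorelSpace (Hpt n))
  haveI b2 : @SecondCountableTopology (HD D)
    (hdMetric D hn).toPseudoMetricSpace.toUniformSpace.toTopologicalSpace :=
    inferInstanceAs (SecondCountableTopology (Hpt n))
  exact @area_formula (HD D) (hdMetric D hn) _ b1 b2 lm _ this m hm hS Sg θ hθ hpos hU hL A hA hAS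

end Heis
end


open MeasureTheory Topology Filter Set ENNReal
set_option autoImplicit false
noncomputable section
namespace Heis
variable {n : ℕ}

/-! ### Horizontal linear maps -/

/-- coefficient space of horizontal linear maps -/
abbrev Hco (n j : ℕ) := Fin j → Fin (2*n) → ℝ

/-- scalar horizontal linear map -/
def dlin1 (c : Fin (2*n) → ℝ) (q : Hpt n) : ℝ :=
  ∑ l : Fin n, (q.1 l * c ⟨(l:ℕ), by omega⟩ + q.2.1 l * c ⟨n + (l:ℕ), by omega⟩)

/-- horizontal linear map with coefficients `c` -/
def dlin {j : ℕ} (c : Hco n j) (q : Hpt n) : Fin j → ℝ := fun i => dlin1 (c i) q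

lemma dlin1_hmul (c : Fin (2*n) → ℝ) (p q : Hpt n) :
    dlin1 c (hmul p q) = dlin1 c p + dlin1 c q := by
  unfold dlin1
  rw [← Finset.sum_add_distrib]
  refine Finset.sum_congr rfl fun l _ => ?_
  simp only [hmul_fst, hmul_snd, Pi.add_apply]
  ring

lemma dlin1_hinv (c : Fin (2*n) → ℝ) (p : Hpt n) : dlin1 c (hinv p) = - dlin1 c p := by
  unfold dlin1
  rw [← Finset.sum_neg_distrib]
  refine Finset.sum_congr rfl fun l _ => ?_
  simp only [hinv, Pi.neg_apply]
  ring

lemma dlin1_hdil (c : Fin (2*n) → ℝ) (r : ℝ) (p : Hpt n) : dlin1 c (hdil r p) = r * dlin1 c p := by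
  unfold dlin1
  rw [Finset.mul_sum]
  refine Finset.sum_congr rfl fun l _ => ?_
  simp only [hdil, Pi.smul_apply, smul_eq_mul]
  ring

lemma dlin1_sub (c c' : Fin (2*n) → ℝ) (p : Hpt n) : dlin1 (c - c') p = dlin1 c p - dlin1 c' p := by
  unfold dlin1
  rw [← Finset.sum_sub_distrib]
  refine Finset.sum_congr rfl fun l _ => ?_
  simp only [Pi.sub_apply]
  ring

lemma abs_dlin1_le (c : Fin (2*n) → ℝ) (p : Hpt n) : |dlin1 c p| ≤ n * ‖c‖ * qn p := by
  unfold dlin1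
  refine (Finset.abs_sum_le_sum_abs _ _).trans ?_
  have : ∀ l ∈ (Finset.univ : Finset (Fin n)), |p.1 l * c ⟨(l:ℕ), by omega⟩ + p.2.1 l * c ⟨n + (l:ℕ), by omega⟩|
      ≤ ‖c‖ * qn p := by
    intro l _
    refine (abs_add_le _ _).trans ?_
    rw [abs_mul, abs_mul]
    have h1 := norm_le_pi_norm c ⟨(l:ℕ), by omega⟩
    have h2 := norm_le_pi_norm c ⟨n + (l:ℕ), by omega⟩
    have h3 := norm_le_pi_norm p.1 l
    have h4 := norm_le_pi_norm p.2.1 l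
    simp only [Real.norm_eq_abs] at h1 h2 h3 h4
    have h5 : 0 ≤ √|p.2.2| := Real.sqrt_nonneg _
    have e1 : |p.1 l| * |c ⟨(l:ℕ), by omega⟩| ≤ ‖p.1‖ * ‖c‖ := by gcongr
    have e2 : |p.2.1 l| * |c ⟨n + (l:ℕ), by omega⟩| ≤ ‖p.2.1‖ * ‖c‖ := by gcongr
    unfold qn
    nlinarith [norm_nonneg c, mul_nonneg (norm_nonneg c) h5]
  refine (Finset.sum_le_sum this).trans ?_
  simp [mul_assoc]

lemma continuous_dlin1 : Continuous fun z : (Fin (2*n) → ℝ) × Hpt n => dlin1 z.1 z.2 := by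
  unfold dlin1; fun_prop

section dl
variable {j : ℕ}

lemma dlin_hmul (c : Hco n j) (p q : Hpt n) : dlin c (hmul p q) = dlin c p + dlin c q :=
  funext fun i => dlin1_hmul (c i) p q

lemma dlin_hinv (c : Hco n j) (p : Hpt n) : dlin c (hinv p) = - dlin c p :=
  funext fun i => dlin1_hinv (c i) p

lemma dlin_hdil (c : Hco n j) (r : ℝ) (p : Hpt n) : dlin c (hdil r p) = r • dlin c p :=
  funext fun i => dlin1_hdil (c i) r p

lemma dlin_sub (c c' : Hco n j) (p : Hpt n) : dlin (c - c') p = dlin c p - dlin c' p :=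
  funext fun i => dlin1_sub (c i) (c' i) p

lemma norm_dlin_le (c : Hco n j) (p : Hpt n) : ‖dlin c p‖ ≤ n * ‖c‖ * qn p := by
  refine (pi_norm_le_iff_of_nonneg ?_).2 fun i => ?_
  · have := qn_nonneg p; positivity
  · refine (abs_dlin1_le (c i) p).trans ?_
    have := qn_nonneg p
    have := norm_le_pi_norm c i
    gcongr

lemma continuous_dlin : Continuous fun z : Hco n j × Hpt n => dlin z.1 z.2 := by
  refine continuous_pi fun i => ?_
  have h : Continuous fun z : Hco n j × Hpt n => (z.1 i, z.2) := by fun_prop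
  exact continuous_dlin1.comp h

lemma exists_dlin_le (D : HomDist n) (hn : 1 ≤ n) : ∃ C > 0, ∀ (j : ℕ) (c : Hco n j) (p : Hpt n),
    ‖dlin c p‖ ≤ C * ‖c‖ * nm D p := by
  obtain ⟨C, hC, h⟩ := exists_qn_le_nm D hn
  have hn' : (0:ℝ) < n := by exact_mod_cast hn
  refine ⟨n * C, by positivity, fun j c p => (norm_dlin_le c p).trans ?_⟩
  calc n * ‖c‖ * qn p ≤ n * ‖c‖ * (C * nm D p) := by
        have := h p
        gcongr
    _ = _ := by ring

lemma exists_nm_v_le (D : HomDist n) (hn : 1 ≤ n) {v : (Fin j → ℝ) →ₗ[ℝ] Hpt n} (hv : IsoV v) :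
    ∃ C > 0, ∀ a, nm D (v a) ≤ C * ‖a‖ := by
  obtain ⟨C, hC, h⟩ := exists_nm_le_qn D hn
  set V := LinearMap.toContinuousLinearMap v
  refine ⟨C * (2 * (‖V‖ + 1)), by positivity, fun a => (h _).trans ?_⟩
  have h1 : ‖v a‖ ≤ (‖V‖ + 1) * ‖a‖ := by
    refine (V.le_opNorm a).trans ?_
    gcongr; linarith
  have h2 : qn (v a) ≤ 2 * ‖v a‖ := by
    unfold qn
    rw [hv.t0]
    have e1 : ‖(v a).1‖ ≤ ‖v a‖ := norm_fst_le _
    have e2 : ‖(v a).2.1‖ ≤ ‖v a‖ := (norm_fst_le _).trans (norm_snd_le _)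
    simp; linarith
  calc C * qn (v a) ≤ C * (2 * ((‖V‖ + 1) * ‖a‖)) := by gcongr; linarith
    _ = _ := by ring

/-- admissible coefficients -/
def Adm (v : (Fin j → ℝ) →ₗ[ℝ] Hpt n) (c : Hco n j) : Prop := ∀ a, ‖dlin c (v a) - a‖ ≤ (1/2) * ‖a‖

/-- translated linear map -/
def aff (c : Hco n j) (g q : Hpt n) : Fin j → ℝ := dlin c (hmul (hinv g) q)

variable {v : (Fin j → ℝ) →ₗ[ℝ] Hpt n} {c : Hco n j}

lemma fib_aff (hv : IsoV v) (hc : Adm v c) (g : Hpt n) : Fib v (aff c g) := by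
  refine ⟨hv, ?_, fun q a => ?_⟩
  · exact continuous_dlin.comp (continuous_const.prodMk (Continuous.hmul' continuous_const continuous_id))
  · unfold aff
    rw [← hmul_assoc', dlin_hmul _ _ (v a), add_sub_cancel_left]
    exact hc a

lemma aff_zero (c : Hco n j) : aff c 0 = dlin c := by
  funext q; simp [aff]

lemma fib_dlin (hv : IsoV v) (hc : Adm v c) : Fib v (dlin c) := by
  rw [← aff_zero]; exact fib_aff hv hc 0

lemma lam_aff (D : HomDist n) (hn : 1 ≤ n) (hv : IsoV v) (hc : Adm v c) (g y : Hpt n) {s : ℝ} (hs : 0 < s) :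
    lam v (aff c g) (hball D y s) = ENNReal.ofReal (s ^ ((2 * n + 2 : ℝ) - j)) *
      lam v (dlin c) (hball D (hdil s⁻¹ (hmul (hinv g) y)) 1) := by
  rw [(fib_aff hv hc g).lam_resc g hs (isOpen_hball D hn y s).measurableSet]
  have e1 : resc g s (aff c g) = dlin c := by
    funext q
    simp only [resc, aff, hinv_hmul_cancel, dlin_hdil, smul_smul]
    rw [inv_mul_cancel₀ hs.ne', one_smul]
  have e2 : (fun q => hmul g (hdil s q)) ⁻¹' (hball D y s)
      = hball D (hdil s⁻¹ (hmul (hinv g) y)) 1 := by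
    ext q
    simp only [mem_preimage, mem_hball]
    have : D.d y (hmul g (hdil s q)) = s * D.d (hdil s⁻¹ (hmul (hinv g) y)) q := by
      rw [← D.homog s hs, hdil_inv_cancel hs.ne', ← D.leftInv g (hmul (hinv g) y), hmul_hinv_cancel]
    rw [this]
    constructor
    · intro h; by_contra h'; push Not at h'; nlinarith
    · intro h; nlinarith
  rw [e1, e2]

lemma aff_eq_dlin {g : Hpt n} (hg : dlin c g = 0) : aff c g = dlin c := by
  funext q; simp [aff, dlin_hmul, dlin_hinv, hg]

/-- `β(c)` -/
def beta (D : HomDist n) (v : (Fin j → ℝ) →ₗ[ℝ] Hpt n) (c : Hco n j) : ℝ≥0∞ :=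
  ⨆ y, lam v (dlin c) (hball D y 1)

lemma beta_local (D : HomDist n) (hn : 1 ≤ n) (hv : IsoV v) (hc : Adm v c) (y : Hpt n)
    (hy : lam v (dlin c) (hball D y 1) ≠ 0) :
    ∃ y', nm D y' < 1 ∧ lam v (dlin c) (hball D y' 1) = lam v (dlin c) (hball D y 1) := by
  have hF := fib_dlin hv hc
  have : ∃ σ ∈ hball D y 1, dlin c σ = 0 := by
    by_contra hcon
    push Not at hcon
    refine hy (measure_mono_null ?_ hF.lam_zeroSet)
    exact fun σ hσ => hcon σ hσ
  obtain ⟨σ, h1, h2⟩ := this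
  refine ⟨hmul (hinv σ) y, ?_, ?_⟩
  · rw [← d_eq_nm, D.symm]; exact h1
  · have := lam_aff D hn hv hc σ y one_pos
    rw [aff_eq_dlin h2] at this
    rw [this]; simp

lemma beta_le (D : HomDist n) (hn : 1 ≤ n) (hv : IsoV v) (hc : Adm v c) {b : ℝ≥0∞}
    (h : ∀ y, nm D y < 1 → lam v (dlin c) (hball D y 1) ≤ b) : beta D v c ≤ b := by
  refine iSup_le fun y => ?_
  by_cases hy : lam v (dlin c) (hball D y 1) = 0
  · simp [hy]
  · obtain ⟨y', h1, h2⟩ := beta_local D hn hv hc y hy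
    rw [← h2]; exact h y' h1

lemma beta_lt_top (D : HomDist n) (hn : 1 ≤ n) (hv : IsoV v) (hc : Adm v c) : beta D v c < ⊤ := by
  refine (beta_le D hn hv hc (b := lam v (dlin c) {q | D.d 0 q ≤ 2}) fun y hy => ?_).trans_lt
    ((fib_dlin hv hc).lam_compact (isCompact_closed_hball D hn 0 2))
  refine measure_mono fun q hq => ?_
  have := D.triangle 0 y q
  have h1 : D.d y q < 1 := hq
  have h2 : D.d 0 y < 1 := hy
  change D.d 0 q ≤ 2
  linarith

lemma beta_pos (D : HomDist n) (hn : 1 ≤ n) (hv : IsoV v) (hc : Adm v c) : 0 < beta D v c := by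
  have := (fib_dlin hv hc).lam_pos (isOpen_hball D hn 0 1) (x := 0)
    (by funext i; simp [dlin, dlin1]) (by rw [mem_hball, d_self]; exact one_pos)
  exact this.trans_le (le_iSup (fun y => lam v (dlin c) (hball D y 1)) 0)

lemma exists_beta (D : HomDist n) (hn : 1 ≤ n) (hv : IsoV v) (hc : Adm v c) {b : ℝ≥0∞}
    (hb : b < beta D v c) : ∃ y, nm D y < 1 ∧ b < lam v (dlin c) (hball D y 1) := by
  by_contra h
  push Not at h
  exact absurd (beta_le D hn hv hc h) (not_le.2 hb)

lemma lam_aff_le (D : HomDist n) (hn : 1 ≤ n) (hv : IsoV v) (hc : Adm v c) (g y : Hpt n) {s : ℝ}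
    (hs : 0 < s) : lam v (aff c g) (hball D y s) ≤
      ENNReal.ofReal (s ^ ((2 * n + 2 : ℝ) - j)) * beta D v c := by
  rw [lam_aff D hn hv hc g y hs]
  gcongr
  exact le_iSup (fun y => lam v (dlin c) (hball D y 1)) _

/-- comparison of the measures of two graphs -/
lemma lam_compare (D : HomDist n) (hn : 1 ≤ n) {F G : Hpt n → Fin j → ℝ} (hF : Fib v F) (hG : Fib v G)
    {Cv : ℝ} (hCv : 0 < Cv) (hCv' : ∀ a, nm D (v a) ≤ Cv * ‖a‖) (y : Hpt n) {s δ : ℝ}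
    (h : ∀ σ, D.d y σ < s → F σ = 0 → ‖G σ‖ ≤ δ) :
    lam v F (hball D y s) ≤ lam v G (hball D y (s + 2 * Cv * δ)) := by
  refine hF.lam_le hG (isOpen_hball D hn _ _).measurableSet fun σ hσ h0 => ?_
  have h1 : D.d y σ < s := hσ
  have h2 := h σ h1 h0
  have h3 : D.d σ (PF v G σ) ≤ 2 * Cv * δ := by
    rw [PF, d_hmul_right]
    refine (hCv' _).trans ?_
    have := hG.norm_sF σ
    nlinarith
  have := D.triangle y σ (PF v G σ)
  rw [mem_hball]
  linarith

end dl

end Heis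
end


open MeasureTheory Topology Filter Set ENNReal
set_option autoImplicit false
noncomputable section
namespace Heis
variable {n : ℕ}

lemma exists_small_pow (K m : ℝ) {c : ℝ} (hc : 1 < c) : ∃ η > 0, (1 + K * η) ^ m < c ∧ 0 < 1 + K * η := by
  have h1 : Tendsto (fun η : ℝ => (1 + K * η) ^ m) (𝓝 0) (𝓝 1) := by
    have : ContinuousAt (fun η : ℝ => (1 + K * η) ^ m) 0 := by
      refine ContinuousAt.rpow_const (by fun_prop) (Or.inl (by simp))
    simpa [ContinuousAt] using this
  have h2 : Tendsto (fun η : ℝ => (1 + K * η)) (𝓝 0) (𝓝 1) := by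
    have : ContinuousAt (fun η : ℝ => (1 + K * η)) 0 := by fun_prop
    simpa [ContinuousAt] using this
  have h3 := (h1.eventually (gt_mem_nhds hc)).and (h2.eventually (lt_mem_nhds one_pos))
  obtain ⟨η, h, h'⟩ := ((h3.filter_mono nhdsWithin_le_nhds).and
    (self_mem_nhdsWithin : Ioi (0:ℝ) ∈ 𝓝[>] 0)).exists
  exact ⟨η, h', h⟩

section gr
variable {j : ℕ} {v : (Fin j → ℝ) →ₗ[ℝ] Hpt n}

/-- the area density -/
def thetaD (D : HomDist n) (v : (Fin j → ℝ) →ₗ[ℝ] Hpt n) (c : Hco n j) : NNReal :=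
  Real.toNNReal (2 ^ ((2 * n + 2 : ℝ) - j)) / (beta D v c).toNNReal

lemma thetaD_pos (D : HomDist n) (hn : 1 ≤ n) (hv : IsoV v) {c : Hco n j} (hc : Adm v c) :
    0 < thetaD D v c := by
  unfold thetaD
  refine div_pos (Real.toNNReal_pos.2 (by positivity)) ?_
  exact ENNReal.toNNReal_pos (beta_pos D hn hv hc).ne' (beta_lt_top D hn hv hc).ne

lemma coe_thetaD (D : HomDist n) (hn : 1 ≤ n) (hv : IsoV v) {c : Hco n j} (hc : Adm v c) :
    (thetaD D v c : ℝ≥0∞) * beta D v c = ENNReal.ofReal (2 ^ ((2 * n + 2 : ℝ) - j)) := by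
  have h0 := (beta_pos D hn hv hc).ne'
  have h1 := (beta_lt_top D hn hv hc).ne
  have h2 : (beta D v c).toNNReal ≠ 0 := (ENNReal.toNNReal_pos h0 h1).ne'
  conv_lhs => rw [← ENNReal.coe_toNNReal h1]
  rw [← ENNReal.coe_mul, thetaD, div_mul_cancel₀ _ h2]
  rfl

lemma beta_compare (D : HomDist n) (hn : 1 ≤ n) (hv : IsoV v) : ∃ K > 0, ∀ {c c' : Hco n j},
    Adm v c → Adm v c' →
    beta D v c ≤ ENNReal.ofReal ((1 + K * ‖c - c'‖) ^ ((2 * n + 2 : ℝ) - j)) * beta D v c' := by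
  obtain ⟨Cv, hCv, hCv'⟩ := exists_nm_v_le D hn hv
  obtain ⟨C, hC, hC'⟩ := exists_dlin_le D hn
  refine ⟨2 * Cv * (C * 2), by positivity, fun {c c'} hc hc' => ?_⟩
  refine beta_le D hn hv hc fun y hy => ?_
  have h := lam_compare D hn (fib_dlin hv hc) (fib_dlin hv hc') hCv hCv' y (s := 1)
    (δ := C * 2 * ‖c - c'‖) ?_
  · refine h.trans ?_
    rw [← aff_zero]
    have := lam_aff_le D hn hv hc' 0 y (s := 1 + 2 * Cv * (C * 2 * ‖c - c'‖)) (by positivity)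
    rwa [show 2 * Cv * (C * 2 * ‖c - c'‖) = 2 * Cv * (C * 2) * ‖c - c'‖ by ring] at *
  · intro σ h1 h2
    have e : dlin c' σ = - dlin (c - c') σ := by rw [dlin_sub, h2]; simp
    rw [e, norm_neg]
    refine (hC' _ _ _).trans ?_
    have h3 : nm D σ ≤ 2 := by
      have := D.triangle 0 y σ
      unfold nm at *
      linarith
    calc C * ‖c - c'‖ * nm D σ ≤ C * ‖c - c'‖ * 2 := by gcongr
      _ = _ := by ring

lemma continuousOn_beta (D : HomDist n) (hn : 1 ≤ n) (hv : IsoV v) :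
    ContinuousOn (fun c : Hco n j => (beta D v c).toNNReal) {c | Adm v c} := by
  obtain ⟨K, hK, h⟩ := beta_compare (v := v) D hn hv
  have key : ∀ {c c' : Hco n j}, Adm v c → Adm v c' → ((beta D v c).toNNReal : ℝ) ≤
      (1 + K * ‖c - c'‖) ^ ((2 * n + 2 : ℝ) - j) * (beta D v c').toNNReal := by
    intro c c' hc hc'
    have h1 := h hc hc'
    have h2 := ENNReal.toReal_mono (ENNReal.mul_ne_top ENNReal.ofReal_ne_top (beta_lt_top D hn hv hc').ne) h1
    rw [ENNReal.toReal_mul, ENNReal.toReal_ofReal (by positivity)] at h2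
    exact h2
  intro c hc
  refine (NNReal.tendsto_coe).1 ?_
  set m := ((2 * n + 2 : ℝ) - j)
  have l0 : Tendsto (fun c' : Hco n j => (1 + K * ‖c' - c‖) ^ m) (𝓝[{c | Adm v c}] c) (𝓝 1) := by
    have : ContinuousAt (fun c' : Hco n j => (1 + K * ‖c' - c‖) ^ m) c := by
      refine ContinuousAt.rpow_const (by fun_prop) (Or.inl (by simp))
    have h' := this.tendsto
    simp only [sub_self, norm_zero, mul_zero, add_zero, Real.one_rpow] at h'
    exact h'.mono_left nhdsWithin_le_nhds
  have l1 : Tendsto (fun c' : Hco n j => (1 + K * ‖c' - c‖) ^ m * (beta D v c).toNNReal)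
      (𝓝[{c | Adm v c}] c) (𝓝 ((beta D v c).toNNReal : ℝ)) := by
    simpa using l0.mul_const ((beta D v c).toNNReal : ℝ)
  have l2 : Tendsto (fun c' : Hco n j => ((1 + K * ‖c' - c‖) ^ m)⁻¹ * (beta D v c).toNNReal)
      (𝓝[{c | Adm v c}] c) (𝓝 ((beta D v c).toNNReal : ℝ)) := by
    simpa using (l0.inv₀ one_ne_zero).mul_const ((beta D v c).toNNReal : ℝ)
  refine tendsto_of_tendsto_of_tendsto_of_le_of_le' l2 l1 ?_ ?_
  · filter_upwards [self_mem_nhdsWithin] with c' hc'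
    have h1 := key hc hc'
    rw [norm_sub_rev] at h1
    rw [inv_mul_le_iff₀ (by positivity)]
    exact h1
  · filter_upwards [self_mem_nhdsWithin] with c' hc'
    exact key hc' hc

lemma continuousOn_thetaD (D : HomDist n) (hn : 1 ≤ n) (hv : IsoV v) :
    ContinuousOn (fun c : Hco n j => thetaD D v c) {c | Adm v c} := by
  unfold thetaD
  refine continuousOn_const.div (continuousOn_beta D hn hv) fun c hc => ?_
  exact (ENNReal.toNNReal_pos (beta_pos D hn hv hc).ne' (beta_lt_top D hn hv hc).ne).ne'

/-- intrinsic graphs of class `C¹` -/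
structure Gr (D : HomDist n) (v : (Fin j → ℝ) →ₗ[ℝ] Hpt n) (F : Hpt n → Fin j → ℝ)
    (c : Hpt n → Hco n j) : Prop where
  fib : Fib v F
  adm : ∀ x, Adm v (c x)
  cont : Continuous c
  strict : ∀ x, ∀ η > 0, ∃ r > 0, ∀ q q', D.d x q < r → D.d x q' < r →
    ‖F q' - F q - dlin (c x) (hmul (hinv q) q')‖ ≤ η * D.d q q'

variable {F : Hpt n → Fin j → ℝ} {c : Hpt n → Hco n j} {D : HomDist n}

lemma Gr.upper (hn : 1 ≤ n) (h : Gr D v F c) (x : Hpt n) (C : NNReal)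
    (hC : 1 < C) : ∃ r0 > 0, ∀ ρ, 0 < ρ → ρ < r0 → ∀ y, D.d x y < r0 →
      (thetaD D v (c x) : ℝ≥0∞) * lam v F (hball D y ρ) ≤
        C * ENNReal.ofReal ((2*ρ) ^ ((2 * n + 2 : ℝ) - j)) := by
  set m := ((2 * n + 2 : ℝ) - j)
  have hv := h.fib.iso
  obtain ⟨Cv, hCv, hCv'⟩ := exists_nm_v_le D hn hv
  obtain ⟨η, hη, hη1, hη2⟩ := exists_small_pow (4 * Cv) m (c := C) (by exact_mod_cast hC)
  obtain ⟨r, hr, hst⟩ := h.strict x η hη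
  refine ⟨r / 2, by positivity, fun ρ hρ hρr y hy => ?_⟩
  by_cases h0 : lam v F (hball D y ρ) = 0
  · simp [h0]
  have : ∃ σ ∈ hball D y ρ, F σ = 0 := by
    by_contra hcon
    push Not at hcon
    exact h0 (measure_mono_null (fun σ hσ => hcon σ hσ) h.fib.lam_zeroSet)
  obtain ⟨σ, hσ, hσ0⟩ := this
  have hσ' : D.d y σ < ρ := hσ
  have h1 := lam_compare D hn h.fib (fib_aff hv (h.adm x) σ) hCv hCv' y (s := ρ)
    (δ := 2 * η * ρ) ?_
  · have e : ρ + 2 * Cv * (2 * η * ρ) = (1 + 4 * Cv * η) * ρ := by ring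
    rw [e] at h1
    have h2 := h1.trans (lam_aff_le D hn hv (h.adm x) σ y (s := (1 + 4 * Cv * η) * ρ) (by positivity))
    calc _ ≤ (thetaD D v (c x) : ℝ≥0∞) * (ENNReal.ofReal (((1 + 4 * Cv * η) * ρ) ^ m) * beta D v (c x)) := by
          gcongr
      _ = ENNReal.ofReal (((1 + 4 * Cv * η) * ρ) ^ m) * ((thetaD D v (c x) : ℝ≥0∞) * beta D v (c x)) := by
          ring
      _ = ENNReal.ofReal (((1 + 4 * Cv * η) * ρ) ^ m * 2 ^ m) := by
          rw [coe_thetaD D hn hv (h.adm x), ENNReal.ofReal_mul (by positivity)]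
      _ ≤ ENNReal.ofReal (C * (2*ρ) ^ m) := by
          refine ENNReal.ofReal_le_ofReal ?_
          rw [Real.mul_rpow hη2.le hρ.le, Real.mul_rpow (by norm_num) hρ.le]
          have : 0 ≤ (2:ℝ) ^ m * ρ ^ m := by positivity
          nlinarith
      _ = _ := by rw [ENNReal.ofReal_mul (by positivity), ENNReal.ofReal_coe_nnreal]
  · intro σ' h2 h3
    have t1 := D.triangle x y σ
    have t2 := D.triangle x y σ'
    have := hst σ σ' (by linarith) (by linarith)
    rw [h3, hσ0, sub_self, zero_sub, norm_neg] at this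
    refine this.trans ?_
    have t3 := D.triangle σ y σ'
    rw [D.symm σ y] at t3
    nlinarith

lemma Gr.lower (hn : 1 ≤ n) (h : Gr D v F c) (x : Hpt n) (C : NNReal)
    (hC : 1 < C) : ∃ r0 > 0, ∀ ρ, 0 < ρ → ρ < r0 → ∀ x', F x' = 0 → D.d x x' < r0 →
      ∃ y, D.d x' y ≤ ρ ∧ ENNReal.ofReal ((2*ρ) ^ ((2 * n + 2 : ℝ) - j)) ≤ 
        C * ((thetaD D v (c x) : ℝ≥0∞) * lam v F (hball D y ρ)) := by
  set m := ((2 * n + 2 : ℝ) - j)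
  have hv := h.fib.iso
  obtain ⟨Cv, hCv, hCv'⟩ := exists_nm_v_le D hn hv
  obtain ⟨C1, hC1, hC1'⟩ := exists_between hC
  obtain ⟨η, hη, hη1, hη2⟩ := exists_small_pow (4 * Cv) m (c := C1) (by exact_mod_cast hC1)
  obtain ⟨r, hr, hst⟩ := h.strict x η hη
  have hb0 := beta_pos D hn hv (h.adm x)
  have hbt := beta_lt_top D hn hv (h.adm x)
  have hC0 : (C : ℝ≥0∞) ≠ 0 := by exact_mod_cast (lt_trans zero_lt_one hC).ne'
  have hC10 : (C1 : ℝ≥0∞) ≠ 0 := by exact_mod_cast (lt_trans zero_lt_one hC1).ne'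
  have hlt : (C1 / C : ℝ≥0∞) * beta D v (c x) < beta D v (c x) := by
    conv_rhs => rw [← one_mul (beta D v (c x))]
    refine ENNReal.mul_lt_mul_left hb0.ne' hbt.ne ?_
    rw [ENNReal.div_lt_iff (Or.inl hC0) (Or.inl (by simp)), one_mul]
    exact_mod_cast hC1'
  obtain ⟨y0, hy0, hy0'⟩ := exists_beta D hn hv (h.adm x) hlt
  refine ⟨r / 4, by positivity, fun ρ hρ hρr x' hx' hxx => ?_⟩
  set s := ρ / (1 + 4 * Cv * η) with hs
  have hK : 1 ≤ 1 + 4 * Cv * η := by have : 0 ≤ 4 * Cv * η := by positivity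
                                     linarith
  have hs0 : 0 < s := by positivity
  have hsρ : s ≤ ρ := div_le_self hρ.le hK
  have hsρ' : (1 + 4 * Cv * η) * s = ρ := by rw [hs]; field_simp
  have hdy : D.d x' (hmul x' (hdil s y0)) ≤ s := by
    rw [d_hmul_right, nm_hdil D hs0]; nlinarith
  refine ⟨hmul x' (hdil s y0), hdy.trans hsρ, ?_⟩
  set y := hmul x' (hdil s y0)
  have h1 := lam_compare D hn (fib_aff hv (h.adm x) x') h.fib hCv hCv' y (s := s)
    (δ := 2 * η * s) ?_
  · rw [show s + 2 * Cv * (2 * η * s) = ρ by rw [← hsρ']; ring] at h1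
    rw [lam_aff D hn hv (h.adm x) x' y hs0] at h1
    have e : hdil s⁻¹ (hmul (hinv x') y) = y0 := by
      rw [hinv_hmul_cancel, hdil_inv_cancel' hs0.ne']
    rw [e] at h1
    have h2 : ENNReal.ofReal (s ^ m) * ((C1 / C : ℝ≥0∞) * beta D v (c x)) ≤ lam v F (hball D y ρ) := by
      refine le_trans ?_ h1
      gcongr
    calc ENNReal.ofReal ((2*ρ) ^ m) 
        ≤ ENNReal.ofReal (C1 * s ^ m * 2 ^ m) := by
          refine ENNReal.ofReal_le_ofReal ?_
          rw [← hsρ', Real.mul_rpow (by norm_num) (by positivity), Real.mul_rpow hη2.le hs0.le]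
          have : 0 ≤ (2:ℝ) ^ m * s ^ m := by positivity
          nlinarith
      _ = C1 * ENNReal.ofReal (s ^ m) * ((thetaD D v (c x) : ℝ≥0∞) * beta D v (c x)) := by
          rw [coe_thetaD D hn hv (h.adm x), ENNReal.ofReal_mul (by positivity),
            ENNReal.ofReal_mul (by positivity), ENNReal.ofReal_coe_nnreal]
      _ = C * ((thetaD D v (c x) : ℝ≥0∞) * (ENNReal.ofReal (s ^ m) * ((C1 / C : ℝ≥0∞) * beta D v (c x)))) := by
          have : (C1 : ℝ≥0∞) = C * (C1 / C) := (ENNReal.mul_div_cancel hC0 (by simp)).symm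
          conv_lhs => rw [this]
          ring
      _ ≤ _ := by gcongr
  · intro σ h2 h3
    have t1 := D.triangle x x' y
    have t2 := D.triangle x y σ
    have t3 := D.triangle x' y σ
    have := hst x' σ (by linarith) (by linarith)
    unfold aff at h3
    rw [h3, hx', sub_zero, sub_zero] at this
    refine this.trans ?_
    nlinarith

/-- Area formula for intrinsic graphs. -/
theorem Gr.area (hn : 1 ≤ n) (hj : j ≤ n) (h : Gr D v F c) {A : Set (Hpt n)} (hA : MeasurableSet A)
    (hAF : ∀ q ∈ A, F q = 0) :
    sphMeasure D ((2 * n + 2 : ℝ) - j) A = ∫⁻ x in A, thetaD D v (c x) ∂(lam v F) := by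
  haveI := h.fib.finite_lam
  refine area_H (Sg := {q | F q = 0}) D hn ?_ ?_ ?_ ?_ ?_ hA hAF
  · have : (j:ℝ) ≤ n := by exact_mod_cast hj
    have : (0:ℝ) ≤ n := by positivity
    linarith
  · have h1 : Continuous fun x => thetaD D v (c x) :=
      (continuousOn_thetaD D hn h.fib.iso).comp_continuous h.cont h.adm
    exact h1.continuousOn
  · exact fun x _ => thetaD_pos D hn h.fib.iso (h.adm x)
  · exact fun x _ C hC => h.upper hn x C hC
  · exact fun x _ C hC => h.lower hn x C hC

end gr

end Heis
end


open MeasureTheory Topology Filter Set ENNReal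
set_option autoImplicit false
noncomputable section
namespace Heis
variable {n : ℕ}

/-! ### Mean value theorem -/

/-- horizontal basis elements of the group -/
def bH (l : Fin (2*n)) : Hpt n := frameVec (hIdx l) 0

lemma bH_lt (l : Fin (2*n)) (h : (l:ℕ) < n) : bH l = ((Pi.single ⟨l, h⟩ 1, 0, 0) : Hpt n) := by
  simp [bH, frameVec, hIdx, h]

lemma bH_ge (l : Fin (2*n)) (h : ¬ (l:ℕ) < n) :
    bH l = ((0, Pi.single ⟨(l:ℕ) - n, by omega⟩ 1, 0) : Hpt n) := by
  have h2 : (l:ℕ) < 2*n := l.2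
  simp [bH, frameVec, hIdx, h]

lemma hmul_smul_bH (q : Hpt n) (s : ℝ) (l : Fin (2*n)) :
    hmul q (s • bH l) = q + s • frameVec (hIdx l) q := by
  by_cases h : (l:ℕ) < n
  · rw [bH_lt l h]
    have e : frameVec (hIdx l) q = (Pi.single (⟨l, h⟩ : Fin n) 1, 0, -(q.2.1 ⟨l, h⟩) / 2) := by
      simp [frameVec, hIdx, h]
    rw [e]
    refine hpt_ext ?_ ?_ ?_
    · simp [hmul]
    · simp [hmul]
    · simp [hmul, Pi.single_apply, Finset.sum_ite_eq]
      ring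
  · have h2 : (l:ℕ) < 2*n := l.2
    rw [bH_ge l h]
    have e : frameVec (hIdx l) q = (0, Pi.single (⟨(l:ℕ) - n, by omega⟩ : Fin n) 1, 
      q.1 ⟨(l:ℕ) - n, by omega⟩ / 2) := by
      simp [frameVec, hIdx, h]
    rw [e]
    refine hpt_ext ?_ ?_ ?_
    · simp [hmul]
    · simp [hmul]
    · simp [hmul, Pi.single_apply, Finset.sum_ite_eq]
      ring

lemma frameVec_seg (q : Hpt n) (s : ℝ) (l : Fin (2*n)) :
    frameVec (hIdx l) (hmul q (s • bH l)) = frameVec (hIdx l) q := by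
  by_cases h : (l:ℕ) < n
  · rw [bH_lt l h]
    simp [frameVec, hIdx, h, hmul]
  · have h2 : (l:ℕ) < 2*n := l.2
    rw [bH_ge l h]
    simp [frameVec, hIdx, h, hmul]

lemma hasDerivAt_seg {f : Hpt n → ℝ} {q : Hpt n} {l : Fin (2*n)} {s : ℝ}
    (h : LineDifferentiableAt ℝ f (hmul q (s • bH l)) (frameVec (hIdx l) (hmul q (s • bH l)))) :
    HasDerivAt (fun u : ℝ => f (hmul q (u • bH l))) (gradH f (hmul q (s • bH l)) l) s := by
  have h1 := h.hasLineDerivAt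
  unfold HasLineDerivAt at h1
  have h2 : HasDerivAt (fun u : ℝ => u - s) 1 s := (hasDerivAt_id s).sub_const s
  have h3 := HasDerivAt.comp s (h₂ := fun t : ℝ => f (hmul q (s • bH l) + t • frameVec (hIdx l) (hmul q (s • bH l))))
    (h := fun u : ℝ => u - s) (by simpa using h1) h2
  rw [mul_one] at h3
  refine h3.congr_of_eventuallyEq (Filter.Eventually.of_forall fun u => ?_)
  simp only [Function.comp]
  rw [frameVec_seg, hmul_smul_bH, hmul_smul_bH, add_assoc, ← add_smul]
  congr 3
  ring

lemma dlin1_bH (c : Fin (2*n) → ℝ) (s : ℝ) (l : Fin (2*n)) : dlin1 c (s • bH l) = s * c l := by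
  by_cases h : (l:ℕ) < n
  · rw [bH_lt l h]
    simp [dlin1, Pi.single_apply]
  · have h2 : (l:ℕ) < 2*n := l.2
    rw [bH_ge l h]
    simp only [dlin1, Prod.smul_mk, smul_zero, Pi.zero_apply, zero_mul, zero_add, Pi.smul_apply,
      Pi.single_apply, smul_eq_mul, mul_ite, mul_one, mul_zero, ite_mul, Finset.sum_ite_eq',
      Finset.mem_univ, if_true]
    congr 2
    ext; simp; omega

lemma dlin1_zero (c : Fin (2*n) → ℝ) : dlin1 c 0 = 0 := by simp [dlin1]

/-- increments bound -/
def MV (D : HomDist n) (h : Hpt n) (A : ℝ) : Prop :=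
  nm D h ≤ A ∧ ∀ (q : Hpt n) (f : Hpt n → ℝ) (c : Fin (2*n) → ℝ) (η : ℝ), 0 ≤ η →
    (∀ h', nm D h' ≤ A → ∀ l, 
      LineDifferentiableAt ℝ f (hmul q h') (frameVec (hIdx l) (hmul q h')) ∧
      |gradH f (hmul q h') l - c l| ≤ η) → |f (hmul q h) - f q - dlin1 c h| ≤ η * A

lemma MV.mono {D : HomDist n} {h : Hpt n} {A B : ℝ} (H : MV D h A) (hAB : A ≤ B) : MV D h B := by
  refine ⟨H.1.trans hAB, fun q f c η hη hh => ?_⟩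
  refine (H.2 q f c η hη fun h' h1 => hh h' (h1.trans hAB)).trans ?_
  gcongr

lemma MV.mul {D : HomDist n} {h h' : Hpt n} {A B : ℝ} (H : MV D h A) (H' : MV D h' B) :
    MV D (hmul h h') (A + B) := by
  have hA : 0 ≤ A := (nm_nonneg D h).trans H.1
  have hB : 0 ≤ B := (nm_nonneg D h').trans H'.1
  refine ⟨(nm_mul_le D h h').trans (add_le_add H.1 H'.1), fun q f c η hη hh => ?_⟩
  have h1 := H.2 q f c η hη fun w hw => hh w (by linarith)
  have h2 := H'.2 (hmul q h) f c η hη fun w hw => by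
    rw [hmul_assoc']
    exact hh _ ((nm_mul_le D h w).trans (add_le_add H.1 hw))
  rw [← hmul_assoc', dlin1_hmul]
  have : f (hmul (hmul q h) h') - f q - (dlin1 c h + dlin1 c h') =
    (f (hmul (hmul q h) h') - f (hmul q h) - dlin1 c h') + (f (hmul q h) - f q - dlin1 c h) := by ring
  rw [this]
  refine (abs_add_le _ _).trans ?_
  linarith

lemma MV_zero (D : HomDist n) : MV D 0 0 := by
  refine ⟨by simp, fun q f c η hη _ => by simp [dlin1_zero]⟩

lemma MV_seg (D : HomDist n) (hn : 1 ≤ n) : ∃ K > 0, ∀ (s : ℝ) (l : Fin (2*n)),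
    MV D (s • bH l) (K * |s|) := by
  obtain ⟨C, hC, h⟩ := exists_nm_le_qn D hn
  have hb : ∀ (s : ℝ) (l : Fin (2*n)), nm D (s • bH l) ≤ C * |s| := by
    intro s l
    refine (h _).trans ?_
    gcongr
    by_cases h : (l:ℕ) < n
    · rw [bH_lt l h]
      simp [qn, norm_smul, Pi.norm_single]
    · have h2 : (l:ℕ) < 2*n := l.2
      rw [bH_ge l h]
      simp [qn, norm_smul, Pi.norm_single]
  refine ⟨C + 1, by positivity, fun s l => ?_⟩
  refine ⟨(hb s l).trans (by nlinarith [abs_nonneg s]), fun q f c η hη hh => ?_⟩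
  have hd : ∀ u ∈ uIcc 0 s, HasDerivWithinAt (fun u : ℝ => f (hmul q (u • bH l)) - u * c l)
      (gradH f (hmul q (u • bH l)) l - c l) (uIcc 0 s) u ∧
      |gradH f (hmul q (u • bH l)) l - c l| ≤ η := by
    intro u hu
    have hus : |u| ≤ |s| := by
      have := abs_sub_left_of_mem_uIcc hu
      simpa using this
    have h1 := hh (u • bH l) ((hb u l).trans (by nlinarith [abs_nonneg u, abs_nonneg s])) l
    refine ⟨?_, h1.2⟩
    have h2 := (hasDerivAt_seg h1.1).sub ((hasDerivAt_id u).mul_const (c l))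
    simp only [one_mul] at h2
    exact h2.hasDerivWithinAt
  have := Convex.norm_image_sub_le_of_norm_hasDerivWithin_le (f := fun u : ℝ => f (hmul q (u • bH l)) - u * c l)
    (fun u hu => (hd u hu).1) (fun u hu => (hd u hu).2) (convex_uIcc 0 s) left_mem_uIcc right_mem_uIcc
  simp only [zero_smul, hmul_zero', zero_mul, sub_zero, Real.norm_eq_abs] at this
  rw [dlin1_bH]
  calc _ = |f (hmul q (s • bH l)) - s * c l - f q| := by congr 1; ring
    _ ≤ η * |s| := this
    _ ≤ _ := by
      have := mul_nonneg hη (abs_nonneg s)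
      nlinarith [mul_nonneg hC.le this]

lemma MV_all (D : HomDist n) (hn : 1 ≤ n) : ∃ K > 0, ∀ h : Hpt n, MV D h (K * nm D h) := by
  obtain ⟨K, hK, hs⟩ := MV_seg D hn
  obtain ⟨C, hC, hq⟩ := exists_qn_le_nm D hn
  have hX : ∀ (x : Fin n → ℝ) (s : Finset (Fin n)), 
      MV D (((fun i => if i ∈ s then x i else 0), 0, 0) : Hpt n) (K * ∑ i ∈ s, |x i|) := by
    intro x s
    induction s using Finset.induction_on with
    | empty =>
      have h0 : MV D (((fun _ => 0), 0, 0) : Hpt n) 0 := MV_zero D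
      simpa using h0
    | insert a s ha ih =>
      have h1 := ih.mul (hs (x a) ⟨a, by omega⟩)
      rw [Finset.sum_insert ha, mul_add, add_comm]
      convert h1 using 1
      rw [bH_lt _ (by simp)]
      refine hpt_ext ?_ ?_ ?_
      · funext i
        by_cases hi : i = a
        · subst hi; simp [hmul, ha]
        · simp [hmul, hi]
      · simp [hmul]
      · simp [hmul]
  have hY : ∀ (x : Fin n → ℝ) (s : Finset (Fin n)), 
      MV D ((0, (fun i => if i ∈ s then x i else 0), 0) : Hpt n) (K * ∑ i ∈ s, |x i|) := by
    intro x s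
    induction s using Finset.induction_on with
    | empty =>
      have h0 : MV D ((0, (fun _ => 0), 0) : Hpt n) 0 := MV_zero D
      simpa using h0
    | insert a s ha ih =>
      have h1 := ih.mul (hs (x a) ⟨n + a, by omega⟩)
      rw [Finset.sum_insert ha, mul_add, add_comm]
      convert h1 using 1
      rw [bH_ge _ (by simp)]
      refine hpt_ext ?_ ?_ ?_
      · simp [hmul]
      · funext i
        by_cases hi : i = a
        · subst hi; simp [hmul, ha]
        · simp [hmul, hi]
      · simp [hmul]
  have hT : ∀ a b : ℝ, MV D ((0, 0, a * b) : Hpt n) (K * |a| + K * |b| + K * |a| + K * |b|) := by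
    intro a b
    have h1 := (((hs a ⟨0, by omega⟩).mul (hs b ⟨n + 0, by omega⟩)).mul (hs (-a) ⟨0, by omega⟩)).mul
      (hs (-b) ⟨n + 0, by omega⟩)
    rw [abs_neg, abs_neg] at h1
    convert h1 using 1
    rw [bH_lt _ (show 0 < n by omega), bH_ge _ (show ¬ (n + 0 < n) by omega)]
    refine hpt_ext ?_ ?_ ?_
    · simp [hmul]
    · simp [hmul]
    · simp [hmul, Pi.single_apply]
      ring
  have hT2 : ∀ τ : ℝ, MV D ((0, 0, τ) : Hpt n) (4 * K * √|τ|) := by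
    intro τ
    rcases le_total 0 τ with h | h
    · have := hT (√|τ|) (√|τ|)
      rw [Real.mul_self_sqrt (abs_nonneg _), abs_of_nonneg h, abs_of_nonneg (Real.sqrt_nonneg _)] at this
      rw [abs_of_nonneg h]
      exact this.mono (by linarith)
    · have := hT (-√|τ|) (√|τ|)
      rw [neg_mul, Real.mul_self_sqrt (abs_nonneg _), abs_of_nonpos h, abs_neg,
        abs_of_nonneg (Real.sqrt_nonneg _), neg_neg] at this
      rw [abs_of_nonpos h]
      exact this.mono (by linarith)
  have hn0 : (1:ℝ) ≤ n := by exact_mod_cast hn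
  refine ⟨(K * n + 4 * K * (1 + n)) * C, by positivity, fun h => ?_⟩
  set S : ℝ := ∑ i, h.1 i * h.2.1 i
  have h0 := ((hX h.1 Finset.univ).mul (hY h.2.1 Finset.univ)).mul (hT2 (h.2.2 - S / 2))
  simp only [Finset.mem_univ, if_true] at h0
  have e : hmul (hmul ((h.1, 0, 0) : Hpt n) (0, h.2.1, 0)) (0, 0, h.2.2 - S / 2) = h := by
    refine hpt_ext ?_ ?_ ?_
    · simp [hmul]
    · simp [hmul]
    · simp [hmul, S]
  have e' : hmul (hmul (((fun i => h.1 i), 0, 0) : Hpt n) (0, (fun i => h.2.1 i), 0)) (0, 0, h.2.2 - S / 2) = h := e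
  rw [e'] at h0
  refine h0.mono ?_
  have b1 : ∀ x : Fin n → ℝ, ∑ i, |x i| ≤ n * ‖x‖ := by
    intro x
    calc ∑ i, |x i| ≤ ∑ _i : Fin n, ‖x‖ := Finset.sum_le_sum fun i _ => norm_le_pi_norm x i
      _ = _ := by simp
  have b2 : |S| ≤ n * (‖h.1‖ * ‖h.2.1‖) := by
    calc |S| ≤ ∑ i, |h.1 i * h.2.1 i| := Finset.abs_sum_le_sum_abs _ _
      _ ≤ ∑ _i : Fin n, ‖h.1‖ * ‖h.2.1‖ := Finset.sum_le_sum fun i _ => by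
          rw [abs_mul]
          exact mul_le_mul (norm_le_pi_norm h.1 i) (norm_le_pi_norm h.2.1 i) (abs_nonneg _) (norm_nonneg _)
      _ = _ := by simp
  have b3 : √|h.2.2 - S / 2| ≤ √|h.2.2| + n * (‖h.1‖ + ‖h.2.1‖) := by
    rw [Real.sqrt_le_iff]
    refine ⟨by positivity, ?_⟩
    have s1 : |h.2.2 - S / 2| ≤ |h.2.2| + |S| / 2 := by
      refine (abs_sub _ _).trans ?_
      rw [abs_div]; simp
    have s2 := Real.sq_sqrt (abs_nonneg h.2.2)
    have s3 : 0 ≤ √|h.2.2| * (n * (‖h.1‖ + ‖h.2.1‖)) := by positivity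
    have s4 : n * (‖h.1‖ * ‖h.2.1‖) ≤ (n * (‖h.1‖ + ‖h.2.1‖))^2 := by
      have p1 := norm_nonneg h.1
      have p2 := norm_nonneg h.2.1
      have p3 : ‖h.1‖ * ‖h.2.1‖ ≤ (‖h.1‖ + ‖h.2.1‖)^2 := by nlinarith [mul_nonneg p1 p2]
      have p4 : (n:ℝ) ≤ n^2 := by nlinarith
      rw [mul_pow]
      exact mul_le_mul p4 p3 (by positivity) (by positivity)
    have s5 : 0 ≤ n * (‖h.1‖ * ‖h.2.1‖) := by positivity
    nlinarith
  have b4 := hq h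
  unfold qn at b4
  calc K * ∑ i, |h.1 i| + K * ∑ i, |h.2.1 i| + 4 * K * √|h.2.2 - S / 2|
      ≤ K * (n * ‖h.1‖) + K * (n * ‖h.2.1‖) + 4 * K * (√|h.2.2| + n * (‖h.1‖ + ‖h.2.1‖)) := by
        gcongr
        · exact b1 _
        · exact b1 _
    _ ≤ (K * n + 4 * K * (1 + n)) * (‖h.1‖ + ‖h.2.1‖ + √|h.2.2|) := by
        have p0 := Real.sqrt_nonneg |h.2.2|
        have : 0 ≤ K * n * √|h.2.2| := by positivity
        have : 0 ≤ K * (‖h.1‖ + ‖h.2.1‖) := by positivity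
        nlinarith [mul_nonneg this (by positivity : (0:ℝ) ≤ n)]
    _ ≤ (K * n + 4 * K * (1 + n)) * (C * nm D h) := by gcongr
    _ = _ := by ring

end Heis
end


open MeasureTheory Topology Filter Set ENNReal
set_option autoImplicit false
noncomputable section
namespace Heis
variable {n : ℕ}

lemma IsC1H.strict (D : HomDist n) (hn : 1 ≤ n) {U : Set (Hpt n)} (hU : IsOpen U) {f : Hpt n → ℝ}
    (hf : IsC1H U f) {x : Hpt n} (hx : x ∈ U) {η : ℝ} (hη : 0 < η) :
    ∃ r > 0, ∀ q q', D.d x q < r → D.d x q' < r →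
      |f q' - f q - dlin1 (gradH f x) (hmul (hinv q) q')| ≤ η * D.d q q' := by
  obtain ⟨K, hK, hMV⟩ := MV_all D hn
  have hev : ∀ᶠ q in 𝓝 x, q ∈ U ∧ ∀ l, |gradH f q l - gradH f x l| ≤ η / K := by
    refine (hU.eventually_mem hx).and ?_
    refine eventually_all.2 fun l => ?_
    have h1 := (hf.contGrad l).continuousAt (hU.mem_nhds hx)
    have h2 := Metric.tendsto_nhds.1 h1 (η / K) (by positivity)
    filter_upwards [h2] with q hq
    rw [Real.dist_eq] at hq
    exact hq.le
  obtain ⟨R, hR, hs⟩ := exists_hball_subset D hn hev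
  refine ⟨R / (1 + 2 * K), by positivity, fun q q' hq hq' => ?_⟩
  have hd : D.d q q' ≤ 2 * (R / (1 + 2 * K)) := by
    have := D.triangle q x q'
    rw [D.symm q x] at this
    linarith
  have h1 := (hMV (hmul (hinv q) q')).2 q f (gradH f x) (η / K) (by positivity) ?_
  · rw [hmul_hinv_cancel, ← d_eq_nm] at h1
    refine h1.trans (le_of_eq ?_)
    field_simp
  · intro h' hh' l
    rw [← d_eq_nm] at hh'
    have h2 : D.d x (hmul q h') < R := by
      have t := D.triangle x q (hmul q h')
      rw [d_hmul_right] at t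
      have e : R / (1 + 2 * K) * (1 + 2 * K) = R := by field_simp
      nlinarith
    have h3 := hs h2
    exact ⟨hf.ldiff _ h3.1 l, h3.2 l⟩

lemma exists_Gr (D : HomDist n) (hn : 1 ≤ n) {j : ℕ} {v : (Fin j → ℝ) →ₗ[ℝ] Hpt n} (hv : IsoV v)
    {L : Hco n j} (hL : ∀ a, dlin L (v a) = a) : ∃ ε > 0, ∀ F : Hpt n → Fin j → ℝ,
    (∀ i, IsC1H univ fun q => F q i) → (∀ q i l, |gradH (fun q => F q i) q l - L i l| ≤ ε) →
    Gr D v F (fun q i => gradH (fun q => F q i) q) := by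
  obtain ⟨K, hK, hMV⟩ := MV_all D hn
  obtain ⟨Cv, hCv, hCv'⟩ := exists_nm_v_le D hn hv
  obtain ⟨C, hC, hC'⟩ := exists_dlin_le D hn
  refine ⟨min (1 / (2 * K * Cv)) (1 / (2 * C * Cv)), by positivity, fun F hF hFL => ?_⟩
  refine ⟨⟨hv, continuous_pi fun i => ?_, fun q a => ?_⟩, fun x a => ?_, ?_, fun x η hη => ?_⟩
  · exact continuousOn_univ.1 (hF i).contOn
  · refine (pi_norm_le_iff_of_nonneg (by positivity)).2 fun i => ?_
    have h1 := (hMV (v a)).2 q (fun q => F q i) (L i) (1 / (2 * K * Cv)) (by positivity)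
      fun h' _ l => ⟨(hF i).ldiff _ (mem_univ _) l, (hFL _ i l).trans (min_le_left _ _)⟩
    have h2 : dlin1 (L i) (v a) = a i := congrFun (hL a) i
    rw [h2] at h1
    refine h1.trans ?_
    calc 1 / (2 * K * Cv) * (K * nm D (v a)) ≤ 1 / (2 * K * Cv) * (K * (Cv * ‖a‖)) := by
          gcongr; exact hCv' a
      _ = _ := by field_simp
  · have h1 := hC' j ((fun i => gradH (fun q => F q i) x) - L) (v a)
    rw [dlin_sub, hL] at h1
    refine h1.trans ?_
    have h2 : ‖(fun i => gradH (fun q => F q i) x) - L‖ ≤ 1 / (2 * C * Cv) := by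
      refine (pi_norm_le_iff_of_nonneg (by positivity)).2 fun i => ?_
      refine (pi_norm_le_iff_of_nonneg (by positivity)).2 fun l => ?_
      exact (hFL x i l).trans (min_le_right _ _)
    calc _ ≤ C * (1 / (2 * C * Cv)) * (Cv * ‖a‖) := by
          have := hCv' a
          have := nm_nonneg D (v a)
          gcongr
      _ = _ := by field_simp
  · refine continuous_pi fun i => continuous_pi fun l => ?_
    exact continuousOn_univ.1 ((hF i).contGrad l)
  · choose r hr h using fun i => (hF i).strict D hn isOpen_univ (mem_univ x) hη
    obtain ⟨r0, hr0, hle⟩ : ∃ r0 > 0, ∀ i, r0 ≤ r i := by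
      rcases Nat.eq_zero_or_pos j with rfl | hj
      · exact ⟨1, one_pos, fun i => i.elim0⟩
      · haveI : Nonempty (Fin j) := ⟨⟨0, hj⟩⟩
        obtain ⟨i0, h0⟩ := Finite.exists_min r
        exact ⟨r i0, hr i0, h0⟩
    refine ⟨r0, hr0, fun q q' hq hq' => ?_⟩
    refine (pi_norm_le_iff_of_nonneg (mul_nonneg hη.le (d_nonneg D _ _))).2 fun i => ?_
    exact h i q q' (hq.trans_le (hle i)) (hq'.trans_le (hle i))

/-! ### Isotropic right inverses -/

lemma dlin1_add (c : Fin (2*n) → ℝ) (p q : Hpt n) : dlin1 c (p + q) = dlin1 c p + dlin1 c q := by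
  unfold dlin1
  rw [← Finset.sum_add_distrib]
  refine Finset.sum_congr rfl fun l _ => ?_
  simp only [Prod.fst_add, Prod.snd_add, Pi.add_apply]
  ring

lemma dlin1_smul (c : Fin (2*n) → ℝ) (r : ℝ) (p : Hpt n) : dlin1 c (r • p) = r * dlin1 c p := by
  unfold dlin1
  rw [Finset.mul_sum]
  refine Finset.sum_congr rfl fun l _ => ?_
  simp only [Prod.smul_fst, Prod.smul_snd, Pi.smul_apply, smul_eq_mul]
  ring

/-- `dlin` as a linear map -/
def dlinL {j : ℕ} (c : Hco n j) : Hpt n →ₗ[ℝ] (Fin j → ℝ) where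
  toFun := dlin c
  map_add' p q := funext fun i => dlin1_add (c i) p q
  map_smul' r p := funext fun i => dlin1_smul (c i) r p

/-- symplectic form -/
def om : Hpt n →ₗ[ℝ] Hpt n →ₗ[ℝ] ℝ :=
  LinearMap.mk₂ ℝ (fun p q => (∑ l, p.1 l * q.2.1 l) - ∑ l, q.1 l * p.2.1 l)
    (by intro p q r; simp [add_mul, mul_add, Finset.sum_add_distrib]; ring)
    (by intro a p r; simp [Finset.mul_sum, mul_sub]; simp only [mul_assoc, mul_left_comm])
    (by intro p q r; simp [add_mul, mul_add, Finset.sum_add_distrib]; ring)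
    (by intro a p r; simp [Finset.mul_sum, mul_sub]; simp only [mul_assoc, mul_left_comm])

lemma om_apply (p q : Hpt n) : om p q = (∑ l, p.1 l * q.2.1 l) - ∑ l, q.1 l * p.2.1 l := rfl

lemma om_self (p : Hpt n) : om p p = 0 := by simp [om_apply]

lemma om_symm (p q : Hpt n) : om p q = - om q p := by simp [om_apply]

lemma hmul_eq_om (p q : Hpt n) : hmul p q = ((p.1 + q.1, p.2.1 + q.2.1, p.2.2 + q.2.2 + om p q / 2) : Hpt n) := by
  refine hpt_ext rfl rfl ?_
  simp only [hmul, om_apply]; ring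

lemma om_nondeg {p : Hpt n} (hp : p.2.2 = 0) (h : ∀ w : Hpt n, w.2.2 = 0 → om w p = 0) : p = 0 := by
  refine hpt_ext ?_ ?_ hp
  · funext l
    have := h (0, Pi.single l 1, 0) rfl
    simpa [om_apply, Pi.single_apply] using this
  · funext l
    have := h (Pi.single l 1, 0, 0) rfl
    simpa [om_apply, Pi.single_apply] using this

lemma exists_isoV {j : ℕ} (hj : j ≤ n) {L : Hco n j} (hL : LinearIndependent ℝ L) :
    ∃ v : (Fin j → ℝ) →ₗ[ℝ] Hpt n, IsoV v ∧ ∀ a, dlin L (v a) = a := by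
  -- Lagrangian embeddings
  let P : ((Fin n → ℝ) →ₗ[ℝ] Hpt n) → Prop := fun ι =>
    (∀ a, (ι a).2.2 = 0) ∧ (∀ a, ι a = 0 → a = 0) ∧ ∀ a b, om (ι a) (ι b) = 0
  have h0 : ∃ d : ℕ, ∃ ι, P ι ∧ Module.finrank ℝ (LinearMap.ker (dlinL L ∘ₗ ι)) = d := by
    refine ⟨_, LinearMap.inl ℝ _ _, ⟨fun a => by simp, fun a ha => ?_, fun a b => ?_⟩, rfl⟩
    · simpa using congrArg Prod.fst ha
    · simp [om_apply]
  classical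
  obtain ⟨ι, hι, hd⟩ := Nat.find_spec h0
  have hmin : ∀ ι', P ι' → Module.finrank ℝ (LinearMap.ker (dlinL L ∘ₗ ι)) ≤
      Module.finrank ℝ (LinearMap.ker (dlinL L ∘ₗ ι')) := by
    intro ι' h'
    rw [hd]
    exact Nat.find_min' h0 ⟨ι', h', rfl⟩
  have hsurj : LinearMap.range (dlinL L ∘ₗ ι) = ⊤ := by
    by_contra hne
    obtain ⟨φ, hφ0, hφ⟩ := Submodule.exists_le_ker_of_lt_top _ (lt_top_iff_ne_top.2 hne)
    -- coefficient vector
    set ℓ : Fin (2*n) → ℝ := fun l => ∑ i, φ (Pi.single i 1) * L i l with hℓ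
    have hφa : ∀ b : Fin j → ℝ, φ b = ∑ i, φ (Pi.single i 1) * b i := by
      intro b
      conv_lhs => rw [← Finset.univ_sum_single b, map_sum]
      refine Finset.sum_congr rfl fun i _ => ?_
      rw [show (Pi.single i (b i) : Fin j → ℝ) = b i • Pi.single i 1 by
        rw [← Pi.single_smul]; simp, map_smul, smul_eq_mul, mul_comm]
    have hφL : ∀ p : Hpt n, φ (dlinL L p) = dlin1 ℓ p := by
      intro p
      rw [hφa]
      simp only [dlinL, dlin, dlin1, LinearMap.coe_mk, AddHom.coe_mk, hℓ, Finset.mul_sum]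
      rw [Finset.sum_comm]
      refine Finset.sum_congr rfl fun l _ => ?_
      rw [← Finset.sum_add_distrib]
      refine Finset.sum_congr rfl fun i _ => ?_
      ring
    have hℓ0 : ℓ ≠ 0 := by
      intro h
      have h1 := Fintype.linearIndependent_iff.1 hL (fun i => φ (Pi.single i 1)) (by
        funext l
        have := congrFun h l
        simpa [hℓ] using this)
      apply hφ0
      ext b
      simpa using h1 b
    obtain ⟨e, he, he0⟩ : ∃ e ∈ LinearMap.ker (dlinL L ∘ₗ ι), e ≠ 0 := by
      apply Submodule.exists_mem_ne_zero_of_ne_bot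
      intro hb
      have h1 := LinearMap.finrank_range_add_finrank_ker (dlinL L ∘ₗ ι)
      rw [hb, finrank_bot, add_zero] at h1
      have h2 := Submodule.finrank_lt (lt_top_iff_ne_top.2 hne).ne
      rw [h1] at h2
      simp at h2
      omega
    have hιe : ι e ≠ 0 := fun h => he0 (hι.2.1 e h)
    obtain ⟨w, hwt, hw1, hw2⟩ : ∃ w : Hpt n, w.2.2 = 0 ∧ om w (ι e) ≠ 0 ∧ dlin1 ℓ w ≠ 0 := by
      obtain ⟨w1, hw1t, hw1⟩ : ∃ w : Hpt n, w.2.2 = 0 ∧ om w (ι e) ≠ 0 := by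
        by_contra hcon
        push Not at hcon
        exact hιe (om_nondeg (hι.1 e) hcon)
      obtain ⟨w2, hw2t, hw2⟩ : ∃ w : Hpt n, w.2.2 = 0 ∧ dlin1 ℓ w ≠ 0 := by
        by_contra hcon
        push Not at hcon
        apply hℓ0
        funext l
        have h1 := hcon ((1:ℝ) • bH l) (by
          by_cases h : (l:ℕ) < n
          · simp [bH_lt l h]
          · have h2 : (l:ℕ) < 2*n := l.2
            simp [bH_ge l h])
        rw [dlin1_bH] at h1
        simpa using h1
      by_cases a1 : dlin1 ℓ w1 = 0
      · by_cases a2 : om w2 (ι e) = 0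
        · refine ⟨w1 + w2, by simp [hw1t, hw2t], ?_, ?_⟩
          · simpa [a2] using hw1
          · rw [dlin1_add, a1, zero_add]; exact hw2
        · exact ⟨w2, hw2t, a2, hw2⟩
      · exact ⟨w1, hw1t, hw1, a1⟩
    -- transvection
    set ι' : (Fin n → ℝ) →ₗ[ℝ] Hpt n := ι + ((om w) ∘ₗ ι).smulRight w with hι'
    have hι'a : ∀ a, ι' a = ι a + om w (ι a) • w := fun a => by simp [hι']
    have hP' : P ι' := by
      refine ⟨fun a => ?_, fun a ha => ?_, fun a b => ?_⟩
      · rw [hι'a]; simp [hι.1 a, hwt]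
      · rw [hι'a] at ha
        have h1 := congrArg (om w) ha
        simp only [map_add, map_smul, om_self, smul_zero, add_zero, map_zero] at h1
        rw [h1, zero_smul, add_zero] at ha
        exact hι.2.1 a ha
      · rw [hι'a, hι'a]
        simp only [map_add, map_smul, LinearMap.add_apply, LinearMap.smul_apply, om_self, smul_eq_mul,
          hι.2.2 a b]
        rw [om_symm (ι a) w]; ring
    have hlt : LinearMap.ker (dlinL L ∘ₗ ι') < LinearMap.ker (dlinL L ∘ₗ ι) := by
      have key : ∀ x, dlinL L (ι' x) = 0 → om w (ι x) = 0 ∧ dlinL L (ι x) = 0 := by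
        intro x hx
        rw [hι'a, map_add, map_smul] at hx
        have h1 := congrArg φ hx
        rw [map_add, map_smul, hφL w, map_zero] at h1
        have h2 : φ (dlinL L (ι x)) = 0 := hφ (LinearMap.mem_range_self (dlinL L ∘ₗ ι) x)
        rw [h2, zero_add, smul_eq_mul] at h1
        have h3 := (mul_eq_zero.1 h1).resolve_right hw2
        rw [h3, zero_smul, add_zero] at hx
        exact ⟨h3, hx⟩
      refine lt_of_le_of_ne (fun x hx => (key x hx).2) fun heq => ?_
      have : e ∈ LinearMap.ker (dlinL L ∘ₗ ι') := heq ▸ he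
      exact hw1 (key e this).1
    exact absurd (hmin ι' hP') (not_le.2 (Submodule.finrank_lt_finrank_of_lt hlt))
  obtain ⟨s, hs⟩ := (dlinL L ∘ₗ ι).exists_rightInverse_of_surjective hsurj
  refine ⟨ι ∘ₗ s, ⟨fun a => hι.1 _, fun a b => ?_⟩, fun a => ?_⟩
  · rw [hmul_eq_om]
    simp only [LinearMap.comp_apply, hι.2.2, map_add]
    refine hpt_ext rfl rfl ?_
    simp
  · exact LinearMap.congr_fun hs a

end Heis
end


open MeasureTheory Topology Filter Set ENNReal
set_option autoImplicit false
noncomputable section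
namespace Heis
variable {n : ℕ}

/-- horizontal derivative in direction `l` -/
def HG (f : Hpt n → ℝ) (q : Hpt n) (l : Fin (2*n)) (d : ℝ) : Prop :=
  HasDerivAt (fun s : ℝ => f (hmul q (s • bH l))) d 0

lemma gradH_eq_deriv (f : Hpt n → ℝ) (q : Hpt n) (l : Fin (2*n)) :
    gradH f q l = deriv (fun s : ℝ => f (hmul q (s • bH l))) 0 := by
  simp only [gradH, lineDeriv, hmul_smul_bH]

lemma ldiff_iff (f : Hpt n → ℝ) (q : Hpt n) (l : Fin (2*n)) :
    LineDifferentiableAt ℝ f q (frameVec (hIdx l) q) ↔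
      DifferentiableAt ℝ (fun s : ℝ => f (hmul q (s • bH l))) 0 := by
  simp only [LineDifferentiableAt, hmul_smul_bH]

lemma HG.grad {f : Hpt n → ℝ} {q : Hpt n} {l : Fin (2*n)} {d : ℝ} (h : HG f q l d) :
    gradH f q l = d := by
  rw [gradH_eq_deriv]; exact h.deriv

lemma HG.ldiff {f : Hpt n → ℝ} {q : Hpt n} {l : Fin (2*n)} {d : ℝ} (h : HG f q l d) :
    LineDifferentiableAt ℝ f q (frameVec (hIdx l) q) :=
  (ldiff_iff f q l).2 h.differentiableAt

lemma IsC1H.HG {U : Set (Hpt n)} {f : Hpt n → ℝ} (h : IsC1H U f) {q : Hpt n} (hq : q ∈ U)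
    (l : Fin (2*n)) : HG f q l (gradH f q l) := by
  have := ((ldiff_iff f q l).1 (h.ldiff q hq l)).hasDerivAt
  rwa [← gradH_eq_deriv] at this

lemma IsC1H.of_HG {U : Set (Hpt n)} {f : Hpt n → ℝ} (hf : ContinuousOn f U)
    {g : Hpt n → Fin (2*n) → ℝ} (hg : ∀ q ∈ U, ∀ l, Heis.HG f q l (g q l))
    (hgc : ∀ l, ContinuousOn (fun q => g q l) U) : IsC1H U f :=
  ⟨hf, fun q hq l => (hg q hq l).ldiff, fun l => (hgc l).congr fun q hq => (hg q hq l).grad⟩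

lemma IsC1H.mono {U V : Set (Hpt n)} {f : Hpt n → ℝ} (h : IsC1H U f) (hVU : V ⊆ U) : IsC1H V f :=
  ⟨h.contOn.mono hVU, fun q hq => h.ldiff q (hVU hq), fun l => (h.contGrad l).mono hVU⟩

lemma continuous_seg (q : Hpt n) (l : Fin (2*n)) : Continuous fun s : ℝ => hmul q (s • bH l) := by
  refine Continuous.hmul' continuous_const ?_
  fun_prop

lemma seg_zero (q : Hpt n) (l : Fin (2*n)) : hmul q ((0:ℝ) • bH l) = q := by
  rw [hmul_smul_bH]; simp

lemma HG.congr {f g : Hpt n → ℝ} {q : Hpt n} {l : Fin (2*n)} {d : ℝ} (h : HG f q l d)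
    (hfg : g =ᶠ[𝓝 q] f) : HG g q l d := by
  refine HasDerivAt.congr_of_eventuallyEq h ?_
  have : Tendsto (fun s : ℝ => hmul q (s • bH l)) (𝓝 0) (𝓝 q) := by
    have := (continuous_seg q l).tendsto 0
    rwa [seg_zero] at this
  exact this.eventually hfg

lemma gradH_congr {f g : Hpt n → ℝ} {q : Hpt n} (hfg : g =ᶠ[𝓝 q] f) : gradH g q = gradH f q := by
  funext l
  rw [gradH_eq_deriv, gradH_eq_deriv]
  refine EventuallyEq.deriv_eq ?_
  have : Tendsto (fun s : ℝ => hmul q (s • bH l)) (𝓝 0) (𝓝 q) := by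
    have := (continuous_seg q l).tendsto 0
    rwa [seg_zero] at this
  exact this.eventually hfg

lemma HG.add {f g : Hpt n → ℝ} {q : Hpt n} {l : Fin (2*n)} {d d' : ℝ} (h : HG f q l d)
    (h' : HG g q l d') : HG (fun q => f q + g q) q l (d + d') := HasDerivAt.add h h'

lemma HG.sub {f g : Hpt n → ℝ} {q : Hpt n} {l : Fin (2*n)} {d d' : ℝ} (h : HG f q l d)
    (h' : HG g q l d') : HG (fun q => f q - g q) q l (d - d') := HasDerivAt.sub h h'

lemma HG.mul {f g : Hpt n → ℝ} {q : Hpt n} {l : Fin (2*n)} {d d' : ℝ} (h : HG f q l d)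
    (h' : HG g q l d') : HG (fun q => f q * g q) q l (d * g q + f q * d') := by
  have := HasDerivAt.mul h h'
  simp only [seg_zero] at this
  exact this

lemma HG.const (c : ℝ) (q : Hpt n) (l : Fin (2*n)) : HG (fun _ => c) q l 0 := hasDerivAt_const _ _

lemma HG.sum {ι : Type*} (s : Finset ι) {f : ι → Hpt n → ℝ} {q : Hpt n} {l : Fin (2*n)} {d : ι → ℝ}
    (h : ∀ i ∈ s, HG (f i) q l (d i)) : HG (fun q => ∑ i ∈ s, f i q) q l (∑ i ∈ s, d i) :=
  HasDerivAt.fun_sum h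

lemma HG.const_mul {f : Hpt n → ℝ} {q : Hpt n} {l : Fin (2*n)} {d : ℝ} (c : ℝ) (h : HG f q l d) :
    HG (fun q => c * f q) q l (c * d) := HasDerivAt.const_mul c h

lemma HG_left {f : Hpt n → ℝ} {g q : Hpt n} {l : Fin (2*n)} {d : ℝ} (h : HG f (hmul g q) l d) :
    HG (fun q => f (hmul g q)) q l d := by
  simpa only [HG, hmul_assoc'] using h

lemma HG_dil {f : Hpt n → ℝ} {q : Hpt n} {r : ℝ} {l : Fin (2*n)} {d : ℝ} (h : HG f (hdil r q) l d) :
    HG (fun q => f (hdil r q)) q l (r * d) := by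
  have e : ∀ s : ℝ, f (hdil r (hmul q (s • bH l))) = f (hmul (hdil r q) ((r * s) • bH l)) := by
    intro s
    rw [hdil_hmul]
    congr 2
    by_cases hl : (l:ℕ) < n
    · rw [bH_lt l hl]; simp [hdil, smul_smul]
    · rw [bH_ge l hl]; simp [hdil, smul_smul]
  simp only [HG, e]
  have h1 : HasDerivAt (fun s : ℝ => r * s) r 0 := by simpa using (hasDerivAt_id (0:ℝ)).const_mul r
  have h2 := HasDerivAt.scomp (h := fun s : ℝ => r * s) (0:ℝ) (show HasDerivAt (fun s : ℝ => f (hmul (hdil r q) (s • bH l))) d (r * 0) by rw [mul_zero]; exact h) h1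
  exact h2

lemma HG_dlin1 (c : Fin (2*n) → ℝ) (q : Hpt n) (l : Fin (2*n)) : HG (dlin1 c) q l (c l) := by
  simp only [HG, dlin1_hmul, dlin1_bH]
  simpa using ((hasDerivAt_id (0:ℝ)).mul_const (c l)).const_add (dlin1 c q)

lemma HG_smooth {f : Hpt n → ℝ} (hf : ContDiff ℝ (⊤ : ℕ∞) f) (q : Hpt n) (l : Fin (2*n)) :
    HG f q l (fderiv ℝ f q (frameVec (hIdx l) q)) := by
  have h1 : HasFDerivAt f (fderiv ℝ f q) q := (hf.differentiable (by simp)).differentiableAt.hasFDerivAt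
  have := h1.hasLineDerivAt (frameVec (hIdx l) q)
  simp only [HG, hmul_smul_bH]
  exact this

lemma continuous_frameVec (i : Fin (2*n+1)) : Continuous fun q : Hpt n => frameVec i q := by
  unfold frameVec
  split_ifs <;> fun_prop

lemma continuous_smooth_grad {f : Hpt n → ℝ} (hf : ContDiff ℝ (⊤ : ℕ∞) f) (l : Fin (2*n)) :
    Continuous fun q => fderiv ℝ f q (frameVec (hIdx l) q) := by
  have h1 : Continuous (fderiv ℝ f) := hf.continuous_fderiv (by simp)
  exact h1.clm_apply (continuous_frameVec _)

lemma IsC1H_smooth {f : Hpt n → ℝ} (hf : ContDiff ℝ (⊤ : ℕ∞) f) (U : Set (Hpt n)) : IsC1H U f :=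
  IsC1H.of_HG hf.continuous.continuousOn (fun q _ l => HG_smooth hf q l)
    fun l => (continuous_smooth_grad hf l).continuousOn

/-- extension of a `C¹_ℍ` germ to a global function with almost constant gradient -/
lemma exists_ext (D : HomDist n) (hn : 1 ≤ n) {U : Set (Hpt n)} (hU : IsOpen U) {f : Hpt n → ℝ}
    (hf : IsC1H U f) {p : Hpt n} (hp : p ∈ U) {ε : ℝ} (hε : 0 < ε) :
    ∃ F : Hpt n → ℝ, IsC1H univ F ∧ (∀ q l, |gradH F q l - gradH f p l| ≤ ε) ∧ F =ᶠ[𝓝 p] f := by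
  -- bump
  obtain ⟨χ, hχs, hχ1, hχ0, hχb⟩ : ∃ χ : Hpt n → ℝ, ContDiff ℝ (⊤ : ℕ∞) χ ∧ χ =ᶠ[𝓝 0] (fun _ => 1) ∧
      (∀ q, 1/2 < nm D q → χ q = 0) ∧ ∀ q, |χ q| ≤ 1 := by
    have h1 : {q : Hpt n | nm D q < 1/2} ∈ 𝓝 0 := by
      have := (continuous_nm D hn).isOpen_preimage _ (isOpen_Iio (a := (1/2:ℝ)))
      exact this.mem_nhds (by simp [nm, (D.eq_iff 0 0).2 rfl])
    obtain ⟨r, hr, hrs⟩ := Metric.mem_nhds_iff.1 h1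
    let b : ContDiffBump (0 : Hpt n) := ⟨r/2, r, by positivity, by linarith⟩
    refine ⟨b, b.contDiff, b.eventuallyEq_one, fun q hq => ?_, fun q => ?_⟩
    · refine b.zero_of_le_dist (le_of_not_gt fun h => ?_)
      have : nm D q < 1/2 := hrs h
      linarith
    · rw [abs_of_nonneg b.nonneg]; exact b.le_one
  obtain ⟨C, hC, hCb⟩ : ∃ C > 0, ∀ q l, |fderiv ℝ χ q (frameVec (hIdx l) q)| ≤ C := by
    have hK := isCompact_closed_hball D hn 0 1
    have : ∀ l : Fin (2*n), ∃ C, ∀ q ∈ {q | D.d 0 q ≤ 1}, ‖fderiv ℝ χ q (frameVec (hIdx l) q)‖ ≤ C :=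
      fun l => hK.exists_bound_of_continuousOn (continuous_smooth_grad hχs l).continuousOn
    choose C hC using this
    refine ⟨1 + ∑ l, |C l|, by positivity, fun q l => ?_⟩
    have h0 : |C l| ≤ ∑ l, |C l| := Finset.single_le_sum (f := fun l => |C l|) (fun _ _ => abs_nonneg _) (Finset.mem_univ l)
    by_cases hq : D.d 0 q ≤ 1
    · have := hC l q hq
      rw [Real.norm_eq_abs] at this
      have := le_abs_self (C l)
      linarith
    · have h1 : χ =ᶠ[𝓝 q] fun _ => 0 := by
        have ho := (continuous_nm D hn).isOpen_preimage _ (isOpen_Ioi (a := (1/2:ℝ)))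
        filter_upwards [ho.mem_nhds (show q ∈ _ by simp only [mem_preimage, mem_Ioi, nm]; linarith)] with x hx
        exact hχ0 x hx
      rw [h1.fderiv_eq]
      simp only [fderiv_fun_const, Pi.zero_apply, zero_apply, abs_zero]
      have : 0 ≤ ∑ l, |C l| := Finset.sum_nonneg fun _ _ => abs_nonneg _
      linarith
  set η : ℝ := ε / (C + 1) with hη
  have hη0 : 0 < η := by positivity
  obtain ⟨r1, hr1, hst⟩ := hf.strict D hn hU hp hη0
  have hev : ∀ᶠ q in 𝓝 p, q ∈ U ∧ ∀ l, |gradH f q l - gradH f p l| ≤ η := by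
    refine (hU.eventually_mem hp).and (eventually_all.2 fun l => ?_)
    have h2 := Metric.tendsto_nhds.1 ((hf.contGrad l).continuousAt (hU.mem_nhds hp)) η hη0
    filter_upwards [h2] with q hq
    rw [Real.dist_eq] at hq
    exact hq.le
  obtain ⟨r2, hr2, hs2⟩ := exists_hball_subset D hn hev
  set r := min r1 r2 with hr
  have hr0 : 0 < r := lt_min hr1 hr2
  set g : Hpt n → ℝ := fun q => f q - (f p + dlin1 (gradH f p) (hmul (hinv p) q)) with hg
  set A : Hpt n → ℝ := fun q => f p + dlin1 (gradH f p) (hmul (hinv p) q) with hA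
  set X : Hpt n → ℝ := fun q => χ (hdil r⁻¹ (hmul (hinv p) q)) with hX
  have hnX : ∀ q, nm D (hdil r⁻¹ (hmul (hinv p) q)) = r⁻¹ * D.d p q := by
    intro q
    rw [nm_hdil, ← d_eq_nm]
    positivity
  have hAG : ∀ q l, HG A q l (gradH f p l) := fun q l => by
    have := (HG.const (f p) q l).add (HG_left (HG_dlin1 (gradH f p) (hmul (hinv p) q) l))
    simpa using this
  have hXG : ∀ q l, HG X q l (r⁻¹ * fderiv ℝ χ (hdil r⁻¹ (hmul (hinv p) q)) (frameVec (hIdx l) (hdil r⁻¹ (hmul (hinv p) q)))) :=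
    fun q l => HG_left (f := fun q => χ (hdil r⁻¹ q)) (HG_dil (HG_smooth hχs _ l))
  have htr : Continuous fun q : Hpt n => hdil r⁻¹ (hmul (hinv p) q) := by
    have : Continuous fun q : Hpt n => hmul (hinv p) q := Continuous.hmul' continuous_const continuous_id
    unfold hdil
    fun_prop
  have hA' : Continuous A := by
    refine continuous_const.add ?_
    exact continuous_dlin1.comp ((continuous_const (y := gradH f p)).prodMk
      (Continuous.hmul' (continuous_const (y := hinv p)) continuous_id))
  have hX' : Continuous X := hχs.continuous.comp htr
  -- the two regimes
  set dX : Hpt n → Fin (2*n) → ℝ := fun q l => r⁻¹ * fderiv ℝ χ (hdil r⁻¹ (hmul (hinv p) q)) (frameVec (hIdx l) (hdil r⁻¹ (hmul (hinv p) q))) with hdX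
  have hdXc : ∀ l, Continuous fun q => dX q l := fun l =>
    continuous_const.mul ((continuous_smooth_grad hχs l).comp htr)
  have hdo : Continuous fun q => D.d p q := (continuous_d D hn).comp (continuous_const.prodMk continuous_id)
  have hout : ∀ q, r / 2 < D.d p q → (fun q => A q + X q * g q) =ᶠ[𝓝 q] A := by
    intro q hq
    filter_upwards [(isOpen_lt continuous_const hdo).mem_nhds hq] with x hx
    have hx' : r / 2 < D.d p x := hx
    have : X x = 0 := hχ0 _ (by rw [hnX]; field_simp; linarith)
    simp [this]
  have hin : ∀ q, D.d p q < r → q ∈ U ∧ (∀ l, |gradH f q l - gradH f p l| ≤ η) ∧ |g q| ≤ η * r := by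
    intro q hq
    have h1 := hs2 (show q ∈ hball D p r2 from hq.trans_le (min_le_right _ _))
    refine ⟨h1.1, h1.2, ?_⟩
    have h2 := hst p q (by rw [(D.eq_iff p p).2 rfl]; exact hr1) (hq.trans_le (min_le_left _ _))
    have e : g q = f q - f p - dlin1 (gradH f p) (hmul (hinv p) q) := by simp only [hg]; ring
    rw [e]
    exact h2.trans (by gcongr)
  have hing : ∀ q l, D.d p q < r → HG (fun q => A q + X q * g q) q l
      (gradH f p l + (dX q l * g q + X q * (gradH f q l - gradH f p l))) := fun q l hq =>
    (hAG q l).add ((hXG q l).mul ((hf.HG (hin q hq).1 l).sub (hAG q l)))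
  have hoc : ∀ q, q ∈ {q | D.d p q < r} ∨ q ∈ {q | r / 2 < D.d p q} := by
    intro q
    rcases lt_or_ge (D.d p q) r with h | h
    · exact Or.inl h
    · right; show r / 2 < D.d p q; linarith
  have hio : IsOpen {q | D.d p q < r} := isOpen_lt hdo continuous_const
  have hoo : IsOpen {q | r / 2 < D.d p q} := isOpen_lt continuous_const hdo
  have hgc : ContinuousOn g {q | D.d p q < r} := 
    (hf.contOn.mono fun q hq => (hin q hq).1).sub hA'.continuousOn
  have hC1 : IsC1H {q | D.d p q < r} (fun q => A q + X q * g q) := by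
    refine IsC1H.of_HG (hA'.continuousOn.add (hX'.continuousOn.mul hgc)) (fun q hq l => hing q l hq) fun l => ?_
    exact continuousOn_const.add (((hdXc l).continuousOn.mul hgc).add (hX'.continuousOn.mul
      (((hf.contGrad l).mono fun q hq => (hin q hq).1).sub continuousOn_const)))
  refine ⟨fun q => A q + X q * g q, ⟨?_, ?_, ?_⟩, ?_, ?_⟩
  · refine continuousOn_univ.2 (continuous_iff_continuousAt.2 fun q => ?_)
    rcases hoc q with h | h
    · exact hC1.contOn.continuousAt (hio.mem_nhds h)
    · exact hA'.continuousAt.congr (hout q h).symm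
  · intro q _ l
    rcases hoc q with h | h
    · exact hC1.ldiff q h l
    · exact ((hAG q l).congr (hout q h)).ldiff
  · intro l
    refine continuousOn_univ.2 (continuous_iff_continuousAt.2 fun q => ?_)
    rcases hoc q with h | h
    · exact (hC1.contGrad l).continuousAt (hio.mem_nhds h)
    · refine (continuousAt_const (y := gradH f p l)).congr ?_
      filter_upwards [hoo.mem_nhds h] with x hx
      exact ((hAG x l).congr (hout x hx)).grad.symm
  · intro q l
    rcases hoc q with h | h
    · obtain ⟨h1, h2, h3⟩ := hin q h
      rw [(hing q l h).grad, add_sub_cancel_left]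
      refine (abs_add_le _ _).trans ?_
      have b1 : |dX q l| ≤ r⁻¹ * C := by
        simp only [hdX]
        rw [abs_mul, abs_of_pos (inv_pos.2 hr0)]
        gcongr
        exact hCb _ _
      calc |dX q l * g q| + |X q * (gradH f q l - gradH f p l)| = |dX q l| * |g q| +
            |X q| * |gradH f q l - gradH f p l| := by rw [abs_mul (dX q l), abs_mul (X q)]
        _ ≤ (r⁻¹ * C) * (η * r) + 1 * η := by
            gcongr
            exact hχb _
            exact h2 l
        _ = ε := by rw [hη]; field_simp
    · rw [((hAG q l).congr (hout q h)).grad]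
      simp [hε.le]
  · have h1 : Tendsto (fun q : Hpt n => hdil r⁻¹ (hmul (hinv p) q)) (𝓝 p) (𝓝 0) := by
      have := htr.tendsto p
      simpa [hinv_hmul, hdil_zero] using this
    filter_upwards [h1.eventually hχ1] with q hq
    have : X q = 1 := hq
    simp only [this, hg]
    simp [hA]

end Heis
end


open MeasureTheory Topology Filter Set ENNReal
set_option autoImplicit false
noncomputable section
namespace Heis
variable {n : ℕ}

lemma exists_extG (D : HomDist n) (hn : 1 ≤ n) {j : ℕ} {v : (Fin j → ℝ) →ₗ[ℝ] Hpt n} (hv : IsoV v)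
    {U : Set (Hpt n)} (hU : IsOpen U) {f : Fin j → Hpt n → ℝ} (hf : ∀ i, IsC1H U (f i))
    {p : Hpt n} (hp : p ∈ U) {ε : ℝ} (hε : 0 < ε) :
    ∃ F : Hpt n → Fin j → ℝ, (∀ i, IsC1H univ fun q => F q i) ∧
      (∀ q i l, |gradH (fun q => F q i) q l - gradH (f i) p l| ≤ ε) ∧
      ∀ᶠ q in 𝓝 p, ∀ i, F q i = f i q := by
  choose F h1 h2 h3 using fun i => exists_ext D hn hU (hf i) hp hε
  exact ⟨fun q i => F i q, h1, fun q i l => h2 i q l, eventually_all.2 h3⟩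

lemma exists_extGr (D : HomDist n) (hn : 1 ≤ n) {j : ℕ} {v : (Fin j → ℝ) →ₗ[ℝ] Hpt n} (hv : IsoV v)
    {U : Set (Hpt n)} (hU : IsOpen U) {f : Fin j → Hpt n → ℝ} (hf : ∀ i, IsC1H U (f i))
    {p : Hpt n} (hp : p ∈ U) (hL : ∀ a, dlin (fun i => gradH (f i) p) (v a) = a) :
    ∃ F : Hpt n → Fin j → ℝ, Gr D v F (fun q i => gradH (fun q => F q i) q) ∧
      ∀ᶠ q in 𝓝 p, ∀ i, F q i = f i q := by
  obtain ⟨ε, hε, h⟩ := exists_Gr D hn hv hL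
  obtain ⟨F, h1, h2, h3⟩ := exists_extG D hn hv hU hf hp hε
  exact ⟨F, h F h1 h2, h3⟩

lemma ker_le (D : HomDist n) (hn : 1 ≤ n) {j : ℕ} (hj : j ≤ n)
    {U : Set (Hpt n)} (hU : IsOpen U) {h : Fin j → Hpt n → ℝ} (hh : ∀ i, IsC1H U (h i))
    {f : Hpt n → ℝ} (hf : IsC1H U f) {x : Hpt n} (hx : x ∈ U)
    (hli : LinearIndependent ℝ (fun i => gradH (h i) x)) (hx0 : ∀ i, h i x = 0)
    (hsub : ∀ᶠ q in 𝓝 x, (∀ i, h i q = 0) → f q = 0) {w : Hpt n}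
    (hw : dlin (fun i => gradH (h i) x) w = 0) : dlin1 (gradH f x) w = 0 := by
  obtain ⟨v, hv, hL⟩ := exists_isoV hj hli
  obtain ⟨H, hG, hHh⟩ := exists_extGr D hn hv hU hh hx hL
  obtain ⟨Cv, hCv, hCv'⟩ := exists_nm_v_le D hn hv
  obtain ⟨C, hC, hC'⟩ := exists_dlin_le D hn
  have hf0 : f x = 0 := hsub.self_of_nhds hx0
  have hH0 : H x = 0 := funext fun i => (hHh.self_of_nhds i).trans (hx0 i)
  have hgx : (fun i => gradH (fun q => H q i) x) = fun i => gradH (h i) x := by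
    funext i
    refine gradH_congr ?_
    filter_upwards [hHh] with q hq using hq i
  set g := gradH f x with hg
  have hdg : ∀ p : Hpt n, |dlin1 g p| ≤ C * ‖g‖ * nm D p := by
    intro p
    have := hC' 1 (fun _ => g) p
    rw [pi_norm_const] at this
    exact (norm_le_pi_norm (dlin (fun _ : Fin 1 => g) p) 0).trans this
  set K : ℝ := nm D w * (1 + 2 * Cv) + 2 * C * ‖g‖ * Cv * nm D w with hK
  have hnw := nm_nonneg D w
  have key : ∀ η : ℝ, 0 < η → η ≤ 1 → |dlin1 g w| ≤ η * K := by
    intro η hη hη1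
    obtain ⟨r1, hr1, hs1⟩ := hG.strict x η hη
    obtain ⟨r2, hr2, hs2⟩ := hf.strict D hn hU hx hη
    obtain ⟨r3, hr3, hs3⟩ := exists_hball_subset D hn (hsub.and hHh)
    set r := min r1 (min r2 r3)
    have hr : 0 < r := lt_min hr1 (lt_min hr2 hr3)
    obtain ⟨s, hs0, hs⟩ : ∃ s : ℝ, 0 < s ∧ s * (nm D w * (1 + 2 * Cv)) < r := by
      refine ⟨r / (nm D w * (1 + 2 * Cv) + 1), by positivity, ?_⟩
      rw [div_mul_eq_mul_div, div_lt_iff₀ (by positivity)]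
      nlinarith
    set q := hmul x (hdil s w) with hq
    have hdq : D.d x q = s * nm D w := by rw [hq, d_hmul_right, nm_hdil D hs0]
    have hqr : D.d x q < r := by
      rw [hdq]
      refine lt_of_le_of_lt ?_ hs
      have : 0 ≤ s * nm D w * (2 * Cv) := by positivity
      nlinarith
    have hHq : ‖H q‖ ≤ η * (s * nm D w) := by
      have := hs1 x q (by rw [d_self]; exact hr1) (hqr.trans_le (min_le_left _ _))
      rw [hgx, hH0, hdq, hq, hinv_hmul_cancel, dlin_hdil, hw] at this
      simpa using this
    set y := PF v H q with hy
    have hsF : nm D (v (sF v H q)) ≤ Cv * (2 * (η * (s * nm D w))) :=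
      (hCv' _).trans (by gcongr; exact (hG.fib.norm_sF q).trans (by gcongr))
    have hdy : D.d x y ≤ s * (nm D w * (1 + 2 * Cv)) := by
      have t := D.triangle x q y
      rw [hdq, hy, PF, d_hmul_right] at t
      have : η * (s * nm D w) ≤ 1 * (s * nm D w) := by gcongr
      refine t.trans ?_
      nlinarith
    have hyr : D.d x y < r := lt_of_le_of_lt hdy hs
    have hy3 := hs3 (show y ∈ hball D x r3 from hyr.trans_le ((min_le_right _ _).trans (min_le_right _ _)))
    have hfy : f y = 0 := hy3.1 fun i => by
      rw [← hy3.2 i, hy, hG.fib.F_PF]; rfl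
    have h4 := hs2 x y (by rw [d_self]; exact hr2) (hyr.trans_le ((min_le_right _ _).trans (min_le_left _ _)))
    have e : hmul (hinv x) y = hmul (hdil s w) (v (sF v H q)) := by
      rw [hy, PF, hq, hmul_assoc', hinv_hmul_cancel]
    rw [hfy, hf0, e, dlin1_hmul, dlin1_hdil] at h4
    have h5 := hdg (v (sF v H q))
    have h6 : s * |dlin1 g w| ≤ s * (η * K) := by
      have a1 : s * |dlin1 g w| = |s * dlin1 g w| := by rw [abs_mul, abs_of_pos hs0]
      have a2 : |s * dlin1 g w| ≤ |0 - 0 - (s * dlin1 g w + dlin1 g (v (sF v H q)))| + |dlin1 g (v (sF v H q))| := by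
        have := abs_add_le (s * dlin1 g w + dlin1 g (v (sF v H q))) (-dlin1 g (v (sF v H q)))
        rw [abs_neg] at this
        rw [sub_zero, zero_sub, abs_neg]
        simpa using this
      rw [a1]
      refine a2.trans ?_
      calc _ ≤ η * (s * (nm D w * (1 + 2 * Cv))) + C * ‖g‖ * (Cv * (2 * (η * (s * nm D w)))) := by
            refine add_le_add (h4.trans (by gcongr)) (h5.trans (by gcongr))
        _ = s * (η * K) := by rw [hK]; ring
    exact le_of_mul_le_mul_left h6 hs0
  by_contra hne
  have hpos : 0 < |dlin1 g w| := abs_pos.2 hne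
  have hK0 : 0 ≤ K := by positivity
  have := key (min 1 (|dlin1 g w| / (2 * (K + 1)))) (by positivity) (min_le_left _ _)
  have h2 : min 1 (|dlin1 g w| / (2 * (K + 1))) * K ≤ |dlin1 g w| / (2 * (K + 1)) * K := by
    gcongr; exact min_le_right _ _
  have h3 : |dlin1 g w| / (2 * (K + 1)) * K ≤ |dlin1 g w| / 2 := by
    rw [div_mul_eq_mul_div, div_le_div_iff₀ (by positivity) (by positivity)]
    nlinarith
  linarith

lemma zero_sub_rev (D : HomDist n) (hn : 1 ≤ n) {j : ℕ} (hj : j ≤ n)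
    {U : Set (Hpt n)} (hU : IsOpen U) {h f : Fin j → Hpt n → ℝ} (hh : ∀ i, IsC1H U (h i))
    (hf : ∀ i, IsC1H U (f i)) {x : Hpt n} (hx : x ∈ U)
    (hli : LinearIndependent ℝ (fun i => gradH (h i) x))
    (hlif : LinearIndependent ℝ (fun i => gradH (f i) x)) (hx0 : ∀ i, h i x = 0)
    (hsub : ∀ᶠ q in 𝓝 x, (∀ i, h i q = 0) → ∀ i, f i q = 0) :
    ∀ᶠ q in 𝓝 x, (∀ i, f i q = 0) → ∀ i, h i q = 0 := by
  obtain ⟨v, hv, hL⟩ := exists_isoV hj hlif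
  set B : (Fin j → ℝ) →ₗ[ℝ] (Fin j → ℝ) := (dlinL (fun i => gradH (h i) x)).comp v with hB
  have hinj : Function.Injective B := by
    rw [← LinearMap.ker_eq_bot, LinearMap.ker_eq_bot']
    intro a ha
    have : dlin (fun i => gradH (f i) x) (v a) = 0 := funext fun i =>
      ker_le D hn hj hU hh (hf i) hx hli hx0 (hsub.mono fun q hq h0 => hq h0 i) ha
    rwa [hL] at this
  set E := LinearEquiv.ofInjectiveEndo B hinj with hE
  set A : Matrix (Fin j) (Fin j) ℝ := LinearMap.toMatrix' (E.symm : (Fin j → ℝ) →ₗ[ℝ] (Fin j → ℝ)) with hA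
  have hAB : ∀ a, A.mulVec (B a) = a := by
    intro a
    rw [hA, LinearMap.toMatrix'_mulVec]
    exact E.symm_apply_apply a
  set h' : Fin j → Hpt n → ℝ := fun i q => ∑ l, A i l * h l q with hh'
  have hHG : ∀ q ∈ U, ∀ i l, HG (h' i) q l (∑ m, A i m * gradH (h m) q l) := fun q hq i l =>
    HG.sum _ fun m _ => ((hh m).HG hq l).const_mul _
  have hC1 : ∀ i, IsC1H U (h' i) := fun i => by
    refine IsC1H.of_HG ?_ (fun q hq l => hHG q hq i l) fun l => ?_
    · exact continuousOn_finsetSum _ fun m _ => continuousOn_const.mul (hh m).contOn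
    · exact continuousOn_finsetSum _ fun m _ => continuousOn_const.mul ((hh m).contGrad l)
  have hL' : ∀ a, dlin (fun i => gradH (h' i) x) (v a) = a := by
    intro a
    have e : A.mulVec (B a) = dlin (fun i => gradH (h' i) x) (v a) := by
      funext i
      have e1 : gradH (h' i) x = fun l => ∑ m, A i m * gradH (h m) x l := funext fun l => (hHG x hx i l).grad
      show ∑ m, A i m * dlin1 (gradH (h m) x) (v a) = dlin1 (gradH (h' i) x) (v a)
      rw [e1]
      simp only [dlin1, Finset.mul_sum, ← Finset.sum_add_distrib]
      rw [Finset.sum_comm]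
      refine Finset.sum_congr rfl fun l _ => Finset.sum_congr rfl fun m _ => ?_
      ring
    rw [← e, hAB]
  obtain ⟨H, hG, hHh⟩ := exists_extGr D hn hv hU hC1 hx hL'
  obtain ⟨F, hGF, hFf⟩ := exists_extGr D hn hv hU hf hx hL
  have hz : ∀ q, (∀ i, h' i q = 0) → ∀ i, h i q = 0 := by
    intro q hq
    have h1 : A.mulVec (fun l => h l q) = 0 := funext hq
    rw [hA, LinearMap.toMatrix'_mulVec] at h1
    have h2 : (fun l => h l q) = 0 := E.symm.injective (by simpa using h1)
    exact congrFun h2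
  have hH0 : H x = 0 := by
    funext i
    rw [hHh.self_of_nhds i]
    simp [hh', hx0]
  have hPx : PF v H x = x := hG.fib.PF_eq_self hH0
  have ht : Tendsto (PF v H) (𝓝 x) (𝓝 x) := by
    have := hG.fib.continuous_PF.tendsto x
    rwa [hPx] at this
  filter_upwards [hFf, hHh, ht.eventually ((hsub.and hHh).and hFf)] with q hq1 hq2 hq3 hq0
  obtain ⟨⟨h1, h2⟩, h3⟩ := hq3
  have hy : ∀ i, h i (PF v H q) = 0 := hz _ fun i => by
    rw [← h2 i, hG.fib.F_PF]; rfl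
  have hFy : F (PF v H q) = 0 := funext fun i => (h3 i).trans (h1 hy i)
  have hFq : F q = 0 := funext fun i => (hq1 i).trans (hq0 i)
  have e : PF v H q = q := by
    have e1 := hGF.fib.PF_eq_self hFy
    rw [hGF.fib.PG_PF, hGF.fib.PF_eq_self hFq] at e1
    exact e1.symm
  rwa [e] at hy

lemma exists_conn {j : ℕ} {v : (Fin j → ℝ) →ₗ[ℝ] Hpt n} {F : Hpt n → Fin j → ℝ} (hF : Fib v F)
    {L : Hco n j} (hL : ∀ a, dlin L (v a) = a) (p : Hpt n) {N : Set (Hpt n)} (hN : N ∈ 𝓝 p) :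
    ∃ U : Set (Hpt n), IsOpen U ∧ p ∈ U ∧ U ⊆ N ∧
      ∀ A : Set (Fin j → ℝ), Convex ℝ A → IsPreconnected {q ∈ U | F q ∈ A} := by
  have hLc : Continuous (dlin L) := continuous_dlin.comp (continuous_const.prodMk continuous_id)
  set Ψ : Hpt n → Hpt n := fun q => hmul q (v (F q - dlin L q)) with hΨ
  set Φ : Hpt n → Hpt n := fun q => hmul q (v (sol v F q (dlin L q))) with hΦ
  have hΨc : Continuous Ψ := Continuous.hmul' continuous_id ((continuous_v v).comp (hF.cont.sub hLc))
  have hΦc : Continuous Φ := Continuous.hmul' continuous_id ((continuous_v v).comp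
    (hF.continuous_sol.comp (continuous_id.prodMk hLc)))
  have hFΦ : ∀ q, F (Φ q) = dlin L q := fun q => hF.sol_spec q _
  have hLΨ : ∀ q, dlin L (Ψ q) = F q := fun q => by
    simp only [hΨ, dlin_hmul, hL]; abel
  have hΨΦ : ∀ q, Ψ (Φ q) = q := fun q => by
    have : F (Φ q) - dlin L (Φ q) = - sol v F q (dlin L q) := by
      rw [hFΦ]; simp only [hΦ, dlin_hmul, hL]; abel
    simp only [hΨ] at this ⊢
    rw [this]
    exact hF.iso.cancel q _
  have hΦΨ : ∀ q, Φ (Ψ q) = q := fun q => by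
    have h1 : sol v F (Ψ q) (dlin L (Ψ q)) = -(F q - dlin L q) := by
      symm
      apply hF.sol_unique
      rw [hLΨ]
      simp only [hΨ]
      rw [hF.iso.cancel]
    simp only [hΦ] at h1 ⊢
    rw [h1]
    exact hF.iso.cancel q _
  have h1 : Φ ⁻¹' N ∈ 𝓝 (Ψ p) := hΦc.continuousAt.preimage_mem_nhds (by rwa [hΦΨ])
  obtain ⟨r, hr, hrN⟩ := Metric.mem_nhds_iff.1 h1
  refine ⟨Ψ ⁻¹' (Metric.ball (Ψ p) r), Metric.isOpen_ball.preimage hΨc, Metric.mem_ball_self hr,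
    fun q hq => ?_, fun A hA => ?_⟩
  · have := hrN hq
    rwa [mem_preimage, hΦΨ] at this
  · have e : {q ∈ Ψ ⁻¹' (Metric.ball (Ψ p) r) | F q ∈ A} =
        Φ '' (Metric.ball (Ψ p) r ∩ (dlinL L) ⁻¹' A) := by
      ext q
      constructor
      · rintro ⟨h1, h2⟩
        refine ⟨Ψ q, ⟨h1, ?_⟩, hΦΨ q⟩
        show dlin L (Ψ q) ∈ A
        rwa [hLΨ]
      · rintro ⟨q', ⟨h1, h2⟩, rfl⟩
        refine ⟨?_, ?_⟩
        · rw [mem_preimage, hΨΦ]; exact h1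
        · rw [hFΦ]; exact h2
    rw [e]
    refine IsPreconnected.image ?_ _ hΦc.continuousOn
    exact ((convex_ball _ _).inter (hA.linear_preimage _)).isPreconnected

end Heis
end


open MeasureTheory Topology Filter Set ENNReal
set_option autoImplicit false
noncomputable section
namespace Heis
variable {n : ℕ}

lemma snoc_grad {k : ℕ} (f0 : Fin k → Hpt n → ℝ) (g : Hpt n → ℝ) (p : Hpt n) :
    (fun i => gradH (Fin.snoc (α := fun _ => Hpt n → ℝ) f0 g i) p) =
      Fin.snoc (α := fun _ => Fin (2*n) → ℝ) (fun i => gradH (f0 i) p) (gradH g p) := by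
  funext i
  refine Fin.lastCases ?_ (fun i => ?_) i <;> simp

lemma gradH_const_mul (c : ℝ) {f : Hpt n → ℝ} {U : Set (Hpt n)} (hf : IsC1H U f) {q : Hpt n} (hq : q ∈ U) :
    gradH (fun q => c * f q) q = c • gradH f q :=
  funext fun l => ((hf.HG hq l).const_mul c).grad

lemma IsC1H.const_mul (c : ℝ) {f : Hpt n → ℝ} {U : Set (Hpt n)} (hf : IsC1H U f) :
    IsC1H U (fun q => c * f q) :=
  IsC1H.of_HG (continuousOn_const.mul hf.contOn) (fun _ hq l => (hf.HG hq l).const_mul c)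
    fun l => continuousOn_const.mul (hf.contGrad l)

theorem exists_germ (D : HomDist n) (hn : 1 ≤ n) {k : ℕ} (hk : k + 1 ≤ n) {O S : Set (Hpt n)}
    (hO : IsOpen O) (hS : IsC1HSubWithBdry D k O S) {p : Hpt n} (hp : p ∈ O ∩ bdry S) :
    ∃ (W : Set (Hpt n)) (f : Fin (k+1) → Hpt n → ℝ), IsOpen W ∧ p ∈ W ∧ W ⊆ O ∧
      (∀ i, IsC1H W (f i)) ∧ LinearIndependent ℝ (fun i => gradH (f i) p) ∧ (∀ i, f i p = 0) ∧
      S ∩ W = {q ∈ W | (∀ i : Fin k, f i.castSucc q = 0) ∧ 0 < f (Fin.last k) q} ∧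
      bdry S ∩ W = {q ∈ W | ∀ i, f i q = 0} := by
  obtain ⟨-, hSc, -, hBc, hS3⟩ := hS
  rw [IsC1HSub, if_pos (by omega)] at hSc
  rw [IsC1HSub, if_pos hk] at hBc
  obtain ⟨U3, hU3, hpU3, S', hS'U, hS'c, hcl, hacc⟩ := hS3 p hp
  rw [IsC1HSub, if_pos (by omega)] at hS'c
  have hpcl : p ∈ closure S := hp.2.1
  obtain ⟨U1, hU1, hpU1, f0, hf0, hf0li, hf0z⟩ := hS'c p (hcl ⟨hpU3, hpcl⟩)
  obtain ⟨U2, hU2, hpU2, g, hg, hgli, hgz⟩ := hBc p hp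
  set W0 := ((U1 ∩ U2) ∩ U3) ∩ O with hW0
  have hW0o : IsOpen W0 := ((hU1.inter hU2).inter hU3).inter hO
  have hpW0 : p ∈ W0 := ⟨⟨⟨hpU1, hpU2⟩, hpU3⟩, hp.1⟩
  have hclf : ∀ q ∈ W0, q ∈ closure S → ∀ i, f0 i q = 0 := by
    intro q hq hqS
    have : q ∈ S' ∩ U1 := ⟨hcl ⟨hq.1.2, hqS⟩, hq.1.1.1⟩
    rw [hf0z] at this
    exact this.2
  have hbg : ∀ q ∈ W0, (q ∈ bdry S ↔ ∀ i, g i q = 0) := by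
    intro q hq
    have : q ∈ (O ∩ bdry S) ∩ U2 ↔ q ∈ {q ∈ U2 | ∀ i, g i q = 0} := by rw [hgz]
    constructor
    · intro h; exact (this.1 ⟨⟨hq.2, h⟩, hq.1.1.2⟩).2
    · intro h; exact (this.2 ⟨hq.1.1.2, h⟩).1.2
  -- choose the last function
  obtain ⟨i0, hi0⟩ : ∃ i0, gradH (g i0) p ∉ Submodule.span ℝ (range fun i => gradH (f0 i) p) := by
    by_contra! hcon
    have h1 : Submodule.span ℝ (range fun i => gradH (g i) p) ≤ Submodule.span ℝ (range fun i => gradH (f0 i) p) := by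
      rw [Submodule.span_le]
      rintro _ ⟨i, rfl⟩
      exact hcon i
    have h2 := Submodule.finrank_mono h1
    rw [finrank_span_eq_card (hgli p hpU2)] at h2
    have h3 : Module.finrank ℝ (Submodule.span ℝ (range fun i => gradH (f0 i) p)) ≤ Fintype.card (Fin k) :=
      finrank_range_le_card _
    simp at h2 h3
    omega
  have hf0W : ∀ i, IsC1H W0 (f0 i) := fun i => (hf0 i).mono fun q hq => hq.1.1.1
  have hgW : ∀ i, IsC1H W0 (g i) := fun i => (hg i).mono fun q hq => hq.1.1.2
  have hli : ∀ σ : ℝ, σ ≠ 0 → LinearIndependent ℝ (fun i => gradH (Fin.snoc (α := fun _ => Hpt n → ℝ) f0 (fun q => σ * g i0 q) i) p) := by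
    intro σ hσ
    rw [snoc_grad, gradH_const_mul σ (hgW i0) hpW0]
    refine linearIndependent_fin_snoc.2 ⟨hf0li p hpU1, fun h => hi0 ?_⟩
    exact (Submodule.smul_mem_iff _ hσ).1 h
  have hC1 : ∀ σ : ℝ, ∀ i, IsC1H W0 (Fin.snoc (α := fun _ => Hpt n → ℝ) f0 (fun q => σ * g i0 q) i) := by
    intro σ i
    refine Fin.lastCases ?_ (fun i => ?_) i
    · rw [Fin.snoc_last]; exact (hgW i0).const_mul σ
    · rw [Fin.snoc_castSucc]; exact hf0W i
  set f := Fin.snoc (α := fun _ => Hpt n → ℝ) f0 (fun q => (1:ℝ) * g i0 q) with hf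
  have hfz : ∀ q, (∀ i, f i q = 0) ↔ (∀ i, f0 i q = 0) ∧ g i0 q = 0 := by
    intro q
    rw [Fin.forall_fin_succ']
    simp [hf]
  have hg0 : ∀ i, g i p = 0 := (hbg p hpW0).1 hp.2
  have hrev : ∀ᶠ q in 𝓝 p, (∀ i, f i q = 0) → ∀ i, g i q = 0 := by
    refine zero_sub_rev D hn hk hW0o hgW (hC1 1) hpW0 (hgli p hpU2) (hli 1 one_ne_zero) hg0 ?_
    filter_upwards [hW0o.mem_nhds hpW0] with q hq hq0
    exact (hfz q).2 ⟨hclf q hq ((hbg q hq).2 hq0).1, hq0 i0⟩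
  obtain ⟨v, hv, hL⟩ := exists_isoV hk (hli 1 one_ne_zero)
  obtain ⟨F, hGF, hFf⟩ := exists_extGr D hn hv hW0o (hC1 1) hpW0 hL
  obtain ⟨U, hUo, hpU, hUN, hconn⟩ := exists_conn hGF.fib hL p
    (((hW0o.eventually_mem hpW0).and hrev).and hFf)
  have hb : ∀ q ∈ U, (q ∈ bdry S ↔ (∀ i, f0 i q = 0) ∧ g i0 q = 0) := by
    intro q hq
    obtain ⟨⟨h1, h2⟩, h3⟩ := hUN hq
    rw [hbg q h1]
    constructor
    · intro h; exact ⟨hclf q h1 ((hbg q h1).2 h).1, h i0⟩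
    · intro h; exact h2 ((hfz q).2 h)
  have hopen : ∀ q ∈ U, q ∈ S → ∀ᶠ q' in 𝓝 q, (∀ i, f0 i q' = 0) → q' ∈ S := by
    intro q hq hqS
    have hq0 := (hUN hq).1.1
    obtain ⟨V, hV, hqV, φ, hφ, hφli, hφz⟩ := hSc q ⟨hq0.2, hqS⟩
    have hφS : ∀ x ∈ V, (∀ i, φ i x = 0) → x ∈ S := by
      intro x hx h0
      have : x ∈ (O ∩ S) ∩ V := by rw [hφz]; exact ⟨hx, h0⟩
      exact this.1.2
    have hφq : ∀ i, φ i q = 0 := by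
      have : q ∈ (O ∩ S) ∩ V := ⟨⟨hq0.2, hqS⟩, hqV⟩
      rw [hφz] at this
      exact this.2
    have := zero_sub_rev D hn (show k ≤ n by omega) (hV.inter hW0o) (fun i => (hφ i).mono inter_subset_left)
      (fun i => (hf0W i).mono inter_subset_right) ⟨hqV, hq0⟩ (hφli q hqV) (hf0li q hq0.1.1.1) hφq (by
        filter_upwards [hV.mem_nhds hqV, hW0o.mem_nhds hq0] with x hx hx0 hxφ
        exact hclf x hx0 (subset_closure (hφS x hx hxφ)))
    filter_upwards [this, hV.mem_nhds hqV] with x hx hxV hx0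
    exact hφS x hxV (hx hx0)
  -- the two sides
  have hside : ∀ σ : ℝ, σ = 1 ∨ σ = -1 →
      (∀ q ∈ U, (∀ i, f0 i q = 0) → 0 < σ * g i0 q → q ∈ S) ∨
      (∀ q ∈ U, (∀ i, f0 i q = 0) → 0 < σ * g i0 q → q ∉ S) := by
    intro σ hσ
    set A : Set (Fin (k+1) → ℝ) := {a | (∀ i : Fin k, a i.castSucc = 0) ∧ 0 < σ * a (Fin.last k)} with hA
    have hAc : Convex ℝ A := by
      intro a ha b hb s t hs ht hst
      refine ⟨fun i => by simp [ha.1 i, hb.1 i], ?_⟩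
      have e : σ * (s • a + t • b) (Fin.last k) = s * (σ * a (Fin.last k)) + t * (σ * b (Fin.last k)) := by
        simp; ring
      rw [e]
      rcases hs.eq_or_lt with h | h
      · have : t = 1 := by linarith
        rw [← h, this]; simpa using hb.2
      · have := mul_pos h ha.2
        have := mul_nonneg ht hb.2.le
        linarith
    have hmem : ∀ q, q ∈ {q ∈ U | F q ∈ A} ↔ q ∈ U ∧ (∀ i, f0 i q = 0) ∧ 0 < σ * g i0 q := by
      intro q
      refine and_congr_right fun hq => ?_
      have hF := (hUN hq).2
      show ((∀ i : Fin k, F q i.castSucc = 0) ∧ 0 < σ * F q (Fin.last k)) ↔ _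
      simp only [hF]
      simp [hf]
    have hpc := isPreconnected_iff_subset_of_disjoint.1 (hconn A hAc)
      {q | ∀ᶠ q' in 𝓝 q, (∀ i, f0 i q' = 0) → q' ∈ S} (closure S)ᶜ isOpen_setOf_eventually_nhds
      isClosed_closure.isOpen_compl ?_ ?_
    · rcases hpc with h | h
      · left
        intro q hq h1 h2
        exact (h ((hmem q).2 ⟨hq, h1, h2⟩)).self_of_nhds h1
      · right
        intro q hq h1 h2 h3
        exact h ((hmem q).2 ⟨hq, h1, h2⟩) (subset_closure h3)
    · intro q hq
      obtain ⟨h1, h2, h3⟩ := (hmem q).1 hq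
      by_cases h : q ∈ closure S
      · left
        refine hopen q h1 (by_contra fun hqS => ?_)
        have := ((hb q h1).1 ⟨h, hqS⟩).2
        rw [this] at h3; simp at h3
      · exact Or.inr h
    · rw [eq_empty_iff_forall_notMem]
      rintro q ⟨hq, h1, h2⟩
      exact h2 (subset_closure (h1.self_of_nhds ((hmem q).1 hq).2.1))
  have hSU : ∀ q ∈ U, q ∈ S → (∀ i, f0 i q = 0) ∧ g i0 q ≠ 0 := by
    intro q hq hqS
    have h1 := hclf q (hUN hq).1.1 (subset_closure hqS)
    exact ⟨h1, fun h => ((hb q hq).2 ⟨h1, h⟩).2 hqS⟩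
  obtain ⟨σ, hσ0, hσ⟩ : ∃ σ : ℝ, σ ≠ 0 ∧ ∀ q ∈ U, (q ∈ S ↔ (∀ i, f0 i q = 0) ∧ 0 < σ * g i0 q) := by
    rcases hside 1 (Or.inl rfl) with h1 | h1 <;> rcases hside (-1) (Or.inr rfl) with h2 | h2
    · exfalso
      obtain ⟨r, hr, hrU⟩ := exists_hball_subset D hn (hUo.mem_nhds hpU)
      obtain ⟨q, hq1, hq2, hq3⟩ := hacc r hr
      have hqU := hrU hq1
      have h3 : ∀ i, f0 i q = 0 := by
        have : q ∈ S' ∩ U1 := ⟨hq2, (hUN hqU).1.1.1.1.1⟩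
        rw [hf0z] at this
        exact this.2
      rcases lt_trichotomy (g i0 q) 0 with h | h | h
      · exact hq3 (subset_closure (h2 q hqU h3 (by linarith)))
      · exact hq3 ((hb q hqU).2 ⟨h3, h⟩).1
      · exact hq3 (subset_closure (h1 q hqU h3 (by linarith)))
    · refine ⟨1, one_ne_zero, fun q hq => ⟨fun hqS => ?_, fun h => h1 q hq h.1 h.2⟩⟩
      obtain ⟨h3, h4⟩ := hSU q hq hqS
      refine ⟨h3, ?_⟩
      rcases lt_or_gt_of_ne h4 with h | h
      · exact absurd hqS (h2 q hq h3 (by linarith))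
      · linarith
    · refine ⟨-1, by norm_num, fun q hq => ⟨fun hqS => ?_, fun h => h2 q hq h.1 h.2⟩⟩
      obtain ⟨h3, h4⟩ := hSU q hq hqS
      refine ⟨h3, ?_⟩
      rcases lt_or_gt_of_ne h4 with h | h
      · linarith
      · exact absurd hqS (h1 q hq h3 (by linarith))
    · exfalso
      obtain ⟨q, hqU, hqS⟩ := mem_closure_iff.1 hpcl U hUo hpU
      obtain ⟨h3, h4⟩ := hSU q hqU hqS
      rcases lt_or_gt_of_ne h4 with h | h
      · exact h2 q hqU h3 (by linarith) hqS
      · exact h1 q hqU h3 (by linarith) hqS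
  refine ⟨U, Fin.snoc (α := fun _ => Hpt n → ℝ) f0 (fun q => σ * g i0 q), hUo, hpU,
    fun q hq => (hUN hq).1.1.2, fun i => (hC1 σ i).mono fun q hq => (hUN hq).1.1, hli σ hσ0, ?_, ?_, ?_⟩
  · rw [Fin.forall_fin_succ']
    have := (hb p hpU).1 hp.2
    simp [this.1, this.2]
  · ext q
    simp only [Fin.snoc_castSucc, Fin.snoc_last, mem_inter_iff]
    constructor
    · rintro ⟨h1, h2⟩; exact ⟨h2, (hσ q h2).1 h1⟩
    · rintro ⟨h1, h2⟩; exact ⟨(hσ q h1).2 h2, h1⟩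
  · ext q
    have e : (∀ i, Fin.snoc (α := fun _ => Hpt n → ℝ) f0 (fun q => σ * g i0 q) i q = 0) ↔
        (∀ i, f0 i q = 0) ∧ g i0 q = 0 := by
      rw [Fin.forall_fin_succ']
      simp [hσ0]
    constructor
    · rintro ⟨h1, h2⟩; exact ⟨h2, e.2 ((hb q h2).1 h1)⟩
    · rintro ⟨h1, h2⟩; exact ⟨(hb q h1).2 (e.1 h2), h1⟩

end Heis
end


open MeasureTheory Topology Filter Set ENNReal
set_option autoImplicit false
noncomputable section
namespace Heis
variable {n : ℕ}

/-! ## Mollification -/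

def Mo (ρ G : Hpt n → ℝ) (q : Hpt n) : ℝ := ∫ y, ρ y * G (hmul y q)

lemma contDiff_hmul : ContDiff ℝ (⊤ : ℕ∞) fun x : Hpt n × Hpt n => hmul x.1 x.2 := by
  unfold hmul
  fun_prop

lemma contDiff_hinv : ContDiff ℝ (⊤ : ℕ∞) (hinv : Hpt n → Hpt n) := by
  unfold hinv
  fun_prop

lemma Mo_eq (ρ G : Hpt n → ℝ) (q : Hpt n) :
    Mo ρ G q = ∫ z, G z * ρ (hmul z (hinv q)) := by
  let e : Hpt n ≃ₜ Hpt n := Homeomorph.mk ⟨fun z => hmul z q, fun z => hmul z (hinv q),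
      fun z => by simp [hmul_assoc'], fun z => by simp [hmul_assoc']⟩
      (Continuous.hmul' continuous_id continuous_const)
      (Continuous.hmul' continuous_id continuous_const)
  have h := (mp_right (n := n) q).integral_comp e.measurableEmbedding
    (fun z => G z * ρ (hmul z (hinv q)))
  have h' : (∫ x, G (hmul x q) * ρ (hmul (hmul x q) (hinv q)))
      = ∫ z, G z * ρ (hmul z (hinv q)) := h
  rw [← h', Mo]
  refine integral_congr_ae (Eventually.of_forall fun y => ?_)
  simp [hmul_assoc', mul_comm]

lemma Mo_smooth {ρ G : Hpt n → ℝ} (hρ : ContDiff ℝ (⊤ : ℕ∞) ρ) (hc : HasCompactSupport ρ)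
    (hG : Continuous G) : ContDiff ℝ (⊤ : ℕ∞) (Mo ρ G) := by
  rw [contDiff_iff_contDiffAt]
  intro q0
  let g : Hpt n → Hpt n → ℝ := fun q s => ρ (hmul (-s) (hinv q))
  let k : Set (Hpt n) := (fun x : Hpt n × Hpt n => -(hmul x.1 x.2)) ''
    (tsupport ρ ×ˢ Metric.closedBall q0 1)
  have hk : IsCompact k := by
    refine (IsCompact.prod hc (isCompact_closedBall q0 1)).image ?_
    exact contDiff_hmul.continuous.neg
  have h := contDiffOn_convolution_right_with_param (μ := (volume : Measure (Hpt n))) (f := G)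
    (n := ⊤) (ContinuousLinearMap.mul ℝ ℝ) (g := g) (s := Metric.ball q0 1) (k := k)
    Metric.isOpen_ball hk ?_ hG.locallyIntegrable ?_
  · have e : ∀ q, Mo ρ G q = (fun x : Hpt n × Hpt n =>
        (convolution G (g x.1) (ContinuousLinearMap.mul ℝ ℝ) volume) x.2) (q, 0) := by
      intro q
      rw [Mo_eq]
      simp [convolution, g]
    have h2 : ContDiffOn ℝ (⊤ : ℕ∞) (Mo ρ G) (Metric.ball q0 1) := by
      have h3 : ContDiffOn ℝ (⊤ : ℕ∞) (fun q : Hpt n => (q, (0 : Hpt n))) (Metric.ball q0 1) := by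
        fun_prop
      have := h.comp h3 (fun q hq => ⟨hq, mem_univ _⟩)
      exact this.congr fun q _ => e q
    exact h2.contDiffAt (Metric.ball_mem_nhds q0 one_pos)
  · intro q x hq hx
    by_contra hne
    refine hx ⟨(hmul (-x) (hinv q), q), ⟨subset_tsupport _ hne, Metric.ball_subset_closedBall hq⟩, ?_⟩
    simp [hmul_assoc']
  · have : ContDiff ℝ (⊤ : ℕ∞) (fun x : Hpt n × Hpt n => ρ (hmul (-x.2) (hinv x.1))) := by
      refine hρ.comp (contDiff_hmul.comp (ContDiff.prodMk ?_ ?_))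
      · fun_prop
      · exact contDiff_hinv.comp contDiff_fst
    exact this.contDiffOn

lemma Mo_integrable {ρ G : Hpt n → ℝ} (hρ : Continuous ρ) (hc : HasCompactSupport ρ)
    (hG : Continuous G) (q : Hpt n) : Integrable fun y => ρ y * G (hmul y q) := by
  refine Continuous.integrable_of_hasCompactSupport ?_ ?_
  · exact hρ.mul (hG.comp (Continuous.hmul' continuous_id continuous_const))
  · exact hc.mul_right

lemma Mo_HG {ρ G : Hpt n → ℝ} (hρ : Continuous ρ) (hc : HasCompactSupport ρ)
    (hG : IsC1H univ G) {B : ℝ} (l : Fin (2*n)) (hB : ∀ q, |gradH G q l| ≤ B) (q : Hpt n) :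
    HG (Mo ρ G) q l (Mo ρ (fun q => gradH G q l) q) := by
  have hGc : Continuous G := continuousOn_univ.1 hG.contOn
  have hgc : Continuous fun q => gradH G q l := continuousOn_univ.1 (hG.contGrad l)
  have key := hasDerivAt_integral_of_dominated_loc_of_deriv_le (μ := (volume : Measure (Hpt n)))
    (F := fun (s : ℝ) y => ρ y * G (hmul y (hmul q (s • bH l)))) (x₀ := 0) (s := univ)
    (F' := fun (s : ℝ) y => ρ y * gradH G (hmul y (hmul q (s • bH l))) l)
    (bound := fun y => |ρ y| * B) univ_mem
    (Eventually.of_forall fun s => (Mo_integrable hρ hc hGc _).aestronglyMeasurable)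
    (Mo_integrable hρ hc hGc _) (Mo_integrable hρ hc hgc _).aestronglyMeasurable
    (Eventually.of_forall fun y s _ => ?_)
    ((hρ.integrable_of_hasCompactSupport hc).abs.mul_const B)
    (Eventually.of_forall fun y s _ => ?_)
  · have := key.2
    simp only [seg_zero] at this
    exact this
  · rw [Real.norm_eq_abs, abs_mul]
    exact mul_le_mul_of_nonneg_left (hB _) (abs_nonneg _)
  · have := hasDerivAt_seg (f := G) (q := hmul y q) (l := l) (s := s) (hG.ldiff _ (mem_univ _) l)
    simp only [hmul_assoc'] at this
    exact this.const_mul (ρ y)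

lemma Mo_sub_le {ρ G : Hpt n → ℝ} (hρ : Continuous ρ) (hc : HasCompactSupport ρ)
    (h0 : ∀ y, 0 ≤ ρ y) (h1 : ∫ y, ρ y = 1)
    (hG : Continuous G) {q : Hpt n} {c ε : ℝ} (hb : ∀ y, ρ y ≠ 0 → |G (hmul y q) - c| ≤ ε) :
    |Mo ρ G q - c| ≤ ε := by
  have hI := hρ.integrable_of_hasCompactSupport hc (μ := (volume : Measure (Hpt n)))
  have e : Mo ρ G q - c = ∫ y, ρ y * (G (hmul y q) - c) := by
    have : c = ∫ y, ρ y * c := by rw [integral_mul_const, h1, one_mul]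
    conv_lhs => rw [this]
    rw [Mo, ← integral_sub (Mo_integrable hρ hc hG q) (hI.mul_const c)]
    simp only [mul_sub]
  rw [e, ← Real.norm_eq_abs]
  have : ∫ y, ρ y * ε = ε := by rw [integral_mul_const, h1, one_mul]
  rw [← this]
  refine norm_integral_le_of_norm_le (hI.mul_const ε) (Eventually.of_forall fun y => ?_)
  rw [Real.norm_eq_abs, abs_mul, abs_of_nonneg (h0 y)]
  by_cases hy : ρ y = 0
  · simp [hy]
  · exact mul_le_mul_of_nonneg_left (hb y hy) (h0 y)

lemma exists_moll {j : ℕ} {F : Hpt n → Fin j → ℝ} (hF : ∀ i, IsC1H univ fun q => F q i)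
    {L : Hco n j} {ε : ℝ} (hL : ∀ q i l, |gradH (fun q => F q i) q l - L i l| ≤ ε)
    {p : Hpt n} (hp : F p = 0) :
    ∃ Fh : ℕ → Hpt n → Fin j → ℝ, (∀ h i, ContDiff ℝ (⊤ : ℕ∞) fun q => Fh h q i) ∧
      (∀ h q i l, |gradH (fun q => Fh h q i) q l - L i l| ≤ ε) ∧ (∀ h, Fh h p = 0) ∧
      (∀ (qh : ℕ → Hpt n) (q : Hpt n), Tendsto qh atTop (𝓝 q) →
        Tendsto (fun h => Fh h (qh h)) atTop (𝓝 (F q)) ∧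
        Tendsto (fun h => fun i => gradH (fun q => Fh h q i) (qh h)) atTop
          (𝓝 (fun i => gradH (fun q => F q i) q))) := by
  have hFc : ∀ i, Continuous fun q => F q i := fun i => continuousOn_univ.1 (hF i).contOn
  have hgc : ∀ i l, Continuous fun q => gradH (fun q => F q i) q l :=
    fun i l => continuousOn_univ.1 ((hF i).contGrad l)
  let φ : ℕ → ContDiffBump (0 : Hpt n) := fun h =>
    ⟨1 / ((h:ℝ) + 1) / 2, 1 / ((h:ℝ) + 1), by positivity, by
      have : (0:ℝ) < 1 / ((h:ℝ) + 1) := by positivity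
      linarith⟩
  let ρ : ℕ → Hpt n → ℝ := fun h => (φ h).normed volume
  have hρs : ∀ h, ContDiff ℝ (⊤ : ℕ∞) (ρ h) := fun h => (φ h).contDiff_normed
  have hρc : ∀ h, Continuous (ρ h) := fun h => (φ h).continuous_normed
  have hρk : ∀ h, HasCompactSupport (ρ h) := fun h => (φ h).hasCompactSupport_normed
  have hρ0 : ∀ h y, 0 ≤ ρ h y := fun h y => (φ h).nonneg_normed y
  have hρ1 : ∀ h, ∫ y, ρ h y = 1 := fun h => (φ h).integral_normed
  have hρb : ∀ h y, ρ h y ≠ 0 → y ∈ Metric.ball (0 : Hpt n) (1 / ((h:ℝ) + 1)) := by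
    intro h y hy
    have : y ∈ Function.support ((φ h).normed volume) := hy
    rwa [(φ h).support_normed_eq] at this
  have conv : ∀ {G : Hpt n → ℝ}, Continuous G → ∀ (qh : ℕ → Hpt n) (q : Hpt n),
      Tendsto qh atTop (𝓝 q) → Tendsto (fun h => Mo (ρ h) G (qh h)) atTop (𝓝 (G q)) := by
    intro G hG qh q hq
    rw [Metric.tendsto_atTop]
    intro δ hδ
    have hcont : ContinuousAt (fun x : Hpt n × Hpt n => G (hmul x.1 x.2)) (0, q) :=
      (hG.comp contDiff_hmul.continuous).continuousAt
    have h1 : ∀ᶠ x in 𝓝 ((0 : Hpt n), q), |G (hmul x.1 x.2) - G q| < δ / 2 := by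
      have := Metric.continuousAt_iff'.1 hcont (δ / 2) (by positivity)
      simpa [Real.dist_eq] using this
    rw [nhds_prod_eq, eventually_prod_iff] at h1
    obtain ⟨pa, hpa, pb, hpb, hab⟩ := h1
    obtain ⟨r, hr, hra⟩ := Metric.eventually_nhds_iff_ball.1 hpa
    have h2 : ∀ᶠ h : ℕ in atTop, 1 / ((h:ℝ) + 1) < r :=
      tendsto_one_div_add_atTop_nhds_zero_nat.eventually (gt_mem_nhds hr)
    obtain ⟨N, hN⟩ := eventually_atTop.1 (h2.and (hq.eventually hpb))
    refine ⟨N, fun h hh => ?_⟩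
    rw [Real.dist_eq]
    refine lt_of_le_of_lt (Mo_sub_le (hρc h) (hρk h) (hρ0 h) (hρ1 h) hG (ε := δ / 2) ?_) (by linarith)
    intro y hy
    exact (hab (hra y (Metric.ball_subset_ball (hN h hh).1.le (hρb h y hy))) (hN h hh).2).le
  have hgrad : ∀ h i q l, HG (fun q => Mo (ρ h) (fun q => F q i) q - Mo (ρ h) (fun q => F q i) p) q l
      (Mo (ρ h) (fun q => gradH (fun q => F q i) q l) q) := by
    intro h i q l
    have h1 := Mo_HG (hρc h) (hρk h) (hF i) (B := |L i l| + ε) l (fun q => by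
      have := hL q i l
      have h2 := abs_sub_abs_le_abs_sub (gradH (fun q => F q i) q l) (L i l)
      linarith) q
    simpa using h1.sub (HG.const (Mo (ρ h) (fun q => F q i) p) q l)
  refine ⟨fun h q i => Mo (ρ h) (fun q => F q i) q - Mo (ρ h) (fun q => F q i) p, ?_, ?_, ?_, ?_⟩
  · intro h i
    exact (Mo_smooth (hρs h) (hρk h) (hFc i)).sub contDiff_const
  · intro h q i l
    rw [(hgrad h i q l).grad]
    exact Mo_sub_le (hρc h) (hρk h) (hρ0 h) (hρ1 h) (hgc i l) fun y _ => hL _ i l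
  · intro h
    funext i
    simp
  · intro qh q hq
    constructor
    · rw [tendsto_pi_nhds]
      intro i
      have h1 := (conv (hFc i) qh q hq).sub (conv (hFc i) (fun _ => p) p tendsto_const_nhds)
      have : F p i = 0 := by rw [hp]; rfl
      simpa [this] using h1
    · rw [tendsto_pi_nhds]
      intro i
      rw [tendsto_pi_nhds]
      intro l
      simp only [fun h => (hgrad h i (qh h) l).grad]
      exact conv (hgc i l) qh q hq

end Heis
end


open MeasureTheory Topology Filter Set ENNReal
set_option autoImplicit false
noncomputable section
namespace Heis
variable {n : ℕ}

/-! ## Structure of the half level sets -/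

lemma adm_linInd {j : ℕ} {v : (Fin j → ℝ) →ₗ[ℝ] Hpt n} (hv : IsoV v) {c : Hco n j} (hc : Adm v c) :
    LinearIndependent ℝ (fun i => c i) := by
  rw [Fintype.linearIndependent_iff]
  intro g hg
  have hF := fib_dlin hv hc
  have h1 : dlin c (v (sol v (dlin c) 0 g)) = g := by
    simpa using hF.sol_spec 0 g
  have h2 : ∀ w : Hpt n, ∑ i, g i * dlin1 (c i) w = dlin1 (∑ i, g i • c i) w := by
    intro w
    simp only [dlin1, Finset.mul_sum, Finset.sum_apply, Pi.smul_apply, smul_eq_mul]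
    rw [Finset.sum_comm]
    refine Finset.sum_congr rfl fun l _ => ?_
    rw [← Finset.sum_add_distrib]
    refine Finset.sum_congr rfl fun i _ => ?_
    ring
  have h3 := h2 (v (sol v (dlin c) 0 g))
  rw [hg] at h3
  have h4 : ∀ i, dlin1 (c i) (v (sol v (dlin c) 0 g)) = g i := fun i => congrFun h1 i
  simp only [h4] at h3
  have h5 : ∑ i, g i * g i = 0 := by rw [h3]; simp [dlin1]
  intro i
  have := (Finset.sum_eq_zero_iff_of_nonneg (fun i _ => mul_self_nonneg (g i))).1 h5 i (Finset.mem_univ i)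
  exact mul_self_eq_zero.1 this

def halfS {k : ℕ} (G : Hpt n → Fin (k+1) → ℝ) : Set (Hpt n) :=
  {q | (∀ i : Fin k, G q i.castSucc = 0) ∧ 0 < G q (Fin.last k)}

section half
variable {k : ℕ} {v : (Fin (k+1) → ℝ) →ₗ[ℝ] Hpt n} {G : Hpt n → Fin (k+1) → ℝ}

lemma Fib.near (h : Fib v G) (q : Hpt n) (hq : G q = 0) :
    Tendsto (fun s : ℝ => hmul q (v (sol v G q (Pi.single (Fin.last k) s)))) (𝓝 0) (𝓝 q) := by
  have hc : Continuous fun s : ℝ => hmul q (v (sol v G q (Pi.single (Fin.last k) s))) := by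
    refine Continuous.hmul' continuous_const ((continuous_v v).comp ?_)
    exact h.continuous_sol.comp (continuous_const.prodMk (continuous_single (Fin.last k)))
  have := hc.tendsto 0
  rw [Pi.single_zero] at this
  have e : sol v G q 0 = 0 := h.sF_eq_zero hq
  simpa [e] using this

lemma Fib.near_val (h : Fib v G) (q : Hpt n) (s : ℝ) :
    (∀ i : Fin k, G (hmul q (v (sol v G q (Pi.single (Fin.last k) s)))) i.castSucc = 0) ∧
      G (hmul q (v (sol v G q (Pi.single (Fin.last k) s)))) (Fin.last k) = s := by
  rw [h.sol_spec]
  refine ⟨fun i => ?_, by simp⟩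
  rw [Pi.single_eq_of_ne]
  exact (Fin.castSucc_lt_last i).ne

lemma Fib.closure_halfS (h : Fib v G) : closure (halfS G) =
    {q | (∀ i : Fin k, G q i.castSucc = 0) ∧ 0 ≤ G q (Fin.last k)} := by
  have hc : ∀ i, Continuous fun q => G q i := fun i => (continuous_apply i).comp h.cont
  refine Subset.antisymm (closure_minimal (fun q hq => ⟨hq.1, hq.2.le⟩) ?_) fun q hq => ?_
  · have e : {q | (∀ i : Fin k, G q i.castSucc = 0) ∧ 0 ≤ G q (Fin.last k)} =
      (⋂ i : Fin k, {q | G q i.castSucc = 0}) ∩ {q | 0 ≤ G q (Fin.last k)} := by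
      ext q; simp
    rw [e]
    exact (isClosed_iInter fun i => isClosed_eq (hc _) continuous_const).inter
      (isClosed_le continuous_const (hc _))
  · rcases hq.2.lt_or_eq with h1 | h1
    · exact subset_closure ⟨hq.1, h1⟩
    · have h0 : G q = 0 := by
        funext i
        refine Fin.lastCases h1.symm (fun i => hq.1 i) i
      refine mem_closure_of_tendsto ((h.near q h0).mono_left (nhdsWithin_le_nhds (s := Ioi 0))) ?_
      filter_upwards [self_mem_nhdsWithin] with s hs
      have := h.near_val q s
      exact ⟨this.1, this.2.symm ▸ hs⟩

lemma zero_iff (q : Hpt n) : G q = 0 ↔ (∀ i : Fin k, G q i.castSucc = 0) ∧ G q (Fin.last k) = 0 := by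
  constructor
  · intro h; simp [h]
  · intro h; funext i; exact Fin.lastCases h.2 (fun i => h.1 i) i

lemma Fib.bdry_halfS (h : Fib v G) : bdry (halfS G) = {q | G q = 0} := by
  ext q
  rw [bdry, h.closure_halfS]
  simp only [mem_diff, mem_setOf_eq, halfS, zero_iff]
  constructor
  · rintro ⟨⟨h1, h2⟩, h3⟩
    exact ⟨h1, le_antisymm (not_lt.1 fun h4 => h3 ⟨h1, h4⟩) h2⟩
  · rintro ⟨h1, h2⟩
    exact ⟨⟨h1, h2.ge⟩, fun h3 => h3.2.ne' h2⟩

lemma smooth_linInd {j : ℕ} {f : Fin j → Hpt n → ℝ} (hf : ∀ i, ContDiff ℝ (⊤ : ℕ∞) (f i)) {q : Hpt n}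
    (h : LinearIndependent ℝ fun i => gradH (f i) q) : LinearIndependent ℝ fun i => fderiv ℝ (f i) q := by
  rw [Fintype.linearIndependent_iff] at h ⊢
  intro g hg
  refine h g ?_
  funext l
  have := congrArg (fun A : Hpt n →L[ℝ] ℝ => A (frameVec (hIdx l) q)) hg
  simp only [_root_.sum_apply, ContinuousLinearMap.smul_apply,
    ContinuousLinearMap.zero_apply] at this
  simp only [Finset.sum_apply, Pi.smul_apply, (HG_smooth (hf _) q l).grad, Pi.zero_apply]
  exact this

lemma half_smooth (O : Set (Hpt n)) (hO : IsOpen O) (h : Fib v G)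
    (hG : ∀ i, ContDiff ℝ (⊤ : ℕ∞) fun q => G q i)
    (hli : ∀ q, LinearIndependent ℝ fun i => gradH (fun q => G q i) q) :
    IsSmoothCodim k (O ∩ halfS G) ∧ IsC1HCodim k (O ∩ halfS G) ∧
    IsSmoothCodim (k+1) (O ∩ bdry (halfS G)) ∧ IsC1HCodim (k+1) (O ∩ bdry (halfS G)) := by
  have hli' : ∀ q, LinearIndependent ℝ fun i : Fin k => gradH (fun q => G q i.castSucc) q := fun q =>
    (hli q).comp Fin.castSucc (Fin.castSucc_injective k)
  have hU : IsOpen (O ∩ {q | 0 < G q (Fin.last k)}) :=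
    hO.inter (isOpen_lt continuous_const (hG _).continuous)
  have e1 : O ∩ halfS G ∩ (O ∩ {q | 0 < G q (Fin.last k)}) =
      {q ∈ O ∩ {q | 0 < G q (Fin.last k)} | ∀ i : Fin k, G q i.castSucc = 0} := by
    ext q; simp only [halfS, mem_inter_iff, mem_setOf_eq]; tauto
  have e2 : O ∩ bdry (halfS G) ∩ O = {q ∈ O | ∀ i, G q i = 0} := by
    rw [h.bdry_halfS]
    ext q; simp only [mem_inter_iff, mem_setOf_eq, funext_iff, Pi.zero_apply]; tauto
  refine ⟨fun p hp => ⟨_, hU, ⟨hp.1, hp.2.2⟩, fun i q => G q i.castSucc, fun i => hG _,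
    fun q _ => smooth_linInd (fun i => hG _) (hli' q), e1⟩,
    fun p hp => ⟨_, hU, ⟨hp.1, hp.2.2⟩, fun i q => G q i.castSucc, fun i => IsC1H_smooth (hG _) _,
    fun q _ => hli' q, e1⟩,
    fun p hp => ⟨O, hO, hp.1, fun i q => G q i, fun i => hG _,
    fun q _ => smooth_linInd (fun i => hG _) (hli q), e2⟩,
    fun p hp => ⟨O, hO, hp.1, fun i q => G q i, fun i => IsC1H_smooth (hG _) _,
    fun q _ => hli q, e2⟩⟩

lemma half_withBdry (D : HomDist n) (hn : 1 ≤ n) (hk : k + 1 ≤ n) (O : Set (Hpt n)) (hO : IsOpen O)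
    (h : Fib v G)
    (hG : ∀ i, ContDiff ℝ (⊤ : ℕ∞) fun q => G q i)
    (hli : ∀ q, LinearIndependent ℝ fun i => gradH (fun q => G q i) q) {p : Hpt n} (hp : p ∈ O)
    (hp0 : G p = 0) :
    IsC1HSubWithBdry D k O (halfS G) := by
  obtain ⟨-, h1, -, h2⟩ := half_smooth O hO h hG hli
  have hli' : ∀ q, LinearIndependent ℝ fun i : Fin k => gradH (fun q => G q i.castSucc) q := fun q =>
    (hli q).comp Fin.castSucc (Fin.castSucc_injective k)
  have hpb : p ∈ bdry (halfS G) := by rw [h.bdry_halfS]; exact hp0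
  refine ⟨?_, ?_, ⟨p, hp, hpb⟩, ?_, ?_⟩
  · exact mem_closure_iff.1 hpb.1 O hO hp
  · rw [IsC1HSub, if_pos (by omega)]; exact h1
  · rw [IsC1HSub, if_pos (by omega)]; exact h2
  · intro q hq
    have hq0 : G q = 0 := by
      have := hq.2
      rw [h.bdry_halfS] at this; exact this
    refine ⟨univ, isOpen_univ, mem_univ _, {q | ∀ i : Fin k, G q i.castSucc = 0}, subset_univ _, ?_, ?_, ?_⟩
    · rw [IsC1HSub, if_pos (by omega)]
      intro x hx
      exact ⟨univ, isOpen_univ, mem_univ _, fun i q => G q i.castSucc, fun i => IsC1H_smooth (hG _) _,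
        fun q _ => hli' q, by simp⟩
    · rw [h.closure_halfS]
      rintro x ⟨-, hx⟩
      exact hx.1
    · intro r hr
      have h3 : ∀ᶠ s in 𝓝[<] (0:ℝ), hmul q (v (sol v G q (Pi.single (Fin.last k) s))) ∈ hball D q r :=
        ((h.near q hq0).mono_left nhdsWithin_le_nhds).eventually (hball_mem_nhds D hn q hr)
      obtain ⟨s, hs, hs0⟩ := (h3.and self_mem_nhdsWithin).exists
      refine ⟨_, hs, (h.near_val q s).1, ?_⟩
      rw [h.closure_halfS]
      intro hx
      have := hx.2
      rw [(h.near_val q s).2] at this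
      exact absurd this (not_le.2 hs0)

end half

/-! ## Restriction to the first `k` components -/

def embL (k : ℕ) : (Fin k → ℝ) →ₗ[ℝ] (Fin (k+1) → ℝ) where
  toFun a := Fin.snoc (α := fun _ => ℝ) a 0
  map_add' a b := by
    funext i; refine Fin.lastCases ?_ (fun i => ?_) i <;> simp
  map_smul' a b := by
    funext i; refine Fin.lastCases ?_ (fun i => ?_) i <;> simp

lemma embL_cast {k : ℕ} (a : Fin k → ℝ) (i : Fin k) : embL k a i.castSucc = a i := by
  simp [embL]

lemma IsoV.emb {k : ℕ} {v : (Fin (k+1) → ℝ) →ₗ[ℝ] Hpt n} (hv : IsoV v) : IsoV (v ∘ₗ embL k) :=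
  ⟨fun a => hv.t0 _, fun a b => by simp [hv.mul]⟩

lemma adm_of_close (D : HomDist n) {j : ℕ} {v : (Fin j → ℝ) →ₗ[ℝ] Hpt n} {L : Hco n j} {ε : ℝ}
    (h : ∀ F : Hpt n → Fin j → ℝ,
      (∀ i, IsC1H univ fun q => F q i) → (∀ q i l, |gradH (fun q => F q i) q l - L i l| ≤ ε) →
      Gr D v F (fun q i => gradH (fun q => F q i) q)) {c : Hco n j} (hc : ∀ i l, |c i l - L i l| ≤ ε) :
    Adm v c := by
  have hg : ∀ i q l, HG (fun q => dlin c q i) q l (c i l) := fun i q l => HG_dlin1 (c i) q l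
  have h1 := h (dlin c) (fun i => IsC1H.of_HG ?_ (fun q _ l => hg i q l) fun l => continuousOn_const)
    fun q i l => by rw [(hg i q l).grad]; exact hc i l
  · have := h1.adm 0
    have e : (fun i => gradH (fun q => dlin c q i) 0) = c := by
      funext i l; exact (hg i 0 l).grad
    rwa [e] at this
  · exact (continuous_dlin1.comp ((continuous_const (y := c i)).prodMk continuous_id)).continuousOn

lemma isCompact_close {j : ℕ} (L : Hco n j) (ε : ℝ) : IsCompact {c : Hco n j | ∀ i l, |c i l - L i l| ≤ ε} := by
  have : {c : Hco n j | ∀ i l, |c i l - L i l| ≤ ε} =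
      Set.pi univ fun i => Set.pi univ fun l => Icc (L i l - ε) (L i l + ε) := by
    ext c
    simp only [mem_setOf_eq, mem_univ_pi, mem_Icc]
    refine forall_congr' fun i => forall_congr' fun l => ?_
    rw [abs_le]; constructor <;> intro h <;> constructor <;> linarith [h.1, h.2]
  rw [this]
  exact isCompact_univ_pi fun i => isCompact_univ_pi fun l => isCompact_Icc

end Heis
end


open MeasureTheory Topology Filter Set ENNReal
set_option autoImplicit false
noncomputable section
namespace Heis
variable {n : ℕ}

/-! ## Unit simple multivectors -/

section wedge
variable {m : ℕ}

lemma dotC_comm (a b : Fin (2*n+1) → ℝ) : dotC a b = dotC b a := by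
  simp [dotC, mul_comm]

lemma dotC_sum {ι : Type*} (s : Finset ι) (g : ι → ℝ) (o : ι → Fin (2*n+1) → ℝ) (b : Fin (2*n+1) → ℝ) :
    dotC (∑ k ∈ s, g k • o k) b = ∑ k ∈ s, g k * dotC (o k) b := by
  simp only [dotC, Finset.sum_apply, Pi.smul_apply, smul_eq_mul, Finset.sum_mul, Finset.mul_sum]
  rw [Finset.sum_comm]
  simp only [mul_assoc]

def Gram (u : Fin m → Fin (2*n+1) → ℝ) : Matrix (Fin m) (Fin m) ℝ := Matrix.of fun i k => dotC (u i) (u k)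

lemma simpleWedge_mul (A : Matrix (Fin m) (Fin m) ℝ) (u o : Fin m → Fin (2*n+1) → ℝ)
    (h : ∀ i, u i = ∑ k, A i k • o k) : simpleWedge u = A.det • simpleWedge o := by
  funext s
  simp only [simpleWedge, Pi.smul_apply, smul_eq_mul]
  rw [← Matrix.det_mul]
  congr 1
  ext i l
  simp [Matrix.mul_apply, h]

lemma Gram_mul (A : Matrix (Fin m) (Fin m) ℝ) (u o : Fin m → Fin (2*n+1) → ℝ)
    (h : ∀ i, u i = ∑ k, A i k • o k) (ho : ∀ i j, dotC (o i) (o j) = if i = j then 1 else 0) :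
    Gram u = A * A.transpose := by
  ext i l
  simp only [Gram, Matrix.of_apply, Matrix.mul_apply, Matrix.transpose_apply]
  rw [h i, dotC_sum]
  refine Finset.sum_congr rfl fun k _ => ?_
  rw [dotC_comm, h l, dotC_sum]
  simp [ho]

lemma orth_linInd {o : Fin m → Fin (2*n+1) → ℝ}
    (ho : ∀ i j, dotC (o i) (o j) = if i = j then 1 else 0) : LinearIndependent ℝ o := by
  rw [Fintype.linearIndependent_iff]
  intro g hg i
  have := dotC_sum Finset.univ g o (o i)
  rw [hg] at this
  simp only [ho] at this
  simpa [dotC] using this.symm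

lemma exists_coeff {W : Submodule ℝ (Fin (2*n+1) → ℝ)} (hW : Module.finrank ℝ W = m)
    {u o : Fin m → Fin (2*n+1) → ℝ} (huW : ∀ i, u i ∈ W) (hoW : ∀ i, o i ∈ W)
    (hu : LinearIndependent ℝ u) (ho : LinearIndependent ℝ o) :
    ∃ A : Matrix (Fin m) (Fin m) ℝ, (∀ i, u i = ∑ k, A i k • o k) ∧ A.det ≠ 0 := by
  have hs : Submodule.span ℝ (range o) = W := by
    refine Submodule.eq_of_le_of_finrank_eq ?_ ?_
    · rw [Submodule.span_le]; rintro _ ⟨i, rfl⟩; exact hoW i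
    · rw [finrank_span_eq_card ho, hW, Fintype.card_fin]
  have h1 : ∀ i, ∃ c : Fin m → ℝ, ∑ k, c k • o k = u i := fun i => by
    rw [← Submodule.mem_span_range_iff_exists_fun, hs]; exact huW i
  choose A hA using h1
  refine ⟨A, fun i => (hA i).symm, fun hd => ?_⟩
  obtain ⟨g, hg0, hg⟩ := Matrix.exists_vecMul_eq_zero_iff.2 hd
  apply hg0
  rw [Fintype.linearIndependent_iff] at hu
  funext i
  refine hu g ?_ i
  simp only [← hA, Finset.smul_sum, smul_smul]
  rw [Finset.sum_comm]
  refine Finset.sum_eq_zero fun k _ => ?_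
  rw [← Finset.sum_smul]
  have := congrFun hg k
  simp only [Matrix.vecMul, dotProduct, Pi.zero_apply] at this
  rw [this, zero_smul]

/-- normalized wedge -/
def nw (u : Fin m → Fin (2*n+1) → ℝ) : MVec n m := (Real.sqrt (Gram u).det)⁻¹ • simpleWedge u

lemma nw_pm {W : Submodule ℝ (Fin (2*n+1) → ℝ)} (hW : Module.finrank ℝ W = m)
    {u o : Fin m → Fin (2*n+1) → ℝ} (huW : ∀ i, u i ∈ W) (hoW : ∀ i, o i ∈ W)
    (hu : LinearIndependent ℝ u) (ho : ∀ i j, dotC (o i) (o j) = if i = j then 1 else 0) :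
    0 < (Gram u).det ∧ (simpleWedge o = nw u ∨ simpleWedge o = - nw u) := by
  obtain ⟨A, hA, hd⟩ := exists_coeff hW huW hoW hu (orth_linInd ho)
  have h1 : (Gram u).det = A.det ^ 2 := by
    rw [Gram_mul A u o hA ho, Matrix.det_mul, Matrix.det_transpose, sq]
  have h2 := simpleWedge_mul A u o hA
  refine ⟨by rw [h1]; positivity, ?_⟩
  rw [nw, h1, Real.sqrt_sq_eq_abs, h2, smul_smul]
  rcases abs_choice A.det with h | h
  · left; rw [h, inv_mul_cancel₀ hd, one_smul]
  · right; rw [h, inv_neg, neg_mul, inv_mul_cancel₀ hd, neg_smul, one_smul, neg_neg]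

lemma exists_orth {W : Submodule ℝ (Fin (2*n+1) → ℝ)} (hW : Module.finrank ℝ W = m) :
    ∃ o : Fin m → Fin (2*n+1) → ℝ, (∀ i j, dotC (o i) (o j) = if i = j then 1 else 0) ∧
      ∀ i, o i ∈ W := by
  let e : EuclideanSpace ℝ (Fin (2*n+1)) ≃ₗ[ℝ] (Fin (2*n+1) → ℝ) := WithLp.linearEquiv 2 ℝ _
  let W' : Submodule ℝ (EuclideanSpace ℝ (Fin (2*n+1))) := W.map e.symm.toLinearMap
  have hW' : Module.finrank ℝ W' = m := by
    rw [← hW]; exact LinearEquiv.finrank_map_eq e.symm W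
  set b := (stdOrthonormalBasis ℝ W').reindex (finCongr hW')
  refine ⟨fun i => e (b i : EuclideanSpace ℝ (Fin (2*n+1))), fun i j => ?_, fun i => ?_⟩
  · have h1 := orthonormal_iff_ite.1 b.orthonormal i j
    rw [← h1, Submodule.coe_inner, PiLp.inner_apply]
    simp only [dotC]
    refine Finset.sum_congr rfl fun l _ => ?_
    exact mul_comm _ _
  · obtain ⟨w, hw, hwe⟩ := (b i).2
    show e (b i : EuclideanSpace ℝ (Fin (2*n+1))) ∈ W
    rw [← hwe]
    exact hw

lemma simpleWedge_flip (hm : 1 ≤ m) {W : Submodule ℝ (Fin (2*n+1) → ℝ)} {o : Fin m → Fin (2*n+1) → ℝ}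
    (ho : ∀ i j, dotC (o i) (o j) = if i = j then 1 else 0) (hoW : ∀ i, o i ∈ W) :
    ∃ o' : Fin m → Fin (2*n+1) → ℝ, (∀ i j, dotC (o' i) (o' j) = if i = j then 1 else 0) ∧
      (∀ i, o' i ∈ W) ∧ simpleWedge o' = - simpleWedge o := by
  let ε : Fin m → ℝ := fun i => if i = ⟨0, hm⟩ then -1 else 1
  have hε : ∀ i, ε i * ε i = 1 := fun i => by simp only [ε]; split_ifs <;> norm_num
  refine ⟨fun i => ε i • o i, fun i j => ?_, fun i => W.smul_mem _ (hoW i), ?_⟩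
  · have : dotC (ε i • o i) (ε j • o j) = ε i * ε j * dotC (o i) (o j) := by
      simp only [dotC, Pi.smul_apply, smul_eq_mul, Finset.mul_sum]
      refine Finset.sum_congr rfl fun l _ => ?_
      ring
    rw [this, ho]
    split_ifs with h
    · rw [h, hε, one_mul]
    · simp
  · rw [simpleWedge_mul (Matrix.diagonal ε) (fun i => ε i • o i) o, Matrix.det_diagonal]
    · have : ∏ i, ε i = -1 := by
        simp only [ε]
        rw [Finset.prod_ite_eq' Finset.univ (⟨0, hm⟩ : Fin m) (fun _ => (-1 : ℝ))]
        simp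
      rw [this, neg_smul, one_smul]
    · intro i
      simp [Matrix.diagonal_apply, ite_smul]

lemma simpleWedge_ne {u : Fin m → Fin (2*n+1) → ℝ} (hu : LinearIndependent ℝ u) : simpleWedge u ≠ 0 := by
  intro h0
  let M : Matrix (Fin m) (Fin (2*n+1)) ℝ := Matrix.of u
  have hr : M.rank = m := by
    have := LinearIndependent.rank_matrix (M := M) hu
    simpa using this
  have hspan : Module.finrank ℝ (Submodule.span ℝ (range M.col)) = m := by
    rw [← Matrix.rank_eq_finrank_span_cols]; exact hr
  obtain ⟨κ, a, ha, hsp, hli⟩ := exists_linearIndependent' ℝ M.col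
  haveI : Finite κ := Finite.of_injective a ha
  haveI := Fintype.ofFinite κ
  have hcard : Fintype.card κ = m := by
    rw [← finrank_span_eq_card hli, hsp, hspan]
  classical
  let s : IdxSet n m := ⟨Finset.univ.image a, by
    rw [Finset.card_image_of_injective _ ha, Finset.card_univ, hcard]⟩
  have h1 : LinearIndependent ℝ (fun i => M.col (idxTuple s i)) := by
    have hmem : ∀ i, ∃ x, a x = idxTuple s i := by
      intro i
      have := ((s.1.orderIsoOfFin s.2) i).2
      obtain ⟨x, -, hx⟩ := Finset.mem_image.1 this
      exact ⟨x, hx⟩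
    choose b hb using hmem
    have hbi : Function.Injective b := by
      intro i j hij
      have : idxTuple s i = idxTuple s j := by rw [← hb i, ← hb j, hij]
      exact (s.1.orderIsoOfFin s.2).injective (Subtype.ext this)
    have := hli.comp b hbi
    have e : (M.col ∘ a) ∘ b = fun i => M.col (idxTuple s i) := by
      funext i; simp only [Function.comp_apply, hb]
    rwa [e] at this
  have h2 : (Matrix.of fun i j => u i (idxTuple s j)).det = 0 := congrFun h0 s
  have h3 : LinearIndependent ℝ (Matrix.of fun i j => u i (idxTuple s j)).col := h1
  rw [Matrix.linearIndependent_cols_iff_isUnit, Matrix.isUnit_iff_isUnit_det, h2] at h3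
  exact not_isUnit_zero h3

lemma continuousOn_nw {Z : Type*} [TopologicalSpace Z] {A : Set Z} {u : Z → Fin m → Fin (2*n+1) → ℝ}
    (hu : ContinuousOn u A) (hp : ∀ z ∈ A, 0 < (Gram (u z)).det) : ContinuousOn (fun z => nw (u z)) A := by
  have hent : ∀ i l, ContinuousOn (fun z => u z i l) A := fun i l =>
    (continuous_apply_apply i l).comp_continuousOn hu
  have hG : ContinuousOn (fun z => (Gram (u z)).det) A := by
    have : Continuous fun w : Fin m → Fin (2*n+1) → ℝ => (Gram w).det := by
      refine Continuous.matrix_det ?_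
      refine continuous_matrix fun i l => ?_
      simp only [Gram, Matrix.of_apply, dotC]
      fun_prop
    exact this.comp_continuousOn hu
  have hs : ContinuousOn (fun z => simpleWedge (u z)) A := by
    have : Continuous fun w : Fin m → Fin (2*n+1) → ℝ => (simpleWedge w : MVec n m) := by
      refine continuous_pi fun s => ?_
      refine Continuous.matrix_det ?_
      refine continuous_matrix fun i l => ?_
      simp only [Matrix.of_apply]
      fun_prop
    exact this.comp_continuousOn hu
  unfold nw
  refine ContinuousOn.smul (ContinuousOn.inv₀ hG.sqrt fun z hz => ?_) hs
  exact (Real.sqrt_pos.2 (hp z hz)).ne'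

end wedge

end Heis
end


open MeasureTheory Topology Filter Set ENNReal
set_option autoImplicit false
noncomputable section
namespace Heis
variable {n : ℕ}

/-! ## The tangent field -/

def padC (c : Fin (2*n) → ℝ) : Fin (2*n+1) → ℝ := fun j => if h : (j:ℕ) < 2*n then c ⟨j, h⟩ else 0

lemma gradF_eq (f : Hpt n → ℝ) (q : Hpt n) : gradF f q = padC (gradH f q) := rfl

lemma dotC_padC (u : Fin (2*n+1) → ℝ) (c : Fin (2*n) → ℝ) : dotC u (padC c) = dlin1 c (rE u) := by
  have h1 : dotC u (padC c) = ∑ l : Fin (2*n), u l.castSucc * c l := by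
    rw [dotC, Fin.sum_univ_castSucc]
    simp [padC]
  have h2 : ∀ g : Fin (2*n) → ℝ, ∑ l, g l = ∑ l : Fin n, (g ⟨l, by omega⟩ + g ⟨n + l, by omega⟩) := by
    intro g
    rw [← (finCongr (two_mul n)).symm.sum_comp, Fin.sum_univ_add, Finset.sum_add_distrib]
    rfl
  rw [h1, h2]
  rfl

lemma rE_toEc (q : Hpt n) : rE (toEc q) = q := by
  refine Prod.ext ?_ (Prod.ext ?_ ?_)
  · funext i; simp [rE, toEc]
  · funext i
    have : n + (i:ℕ) < 2 * n := by omega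
    simp [rE, toEc, this]
  · simp only [rE, toEc]
    rw [dif_neg (by omega), dif_neg (by omega)]

section tau
variable {j : ℕ}

def CL (c : Hco n j) : (Fin (2*n+1) → ℝ) →ₗ[ℝ] (Fin j → ℝ) where
  toFun u := fun l => dotC u (padC (c l))
  map_add' a b := by funext l; simp [dotC, add_mul, Finset.sum_add_distrib]
  map_smul' r a := by funext l; simp [dotC, mul_assoc, Finset.mul_sum]

lemma CL_eq (c : Hco n j) (u : Fin (2*n+1) → ℝ) : CL c u = dlin c (rE u) :=
  funext fun l => dotC_padC u (c l)

def toEcL : Hpt n →ₗ[ℝ] (Fin (2*n+1) → ℝ) where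
  toFun := toEc
  map_add' a b := by funext l; simp only [toEc, Pi.add_apply]; split_ifs <;> simp
  map_smul' r a := by funext l; simp only [toEc, Pi.smul_apply]; split_ifs <;> simp

lemma continuous_CL (u : Fin (2*n+1) → ℝ) : Continuous fun c : Hco n j => CL c u := by
  simp only [CL_eq]
  exact continuous_dlin.comp (continuous_id.prodMk continuous_const)

theorem exists_tau {v : (Fin j → ℝ) →ₗ[ℝ] Hpt n} (hv : IsoV v) {L : Hco n j}
    (hL : ∀ a, dlin L (v a) = a) {m : ℕ} (hm1 : 1 ≤ m) (hm : m + j = 2*n+1) :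
    ∃ τ : Hco n j → MVec n m, ContinuousOn τ {c | Adm v c} ∧ ∀ c, Adm v c → τ c ≠ 0 ∧
      (∀ o : Fin m → Fin (2*n+1) → ℝ, (∀ i j, dotC (o i) (o j) = if i = j then 1 else 0) →
        (∀ i l, dotC (o i) (padC (c l)) = 0) → simpleWedge o = τ c ∨ simpleWedge o = - τ c) ∧
      (∃ o : Fin m → Fin (2*n+1) → ℝ, (∀ i j, dotC (o i) (o j) = if i = j then 1 else 0) ∧
        (∀ i l, dotC (o i) (padC (c l)) = 0) ∧ τ c = simpleWedge o) ∧
      (∃ o : Fin m → Fin (2*n+1) → ℝ, (∀ i j, dotC (o i) (o j) = if i = j then 1 else 0) ∧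
        (∀ i l, dotC (o i) (padC (c l)) = 0) ∧ - τ c = simpleWedge o) := by
  set ι : (Fin j → ℝ) →ₗ[ℝ] (Fin (2*n+1) → ℝ) := toEcL ∘ₗ v with hι
  have hιC : ∀ (c : Hco n j) a, CL c (ι a) = dlin c (v a) := by
    intro c a
    rw [CL_eq]
    show dlin c (rE (toEc (v a))) = _
    rw [rE_toEc]
  have hιi : Function.Injective ι := by
    intro a b hab
    have := congrArg (CL L) hab
    rwa [hιC, hιC, hL, hL] at this
  obtain ⟨E, hE⟩ := Submodule.exists_isCompl (LinearMap.range ι)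
  have hEd : Module.finrank ℝ E = m := by
    have h1 := Submodule.finrank_add_eq_of_isCompl hE
    rw [LinearMap.finrank_range_of_inj hιi] at h1
    simp only [Module.finrank_fin_fun] at h1
    omega
  let b : Module.Basis (Fin m) ℝ E := Module.finBasisOfFinrankEq ℝ E hEd
  let u : Hco n j → Fin m → Fin (2*n+1) → ℝ := fun c i =>
    (b i : Fin (2*n+1) → ℝ) - ι (sol v (dlin c) 0 (CL c (b i)))
  have hsol : ∀ c, Adm v c → ∀ g, dlin c (v (sol v (dlin c) 0 g)) = g := by
    intro c hc g
    simpa using (fib_dlin hv hc).sol_spec 0 g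
  have huW : ∀ c, Adm v c → ∀ i, u c i ∈ LinearMap.ker (CL c) := by
    intro c hc i
    rw [LinearMap.mem_ker, map_sub, hιC, hsol c hc, sub_self]
  have huli : ∀ c, LinearIndependent ℝ (u c) := by
    intro c
    rw [Fintype.linearIndependent_iff]
    intro g hg
    have hb := Fintype.linearIndependent_iff.1 b.linearIndependent g
    refine hb ?_
    have h1 : (∑ i, g i • (b i : Fin (2*n+1) → ℝ)) = ι (∑ i, g i • sol v (dlin c) 0 (CL c (b i))) := by
      rw [map_sum, ← sub_eq_zero, ← Finset.sum_sub_distrib, ← hg]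
      refine Finset.sum_congr rfl fun i _ => ?_
      rw [map_smul, ← smul_sub]
    have h2 : ((∑ i, g i • b i : E) : Fin (2*n+1) → ℝ) = ∑ i, g i • (b i : Fin (2*n+1) → ℝ) := by
      simp
    have h3 := Submodule.disjoint_def.1 hE.disjoint _ (LinearMap.mem_range_self ι
      (∑ i, g i • sol v (dlin c) 0 (CL c (b i)))) (by rw [← h1, ← h2]; exact (∑ i, g i • b i : E).2)
    rw [← h1, ← h2] at h3
    exact Subtype.ext h3
  have hWd : ∀ c, Adm v c → Module.finrank ℝ (LinearMap.ker (CL c)) = m := by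
    intro c hc
    have hs : LinearMap.range (CL c) = ⊤ := by
      rw [LinearMap.range_eq_top]
      intro g
      exact ⟨ι (sol v (dlin c) 0 g), by rw [hιC, hsol c hc]⟩
    have := LinearMap.finrank_range_add_finrank_ker (CL c)
    rw [hs, finrank_top] at this
    simp only [Module.finrank_fin_fun] at this
    omega
  have hmemW : ∀ (c : Hco n j) (w : Fin (2*n+1) → ℝ), w ∈ LinearMap.ker (CL c) ↔ ∀ l, dotC w (padC (c l)) = 0 := by
    intro c w
    rw [LinearMap.mem_ker, funext_iff]; rfl
  have hgr : ∀ c, Adm v c → 0 < (Gram (u c)).det := by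
    intro c hc
    obtain ⟨o, ho, hoW⟩ := exists_orth (hWd c hc)
    exact (nw_pm (hWd c hc) (huW c hc) hoW (huli c) ho).1
  refine ⟨fun c => nw (u c), continuousOn_nw ?_ hgr, fun c hc => ⟨?_, ?_, ?_⟩⟩
  · refine continuousOn_pi.2 fun i => ?_
    refine continuousOn_const.sub ?_
    refine ι.continuous_of_finiteDimensional.comp_continuousOn ?_
    intro c hc
    have hlim : Tendsto (fun c' : Hco n j => 2 * ‖CL c' (b i) - dlin c' (v (sol v (dlin c) 0 (CL c (b i))))‖)
        (𝓝[{c | Adm v c}] c) (𝓝 0) := by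
      have hcont : Continuous (fun c' : Hco n j =>
          2 * ‖CL c' (b i) - dlin c' (v (sol v (dlin c) 0 (CL c (b i))))‖) := by
        refine continuous_const.mul (Continuous.norm ((continuous_CL _).sub ?_))
        exact continuous_dlin.comp (continuous_id.prodMk continuous_const)
      have := hcont.tendsto c
      rw [hsol c hc, sub_self, norm_zero, mul_zero] at this
      exact this.mono_left nhdsWithin_le_nhds
    refine tendsto_iff_norm_sub_tendsto_zero.2 ?_
    refine squeeze_zero' (Eventually.of_forall fun _ => norm_nonneg _) ?_ hlim
    filter_upwards [self_mem_nhdsWithin] with c' hc'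
    have := (fib_dlin hv hc').sol_dist 0 (CL c' (b i)) (sol v (dlin c) 0 (CL c (b i)))
    simpa using this
  · unfold nw
    refine smul_ne_zero ?_ (simpleWedge_ne (huli c))
    exact inv_ne_zero (Real.sqrt_pos.2 (hgr c hc)).ne'
  · intro o ho hoW
    exact (nw_pm (hWd c hc) (huW c hc) (fun i => (hmemW c _).2 (hoW i)) (huli c) ho).2
  · obtain ⟨o, ho, hoW⟩ := exists_orth (hWd c hc)
    obtain ⟨o', ho', hoW', hoo⟩ := simpleWedge_flip hm1 ho hoW
    rcases (nw_pm (hWd c hc) (huW c hc) hoW (huli c) ho).2 with h | h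
    · exact ⟨⟨o, ho, fun i => (hmemW c _).1 (hoW i), h.symm⟩,
        ⟨o', ho', fun i => (hmemW c _).1 (hoW' i), by rw [hoo, h]⟩⟩
    · exact ⟨⟨o', ho', fun i => (hmemW c _).1 (hoW' i), by rw [hoo, h, neg_neg]⟩,
        ⟨o, ho, fun i => (hmemW c _).1 (hoW i), h.symm⟩⟩

end tau

end Heis
end


open MeasureTheory Topology Filter Set ENNReal
set_option autoImplicit false
noncomputable section
namespace Heis
variable {n : ℕ}

lemma sign_const {m : ℕ} {P : Set (Hpt n)} (hP : IsPreconnected P) {t τ : Hpt n → MVec n m}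
    (ht : ContinuousOn t P) (hτ : ContinuousOn τ P) (h0 : ∀ q ∈ P, τ q ≠ 0)
    (h : ∀ q ∈ P, t q = τ q ∨ t q = - τ q) : (∀ q ∈ P, t q = τ q) ∨ (∀ q ∈ P, t q = - τ q) := by
  let f : Hpt n → ℝ := fun q => ∑ s, t q s * τ q s
  let g : Hpt n → ℝ := fun q => ∑ s, τ q s * τ q s
  have hcs : ∀ {a : Hpt n → MVec n m}, ContinuousOn a P → ∀ s, ContinuousOn (fun q => a q s) P :=
    fun ha s => (continuous_apply s).comp_continuousOn ha
  have hf : ContinuousOn f P := continuousOn_finsetSum _ fun s _ => (hcs ht s).mul (hcs hτ s)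
  have hg : ContinuousOn g P := continuousOn_finsetSum _ fun s _ => (hcs hτ s).mul (hcs hτ s)
  have hg0 : ∀ {q}, q ∈ P → g q ≠ 0 := by
    intro q hq hz
    apply h0 q hq
    funext s
    have := (Finset.sum_eq_zero_iff_of_nonneg (fun s _ => mul_self_nonneg (τ q s))).1 hz s (Finset.mem_univ s)
    exact mul_self_eq_zero.1 this
  have h1 : ∀ q, t q = τ q → f q = g q := fun q hq => by simp only [f, g, hq]
  have h2 : ∀ q, t q = - τ q → f q = - g q := fun q hq => by simp [f, g, hq]
  have hsq : EqOn (f ^ 2) (g ^ 2) P := by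
    intro q hq
    rcases h q hq with h3 | h3
    · simp [h1 q h3]
    · simp [h2 q h3]
  rcases hP.eq_or_eq_neg_of_sq_eq hf hg hsq hg0 with h3 | h3
  · left
    intro q hq
    rcases h q hq with h4 | h4
    · exact h4
    · have e1 := h3 hq
      have e2 := h2 q h4
      have := hg0 hq
      exfalso; apply this; linarith
  · right
    intro q hq
    rcases h q hq with h4 | h4
    · have e1 : f q = - g q := h3 hq
      have e2 := h1 q h4
      have := hg0 hq
      exfalso; apply this; linarith
    · exact h4

lemma tangent_perp (D : HomDist n) (hn : 1 ≤ n) {j m : ℕ} (hj : j ≤ n) {S W : Set (Hpt n)}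
    {x : Hpt n} {t : MVec n m} (hT : IsHTangentVecAt j m S x t) (hxS : x ∈ S) (hW : IsOpen W) (hxW : x ∈ W)
    {F : Fin j → Hpt n → ℝ} (hF : ∀ i, IsC1H W (F i)) (hSW : S ∩ W ⊆ {q ∈ W | ∀ i, F i q = 0}) :
    ∃ o : Fin m → Fin (2*n+1) → ℝ, (∀ i j, dotC (o i) (o j) = if i = j then 1 else 0) ∧
        (∀ i l, dotC (o i) (padC (gradH (F l) x)) = 0) ∧ t = simpleWedge o := by
  obtain ⟨U, f, hU, hxU, hf, hli, hSU, o, ho, hof, hto⟩ := hT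
  refine ⟨o, ho, fun i l => ?_, hto⟩
  rw [dotC_padC]
  have hx0 : ∀ i, f i x = 0 := (hSU.subset ⟨hxS, hxU⟩).2
  refine ker_le D hn hj (hU.inter hW) (fun i => (hf i).mono inter_subset_left)
    ((hF l).mono inter_subset_right) ⟨hxU, hxW⟩ (hli x hxU) hx0 ?_ ?_
  · filter_upwards [(hU.inter hW).mem_nhds ⟨hxU, hxW⟩] with q hq hfq
    have h1 : q ∈ S ∩ U := by rw [hSU]; exact ⟨hq.1, hfq⟩
    exact (hSW ⟨h1.1, hq.2⟩).2 l
  · funext a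
    have := hof i a
    rwa [gradF_eq, dotC_padC] at this

end Heis
end


open MeasureTheory Topology Filter Set ENNReal
set_option autoImplicit false
noncomputable section
namespace Heis
variable {n : ℕ}

section conv
variable {j : ℕ} {v : (Fin j → ℝ) →ₗ[ℝ] Hpt n} {F : Hpt n → Fin j → ℝ} {c : Hpt n → Hco n j}
  {D : HomDist n}

lemma Gr.cont_theta (hn : 1 ≤ n) (h : Gr D v F c) : Continuous fun x => thetaD D v (c x) :=
  continuousOn_univ.1
    ((continuousOn_thetaD D hn h.fib.iso).comp h.cont.continuousOn fun x _ => h.adm x)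

lemma Gr.integral (hn : 1 ≤ n) (hj : j ≤ n) (h : Gr D v F c) {P : Set (Hpt n)}
    (hP : MeasurableSet P) (f : Hpt n → ℝ) :
    ∫ q in {q | F q = 0} ∩ P, f q ∂(sphMeasure D ((2 * n + 2 : ℝ) - j)) =
      ∫ q, P.indicator (fun q => (thetaD D v (c q) : ℝ) * f q) q ∂(lam v F) := by
  have hZ : MeasurableSet {q | F q = 0} := (isClosed_eq h.fib.cont continuous_const).measurableSet
  have hA := hZ.inter hP
  have hm : Measurable fun x => thetaD D v (c x) := (h.cont_theta hn).measurable
  have e : (sphMeasure D ((2 * n + 2 : ℝ) - j)).restrict ({q | F q = 0} ∩ P) =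
      ((lam v F).withDensity fun x => (thetaD D v (c x) : ℝ≥0∞)).restrict ({q | F q = 0} ∩ P) := by
    refine Measure.ext fun B hB => ?_
    rw [Measure.restrict_apply hB, Measure.restrict_apply hB, withDensity_apply _ (hB.inter hA)]
    exact h.area hn hj (hB.inter hA) fun q hq => hq.2.1
  rw [e, setIntegral_withDensity_eq_setIntegral_smul hm _ hA, ← integral_indicator hA]
  refine integral_congr_ae ?_
  filter_upwards [h.fib.ae_zero] with q hq
  by_cases hqP : q ∈ P
  · rw [indicator_of_mem (show q ∈ {q | F q = 0} ∩ P from ⟨hq, hqP⟩), indicator_of_mem hqP]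
    rfl
  · rw [indicator_of_notMem (fun h => hqP h.2), indicator_of_notMem hqP]

lemma Gr.conv (hn : 1 ≤ n) (hj : j ≤ n) (h : Gr D v F c) {Fh : ℕ → Hpt n → Fin j → ℝ}
    {ch : ℕ → Hpt n → Hco n j} (hh : ∀ i, Gr D v (Fh i) (ch i))
    (hFc : ∀ (qh : ℕ → Hpt n) (q : Hpt n), Tendsto qh atTop (𝓝 q) →
      Tendsto (fun i => Fh i (qh i)) atTop (𝓝 (F q)) ∧
      Tendsto (fun i => ch i (qh i)) atTop (𝓝 (c q)))
    {Kc : Set (Hco n j)} (hKc : IsCompact Kc) (hKA : ∀ a ∈ Kc, Adm v a)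
    (hchK : ∀ i q, ch i q ∈ Kc) (hcK : ∀ q, c q ∈ Kc)
    {P : Set (Hpt n)} {Ph : ℕ → Set (Hpt n)} (hP : MeasurableSet P) (hPh : ∀ i, MeasurableSet (Ph i))
    (hPP : ∀ᵐ x ∂(lam v F), ∀ qh : ℕ → Hpt n, Tendsto qh atTop (𝓝 x) →
      ∀ᶠ i in atTop, (qh i ∈ Ph i ↔ x ∈ P))
    {Ψ : Hpt n → Hco n j → ℝ}
    (hΨ : ContinuousOn (fun z : Hpt n × Hco n j => Ψ z.1 z.2) (univ ×ˢ Kc))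
    {K : Set (Hpt n)} (hK : IsCompact K) (hΨ0 : ∀ q ∉ K, ∀ a, Ψ q a = 0) :
    Tendsto (fun i => ∫ q in {q | Fh i q = 0} ∩ Ph i, Ψ q (ch i q)
        ∂(sphMeasure D ((2 * n + 2 : ℝ) - j))) atTop
      (𝓝 (∫ q in {q | F q = 0} ∩ P, Ψ q (c q) ∂(sphMeasure D ((2 * n + 2 : ℝ) - j)))) := by
  haveI := h.fib.finite_lam
  have hv := h.fib.iso
  set Φ : Hpt n × Hco n j → ℝ := fun z => (thetaD D v z.2 : ℝ) * Ψ z.1 z.2 with hΦ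
  have hΦc : ContinuousOn Φ (univ ×ˢ Kc) := by
    refine ContinuousOn.mul ?_ hΨ
    refine NNReal.continuous_coe.comp_continuousOn ?_
    exact (continuousOn_thetaD D hn hv).comp continuousOn_snd fun z hz => hKA _ hz.2
  obtain ⟨C, hC⟩ : ∃ C, ∀ z ∈ K ×ˢ Kc, ‖Φ z‖ ≤ C :=
    (hK.prod hKc).exists_bound_of_continuousOn (hΦc.mono (prod_mono (subset_univ _) subset_rfl))
  have hΦ0 : ∀ q ∉ K, ∀ a, Φ (q, a) = 0 := fun q hq a => by simp [hΦ, hΨ0 q hq a]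
  have hC' : ∀ q, ∀ a ∈ Kc, ‖Φ (q, a)‖ ≤ max C 0 := by
    intro q a ha
    by_cases hq : q ∈ K
    · exact (hC (q, a) ⟨hq, ha⟩).trans (le_max_left _ _)
    · rw [hΦ0 q hq a]; simp
  have hcc : ∀ {g : Hpt n → Hco n j}, Continuous g → (∀ q, g q ∈ Kc) →
      Continuous fun q => Φ (q, g q) := fun {g} hg hgK =>
    continuousOn_univ.1
      (hΦc.comp (continuous_id.prodMk hg).continuousOn fun x _ => ⟨mem_univ _, hgK x⟩)
  rw [h.integral hn hj hP]
  have e : ∀ i, ∫ q in {q | Fh i q = 0} ∩ Ph i, Ψ q (ch i q) ∂(sphMeasure D ((2 * n + 2 : ℝ) - j)) =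
      ∫ q, (Ph i).indicator (fun q => Φ (q, ch i q)) (PF v (Fh i) q) ∂(lam v F) := by
    intro i
    rw [(hh i).integral hn hj (hPh i), h.fib.lam_transfer (hh i).fib,
      integral_map (hh i).fib.continuous_PF.measurable.aemeasurable]
    exact ((hcc (hh i).cont (hchK i)).measurable.indicator (hPh i)).aestronglyMeasurable
  simp_rw [e]
  set K' := PF v F '' K
  have hK' : IsCompact K' := hK.image h.fib.continuous_PF
  refine tendsto_integral_of_dominated_convergence (K'.indicator fun _ => max C 0) ?_ ?_ ?_ ?_
  · intro i
    exact (((hcc (hh i).cont (hchK i)).measurable.indicator (hPh i)).comp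
      (hh i).fib.continuous_PF.measurable).aestronglyMeasurable
  · rw [integrable_indicator_iff hK'.measurableSet]
    exact integrableOn_const hK'.measure_lt_top.ne
  · intro i
    filter_upwards [h.fib.ae_zero] with x hx
    by_cases hxP : PF v (Fh i) x ∈ Ph i
    · rw [indicator_of_mem hxP]
      by_cases hxK : PF v (Fh i) x ∈ K
      · have : x ∈ K' := ⟨_, hxK, by rw [h.fib.PG_PF, h.fib.PF_eq_self hx]⟩
        rw [indicator_of_mem this]
        exact hC' _ _ (hchK i _)
      · rw [hΦ0 _ hxK, norm_zero]
        exact indicator_nonneg (fun _ _ => le_max_right _ _) _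
    · rw [indicator_of_notMem hxP, norm_zero]
      exact indicator_nonneg (fun _ _ => le_max_right _ _) _
  · filter_upwards [h.fib.ae_zero, hPP] with x hx hxP
    have t1 : Tendsto (fun i => PF v (Fh i) x) atTop (𝓝 x) := by
      have a1 : Tendsto (fun i => Fh i x) atTop (𝓝 0) := by
        have := (hFc (fun _ => x) x tendsto_const_nhds).1
        rwa [hx] at this
      have a2 : Tendsto (fun i => sF v (Fh i) x) atTop (𝓝 0) := by
        refine squeeze_zero_norm (fun i => (hh i).fib.norm_sF x) ?_
        simpa using (a1.norm.const_mul 2)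
      have a3 : Tendsto (fun a => hmul x (v a)) (𝓝 0) (𝓝 (hmul x (v 0))) :=
        (Continuous.hmul' continuous_const (continuous_v v)).tendsto 0
      have := a3.comp a2
      rwa [show hmul x (v 0) = x by simp [hmul]] at this
    have t2 := (hFc _ _ t1).2
    have t3 : Tendsto (fun i => Φ (PF v (Fh i) x, ch i (PF v (Fh i) x))) atTop (𝓝 (Φ (x, c x))) := by
      have := hΦc (x, c x) ⟨mem_univ _, hcK x⟩
      refine this.tendsto.comp (tendsto_nhdsWithin_iff.2 ⟨t1.prodMk_nhds t2, ?_⟩)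
      exact Eventually.of_forall fun i => ⟨mem_univ _, hchK i _⟩
    by_cases hxP' : x ∈ P
    · rw [indicator_of_mem hxP']
      refine t3.congr' ?_
      filter_upwards [hxP _ t1] with i hi
      rw [indicator_of_mem (hi.2 hxP')]
    · rw [indicator_of_notMem hxP']
      refine tendsto_const_nhds.congr' ?_
      filter_upwards [hxP _ t1] with i hi
      rw [indicator_of_notMem (fun h => hxP' (hi.1 h))]

lemma Gr.locFin (hn : 1 ≤ n) (hj : j ≤ n) (h : Gr D v F c) (O : Set (Hpt n)) {A : Set (Hpt n)}
    (hA : ∀ q ∈ A, F q = 0) :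
    LocFin (sphMeasure D ((2 * n + 2 : ℝ) - j)) A O := by
  haveI := h.fib.finite_lam
  intro p _
  refine ⟨Metric.ball p 1, Metric.isOpen_ball, Metric.mem_ball_self one_pos, ?_⟩
  set B := {q | F q = 0} ∩ Metric.closedBall p 1
  have hB : IsCompact B := (isCompact_closedBall p 1).inter_left (isClosed_eq h.fib.cont continuous_const)
  refine (measure_mono (show A ∩ Metric.ball p 1 ⊆ B from fun q hq =>
    ⟨hA q hq.1, Metric.ball_subset_closedBall hq.2⟩)).trans_lt ?_
  rw [h.area hn hj hB.measurableSet fun q hq => hq.1]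
  obtain ⟨C, hC⟩ := hB.exists_bound_of_continuousOn
    (f := fun x => (thetaD D v (c x) : ℝ)) (NNReal.continuous_coe.comp (h.cont_theta hn)).continuousOn
  refine (setLIntegral_mono' (g := fun _ => ENNReal.ofReal C) hB.measurableSet fun x hx => ?_).trans_lt ?_
  · rw [← ENNReal.ofReal_coe_nnreal]
    exact ENNReal.ofReal_le_ofReal ((le_abs_self _).trans (hC x hx))
  · rw [setLIntegral_const]
    exact ENNReal.mul_lt_top ENNReal.ofReal_lt_top hB.measure_lt_top

end conv

end Heis
end


open MeasureTheory Topology Filter Set ENNReal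
set_option autoImplicit false
noncomputable section
namespace Heis
variable {n : ℕ}

lemma ae_last_ne {k : ℕ} {v : (Fin (k+1) → ℝ) →ₗ[ℝ] Hpt n} {F : Hpt n → Fin (k+1) → ℝ} (h : Fib v F)
    (h' : Fib (v ∘ₗ embL k) fun q i => F q (Fin.castSucc i)) :
    ∀ᵐ x ∂(lam (v ∘ₗ embL k) fun q i => F q (Fin.castSucc i)), F x (Fin.last k) ≠ 0 := by
  set F' : Hpt n → Fin k → ℝ := fun q i => F q (Fin.castSucc i) with hF'
  set v' := v ∘ₗ embL k with hv'
  have hZ : MeasurableSet {q | F q = 0} := (isClosed_eq h.cont continuous_const).measurableSet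
  have h0 : lam v' F' {q | F q = 0} = 0 := by
    rw [h'.lam_apply hZ]
    refine measure_mono_null (t := PF v F ⁻¹' univ ∩ sF v F ⁻¹' {a | a (Fin.last k) = 0}) ?_ ?_
    · rintro q ⟨hq, -⟩
      refine ⟨mem_univ _, ?_⟩
      have e : sF v F q = embL k (sF v' F' q) := (h.sol_unique hq).symm
      show sF v F q (Fin.last k) = 0
      rw [e]; simp [embL]
    · rw [h.prod_rect MeasurableSet.univ
        ((isClosed_eq (continuous_apply _) continuous_const).measurableSet)]
      rw [show (volume {a : Fin (k+1) → ℝ | a (Fin.last k) = 0}) = 0 from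
        Measure.pi_hyperplane _ _ _, mul_zero]
  have h1 : ∀ᵐ x ∂(lam v' F'), ¬ (F x = 0) := by
    rw [ae_iff]; simpa using h0
  filter_upwards [h1, h'.ae_zero] with x hx hx'
  intro hl
  exact hx ((zero_iff x).2 ⟨fun i => congrFun hx' i, hl⟩)

lemma continuous_form {m : ℕ} {ω : Hpt n → Cov n m} (hω : ∀ v, Continuous fun p => ω p v)
    {w : Fin m → Hpt n → Hpt n} (hw : ∀ i, Continuous (w i)) : Continuous fun q => ω q (fun i => w i q) := by
  let b := Module.finBasis ℝ (Hpt n)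
  have e : ∀ q, ω q (fun i => w i q) = ∑ r : Fin m → Fin (Module.finrank ℝ (Hpt n)),
      (∏ i, b.repr (w i q) (r i)) * ω q (fun i => b (r i)) := by
    intro q
    have h1 : (fun i => w i q) = fun i => ∑ l, b.repr (w i q) l • b l := by
      funext i; exact (b.sum_repr (w i q)).symm
    rw [h1]
    rw [← AlternatingMap.coe_multilinearMap, MultilinearMap.map_sum]
    refine Finset.sum_congr rfl fun r _ => ?_
    rw [MultilinearMap.map_smul_univ]
    rfl
  simp_rw [e]
  refine continuous_finsetSum _ fun r _ => Continuous.mul (continuous_finsetProd _ fun i _ => ?_) (hω _)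
  have : Continuous (b.coord (r i)) := LinearMap.continuous_of_finiteDimensional _
  exact this.comp (hw i)

lemma curr_conv {j : ℕ} {v : (Fin j → ℝ) →ₗ[ℝ] Hpt n} {F : Hpt n → Fin j → ℝ} {c : Hpt n → Hco n j}
    {D : HomDist n} (hn : 1 ≤ n) (hj : j ≤ n) (h : Gr D v F c) {Fh : ℕ → Hpt n → Fin j → ℝ}
    {ch : ℕ → Hpt n → Hco n j} (hh : ∀ i, Gr D v (Fh i) (ch i))
    (hFc : ∀ (qh : ℕ → Hpt n) (q : Hpt n), Tendsto qh atTop (𝓝 q) →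
      Tendsto (fun i => Fh i (qh i)) atTop (𝓝 (F q)) ∧
      Tendsto (fun i => ch i (qh i)) atTop (𝓝 (c q)))
    {Kc : Set (Hco n j)} (hKc : IsCompact Kc) (hKA : ∀ a ∈ Kc, Adm v a)
    (hchK : ∀ i q, ch i q ∈ Kc) (hcK : ∀ q, c q ∈ Kc)
    {P : Set (Hpt n)} {Ph : ℕ → Set (Hpt n)} (hP : MeasurableSet P) (hPh : ∀ i, MeasurableSet (Ph i))
    (hPP : ∀ᵐ x ∂(lam v F), ∀ qh : ℕ → Hpt n, Tendsto qh atTop (𝓝 x) →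
      ∀ᶠ i in atTop, (qh i ∈ Ph i ↔ x ∈ P))
    {U S : Set (Hpt n)} {Sh : ℕ → Set (Hpt n)} (hSU : S ∩ U = ({q | F q = 0} ∩ P) ∩ U)
    (hSh : ∀ i, Sh i = {q | Fh i q = 0} ∩ Ph i)
    {τ : Hco n j → MVec n (2*n+1-j)} (hτ : ContinuousOn τ {c | Adm v c})
    {t : Hpt n → MVec n (2*n+1-j)} (ht : ∀ q ∈ S ∩ U, t q = τ (c q))
    {ω : Hpt n → Cov n (2*n+1-j)} (hω : IsHFormD (2*n+1-j) U ω) :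
    Tendsto (fun i => currF D j (Sh i) (fun q => τ (ch i q)) (fun p v => ω p v)) atTop
      (𝓝 (currF D j S t (fun p v => ω p v))) := by
  obtain ⟨K, hK, hKU, hK0⟩ := hω.cptSupp
  unfold currF
  refine Tendsto.const_mul _ ?_
  let Ψ : Hpt n → Hco n j → ℝ := fun q a => pairF (τ a) q (fun v => ω q v)
  have hz : ∀ q ∉ K, ∀ a, pairF a q (fun v => ω q v) = 0 := by
    intro q hq a
    simp [pairF, hK0 q hq]
  have hΨ : ContinuousOn (fun z : Hpt n × Hco n j => Ψ z.1 z.2) (univ ×ˢ Kc) := by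
    refine continuousOn_finsetSum _ fun s _ => ContinuousOn.mul ?_ ?_
    · exact (continuous_apply s).comp_continuousOn
        (hτ.comp continuousOn_snd fun z hz => hKA _ hz.2)
    · have := continuous_form (fun v => (hω.smooth v).continuous)
        (w := fun i => frameVec (idxTuple s i)) (fun i => continuous_frameVec _)
      exact (this.comp continuous_fst).continuousOn
  have key := Gr.conv hn hj h hh hFc hKc hKA hchK hcK hP hPh hPP hΨ hK fun q hq a => hz q hq _
  have e : ∫ p in S, pairF (t p) p (fun v => ω p v) ∂(sphMeasure D ((2*n+2 : ℝ) - (j : ℝ))) =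
      ∫ q in {q | F q = 0} ∩ P, Ψ q (c q) ∂(sphMeasure D ((2 * n + 2 : ℝ) - j)) := by
    have hKm := hK.measurableSet
    rw [← setIntegral_eq_integral_of_forall_compl_eq_zero (s := K) fun q hq => hz q hq _,
      ← setIntegral_eq_integral_of_forall_compl_eq_zero (s := K) (f := fun q => Ψ q (c q))
        fun q hq => hz q hq _,
      Measure.restrict_restrict hKm, Measure.restrict_restrict hKm]
    have e1 : K ∩ S = K ∩ ({q | F q = 0} ∩ P) := by
      ext q
      constructor
      · intro hq
        exact ⟨hq.1, (hSU.subset ⟨hq.2, hKU hq.1⟩).1⟩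
      · intro hq
        exact ⟨hq.1, (hSU.superset ⟨hq.2, hKU hq.1⟩).1⟩
    rw [← e1]
    have hm : MeasurableSet (K ∩ S) := by
      rw [e1]
      exact hKm.inter (((isClosed_eq h.fib.cont continuous_const).measurableSet).inter hP)
    refine setIntegral_congr_fun hm fun q hq => ?_
    show _ = pairF _ _ _
    rw [ht q ⟨hq.2, hKU hq.1⟩]
  rw [e]
  simp_rw [hSh]
  exact key

end Heis
end


open MeasureTheory Topology Filter Set ENNReal
set_option autoImplicit false
noncomputable section
namespace Heis
variable {n : ℕ}

lemma exists_tau_match (D : HomDist n) (hn : 1 ≤ n) {j m : ℕ} (hj : j ≤ n)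
    {v : (Fin j → ℝ) →ₗ[ℝ] Hpt n} (hv : IsoV v) {L : Hco n j}
    (hL : ∀ a, dlin L (v a) = a) (hm1 : 1 ≤ m) (hm : m + j = 2*n+1)
    {S U : Set (Hpt n)} {t : Hpt n → MVec n m} (ht : IsHOrient j m S t) (hU : IsOpen U)
    {F : Hpt n → Fin j → ℝ} (hF : ∀ i, IsC1H univ fun q => F q i)
    (hG : Gr D v F (fun q i => gradH (fun q => F q i) q))
    (hSU : S ∩ U ⊆ {q | F q = 0}) (hpre : IsPreconnected (S ∩ U)) :
    ∃ τ : Hco n j → MVec n m, ContinuousOn τ {c | Adm v c} ∧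
      (∀ c, Adm v c → ∃ o : Fin m → Fin (2*n+1) → ℝ, (∀ i j, dotC (o i) (o j) = if i = j then 1 else 0) ∧
        (∀ i l, dotC (o i) (padC (c l)) = 0) ∧ τ c = simpleWedge o) ∧
      ∀ q ∈ S ∩ U, t q = τ (fun i => gradH (fun q => F q i) q) := by
  obtain ⟨τ, hτc, hτ⟩ := exists_tau hv hL hm1 hm
  have h := sign_const (t := t) (τ := fun q => τ (fun i => gradH (fun q => F q i) q)) hpre
    (ht.1.mono inter_subset_left)
    (hτc.comp hG.cont.continuousOn fun q _ => hG.adm q) (fun q _ => (hτ _ (hG.adm q)).1) ?_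
  · rcases h with h | h
    · exact ⟨τ, hτc, fun c hc => (hτ c hc).2.2.1, h⟩
    · exact ⟨fun c => - τ c, hτc.neg, fun c hc => (hτ c hc).2.2.2, h⟩
  · intro q hq
    obtain ⟨o, ho, hp, e⟩ := tangent_perp D hn hj (ht.2 q hq.1) hq.1 hU hq.2
      (F := fun i q => F q i) (fun i => (hF i).mono (subset_univ _))
      (fun x hx => ⟨hx.2, fun i => congrFun (hSU hx) i⟩)
    rw [e]
    exact (hτ _ (hG.adm q)).2.1 o ho hp

lemma orient_of_tau {D : HomDist n} {j m : ℕ} {v : (Fin j → ℝ) →ₗ[ℝ] Hpt n}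
    {S W : Set (Hpt n)} (hW : IsOpen W) (hSW : S ⊆ W)
    {F : Hpt n → Fin j → ℝ} (hF : ∀ i, IsC1H univ fun q => F q i)
    (hG : Gr D v F (fun q i => gradH (fun q => F q i) q))
    (hS : S = {q ∈ W | ∀ i, F q i = 0})
    {τ : Hco n j → MVec n m} (hτc : ContinuousOn τ {c | Adm v c})
    (hτ : ∀ c, Adm v c → ∃ o : Fin m → Fin (2*n+1) → ℝ, (∀ i j, dotC (o i) (o j) = if i = j then 1 else 0) ∧
        (∀ i l, dotC (o i) (padC (c l)) = 0) ∧ τ c = simpleWedge o) :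
    IsHOrient j m S (fun q => τ (fun i => gradH (fun q => F q i) q)) := by
  refine ⟨hτc.comp hG.cont.continuousOn fun q _ => hG.adm q, fun p hp => ?_⟩
  refine ⟨W, fun i q => F q i, hW, hSW hp, fun i => (hF i).mono (subset_univ _),
    fun q _ => adm_linInd hG.fib.iso (hG.adm q), ?_, hτ _ (hG.adm p)⟩
  rw [inter_eq_left.2 hSW, hS]

theorem main {n : ℕ} (hn : 1 ≤ n) (D : HomDist n)
    (k : ℕ) (hk1 : 1 ≤ k) (hk2 : k ≤ n - 1)
    (O : Set (Hpt n)) (hO : IsOpen O) (S : Set (Hpt n))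
    (hS : IsC1HSubWithBdry D k O S)
    (tS : Hpt n → MVec n (2*n+1-k)) (htS : IsHOrient k (2*n+1-k) (O ∩ S) tS)
    (tB : Hpt n → MVec n (2*n+1-(k+1)))
    (htB : IsHOrient (k+1) (2*n+1-(k+1)) (O ∩ bdry S) tB) :
    ∀ p ∈ O ∩ bdry S, ∃ U : Set (Hpt n), IsOpen U ∧ p ∈ U ∧
      ∃ (Sh : ℕ → Set (Hpt n)) (th : ℕ → Hpt n → MVec n (2*n+1-k))
        (tbh : ℕ → Hpt n → MVec n (2*n+1-(k+1))),
        (∀ h : ℕ,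
          IsSmoothCodim k (O ∩ Sh h) ∧ IsC1HCodim k (O ∩ Sh h) ∧
          IsSmoothCodim (k+1) (O ∩ bdry (Sh h)) ∧ IsC1HCodim (k+1) (O ∩ bdry (Sh h)) ∧
          IsC1HSubWithBdry D k O (Sh h) ∧
          IsHOrient k (2*n+1-k) (O ∩ Sh h) (th h) ∧
          IsHOrient (k+1) (2*n+1-(k+1)) (O ∩ bdry (Sh h)) (tbh h) ∧
          LocFin (sphMeasure D ((2*n+2 : ℝ) - (k:ℝ))) (Sh h) O ∧
          LocFin (sphMeasure D ((2*n+1 : ℝ) - (k:ℝ))) (bdry (Sh h)) O) ∧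
        (∀ ω : Hpt n → Cov n (2*n+1-k), IsHFormD (2*n+1-k) U ω →
          Filter.Tendsto (fun h => currF D k (Sh h) (th h) (fun p v => ω p v)) Filter.atTop
            (𝓝 (currF D k S tS (fun p v => ω p v)))) ∧
        (∀ α : Hpt n → Cov n (2*n+1-(k+1)), IsHFormD (2*n+1-(k+1)) U α →
          Filter.Tendsto (fun h => currF D (k+1) (bdry (Sh h)) (tbh h) (fun p v => α p v))
            Filter.atTop (𝓝 (currF D (k+1) (bdry S) tB (fun p v => α p v)))) := by
  have hk : k + 1 ≤ n := by omega
  intro p hp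
  obtain ⟨W, f, hW, hpW, hWO, hf, hfli, hf0, hSW, hBW⟩ := exists_germ D hn hk hO hS hp
  set L : Hco n (k+1) := fun i => gradH (f i) p with hLdef
  obtain ⟨v, hv, hL⟩ := exists_isoV hk hfli
  set L' : Hco n k := fun i => L i.castSucc with hL'def
  set v' := v ∘ₗ embL k with hv'def
  have hv' : IsoV v' := hv.emb
  have hL' : ∀ a, dlin L' (v' a) = a := by
    intro a
    funext i
    have := congrFun (hL (embL k a)) i.castSucc
    rw [embL_cast] at this
    exact this
  obtain ⟨ε1, hε1, hGr1⟩ := exists_Gr D hn hv hL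
  obtain ⟨ε2, hε2, hGr2⟩ := exists_Gr D hn hv' hL'
  set ε := min ε1 ε2
  have hε : 0 < ε := lt_min hε1 hε2
  have hGrA : ∀ F : Hpt n → Fin (k+1) → ℝ, (∀ i, IsC1H univ fun q => F q i) →
      (∀ q i l, |gradH (fun q => F q i) q l - L i l| ≤ ε) →
      Gr D v F (fun q i => gradH (fun q => F q i) q) := fun F h1 h2 =>
    hGr1 F h1 fun q i l => (h2 q i l).trans (min_le_left _ _)
  have hGrB : ∀ F : Hpt n → Fin (k+1) → ℝ, (∀ i, IsC1H univ fun q => F q i) →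
      (∀ q i l, |gradH (fun q => F q i) q l - L i l| ≤ ε) →
      Gr D v' (fun q (i : Fin k) => F q i.castSucc) (fun q i => gradH (fun q => F q i.castSucc) q) :=
    fun F h1 h2 =>
      hGr2 (fun q (i : Fin k) => F q i.castSucc) (fun i => h1 _)
        fun q i l => (h2 q i.castSucc l).trans (min_le_right _ _)
  obtain ⟨F, hF, hFL, hFf⟩ := exists_extG D hn hv hW hf hpW hε
  have hFp : F p = 0 := funext fun i => (hFf.self_of_nhds i).trans (hf0 i)
  have hA := hGrA F hF hFL
  have hB := hGrB F hF hFL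
  obtain ⟨U, hU, hpU, hUN, hUc⟩ := exists_conn hA.fib hL p (inter_mem hFf (hW.mem_nhds hpW))
  have hUW : ∀ q ∈ U, q ∈ W := fun q hq => (hUN hq).2
  have hUF : ∀ q ∈ U, ∀ i, F q i = f i q := fun q hq => (hUN hq).1
  have hSU : ∀ q ∈ U, (q ∈ S ↔ (∀ i : Fin k, F q i.castSucc = 0) ∧ 0 < F q (Fin.last k)) := by
    intro q hq
    have : q ∈ S ∩ W ↔ q ∈ {q ∈ W | (∀ i : Fin k, f i.castSucc q = 0) ∧ 0 < f (Fin.last k) q} := by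
      rw [hSW]
    simp only [mem_inter_iff, mem_setOf_eq, hUW q hq, and_true, true_and] at this
    simp only [this, hUF q hq]
  have hBU : ∀ q ∈ U, (q ∈ bdry S ↔ F q = 0) := by
    intro q hq
    have : q ∈ bdry S ∩ W ↔ q ∈ {q ∈ W | ∀ i, f i q = 0} := by
      rw [hBW]
    simp only [mem_inter_iff, mem_setOf_eq, hUW q hq, and_true, true_and] at this
    rw [this, funext_iff]
    simp only [hUF q hq, Pi.zero_apply]
  have hUO : ∀ q ∈ U, q ∈ O := fun q hq => hWO (hUW q hq)
  obtain ⟨Fh, hFhs, hFhL, hFhp, hFhc⟩ := exists_moll hF hFL hFp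
  have hFhC : ∀ h i, IsC1H univ fun q => Fh h q i := fun h i => IsC1H_smooth (hFhs h i) univ
  have hAh := fun h => hGrA (Fh h) (hFhC h) (hFhL h)
  have hBh := fun h => hGrB (Fh h) (hFhC h) (hFhL h)
  have hli : ∀ h q, LinearIndependent ℝ fun i => gradH (fun q => Fh h q i) q :=
    fun h q => adm_linInd hv ((hAh h).adm q)
  -- orientations
  have hpreS : IsPreconnected (O ∩ S ∩ U) := by
    have := hUc {a | (∀ i : Fin k, a i.castSucc = 0) ∧ 0 < a (Fin.last k)} ?_
    · convert this using 1
      ext q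
      constructor
      · intro hq; exact ⟨hq.2, (hSU q hq.2).1 hq.1.2⟩
      · intro hq; exact ⟨⟨hUO q hq.1, (hSU q hq.1).2 hq.2⟩, hq.1⟩
    · intro a ha b hb s t hs ht hst
      refine ⟨fun i => by simp [ha.1 i, hb.1 i], ?_⟩
      show 0 < s * a (Fin.last k) + t * b (Fin.last k)
      rcases hs.eq_or_lt with h | h
      · have : t = 1 := by linarith
        rw [← h, this]; simpa using hb.2
      · have := mul_pos h ha.2
        have := mul_nonneg ht hb.2.le
        linarith
  have hpreB : IsPreconnected (O ∩ bdry S ∩ U) := by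
    have := hUc {0} (convex_singleton _)
    convert this using 1
    ext q
    constructor
    · intro hq; exact ⟨hq.2, (hBU q hq.2).1 hq.1.2⟩
    · intro hq; exact ⟨⟨hUO q hq.1, (hBU q hq.1).2 hq.2⟩, hq.1⟩
  obtain ⟨τ, hτc, hτ, hτS⟩ := exists_tau_match D hn (by omega) hv' hL' (m := 2*n+1-k) (by omega) (by omega)
    htS hU (F := fun q (i : Fin k) => F q i.castSucc) (fun i => hF _) hB
    (fun q hq => funext fun i => ((hSU q hq.2).1 hq.1.2).1 i) hpreS
  obtain ⟨σ, hσc, hσ, hσB⟩ := exists_tau_match D hn hk hv hL (m := 2*n+1-(k+1)) (by omega) (by omega)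
    htB hU hF hA (fun q hq => (hBU q hq.2).1 hq.1.2) hpreB
  have hbd : ∀ h, bdry (halfS (Fh h)) = {q | Fh h q = 0} := fun h => (hAh h).fib.bdry_halfS
  refine ⟨U, hU, hpU, fun h => halfS (Fh h),
    fun h q => τ (fun i => gradH (fun q => Fh h q i.castSucc) q),
    fun h q => σ (fun i => gradH (fun q => Fh h q i) q), fun h => ?_, fun ω hω => ?_, fun α hα => ?_⟩
  · obtain ⟨a1, a2, a3, a4⟩ := half_smooth O hO (hAh h).fib (hFhs h) (hli h)
    refine ⟨a1, a2, a3, a4, half_withBdry D hn hk O hO (hAh h).fib (hFhs h) (hli h) hp.1 (hFhp h),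
      ?_, ?_, ?_, ?_⟩
    · refine orient_of_tau (W := O ∩ {q | 0 < Fh h q (Fin.last k)})
        (F := fun q (i : Fin k) => Fh h q i.castSucc)
        (hO.inter (isOpen_lt continuous_const (hFhs h _).continuous)) (fun q hq => ⟨hq.1, hq.2.2⟩)
        (fun i => hFhC h _) (hBh h) ?_ hτc hτ
      ext q
      constructor
      · intro hq; exact ⟨⟨hq.1, hq.2.2⟩, hq.2.1⟩
      · intro hq; exact ⟨hq.1.1, hq.2, hq.1.2⟩
    · refine orient_of_tau (W := O) hO inter_subset_left (hFhC h) (hAh h) ?_ hσc hσ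
      rw [hbd]
      ext q
      simp [funext_iff]
    · exact (hBh h).locFin hn (by omega) O fun q hq => funext fun i => hq.1 i
    · have := (hAh h).locFin hn hk O (A := bdry (halfS (Fh h))) (by rw [hbd]; exact fun q hq => hq)
      convert this using 2
      push_cast; ring
  · refine curr_conv (U := U) hn (by omega) hB hBh ?_
      (isCompact_close L' ε2) (fun a ha => adm_of_close D hGr2 ha)
      (fun h q i l => (hFhL h q i.castSucc l).trans (min_le_right _ _))
      (fun q i l => (hFL q i.castSucc l).trans (min_le_right _ _))
      (P := {q | 0 < F q (Fin.last k)}) (Ph := fun h => {q | 0 < Fh h q (Fin.last k)})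
      (isOpen_lt continuous_const (continuousOn_univ.1 (hF _).contOn)).measurableSet
      (fun h => (isOpen_lt continuous_const (hFhs h _).continuous).measurableSet) ?_ ?_ ?_ hτc ?_ hω
    · intro qh q hq
      obtain ⟨b1, b2⟩ := hFhc qh q hq
      refine ⟨tendsto_pi_nhds.2 fun i => (tendsto_pi_nhds.1 b1) i.castSucc,
        tendsto_pi_nhds.2 fun i => (tendsto_pi_nhds.1 b2) i.castSucc⟩
    · filter_upwards [ae_last_ne hA.fib hB.fib] with x hx qh hq
      have b := (tendsto_pi_nhds.1 (hFhc qh x hq).1) (Fin.last k)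
      rcases hx.lt_or_gt with hx | hx
      · filter_upwards [b.eventually (eventually_lt_nhds hx)] with i hi
        show 0 < Fh i (qh i) (Fin.last k) ↔ 0 < F x (Fin.last k)
        constructor <;> intro h <;> linarith
      · filter_upwards [b.eventually (eventually_gt_nhds hx)] with i hi
        show 0 < Fh i (qh i) (Fin.last k) ↔ 0 < F x (Fin.last k)
        constructor <;> intro h <;> assumption
    · ext q
      simp only [mem_inter_iff, mem_setOf_eq]
      constructor
      · intro hq
        have := (hSU q hq.2).1 hq.1
        exact ⟨⟨funext this.1, this.2⟩, hq.2⟩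
      · intro hq
        exact ⟨(hSU q hq.2).2 ⟨fun i => congrFun hq.1.1 i, hq.1.2⟩, hq.2⟩
    · intro h
      ext q
      simp [halfS, funext_iff]
    · intro q hq
      exact hτS q ⟨⟨hUO q hq.2, hq.1⟩, hq.2⟩
  · refine curr_conv (U := U) hn hk hA hAh hFhc
      (isCompact_close L ε1) (fun a ha => adm_of_close D hGr1 ha)
      (fun h q i l => (hFhL h q i l).trans (min_le_left _ _))
      (fun q i l => (hFL q i l).trans (min_le_left _ _))
      (P := univ) (Ph := fun h => univ) MeasurableSet.univ (fun h => MeasurableSet.univ) ?_ ?_ ?_ hσc ?_ hα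
    · exact Eventually.of_forall fun x qh hq => Eventually.of_forall fun i => by simp
    · ext q
      simp only [mem_inter_iff, mem_setOf_eq, mem_univ, and_true]
      constructor
      · intro hq; exact ⟨(hBU q hq.2).1 hq.1, hq.2⟩
      · intro hq; exact ⟨(hBU q hq.2).2 hq.1, hq.2⟩
    · intro h
      rw [hbd, inter_univ]
    · intro q hq
      exact hσB q ⟨⟨hUO q hq.2, hq.1⟩, hq.2⟩

end Heis
end


noncomputable section
namespace Heis
variable {n : ℕ}

/-- **Approximation of submanifolds with boundary in non-critical low codimension**
(Lemma 4.1): if `1 ≤ k ≤ n−1` and `S` is an oriented `k`-codimensional `C¹_ℍ`-regular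
submanifold with boundary in `O` such that `S, ∂S` have locally finite measures on `O`, then
every `p ∈ O ∩ ∂S` admits an open neighbourhood `U` and a sequence `(S_h)` of oriented smooth
`C¹_ℍ`-regular codimension-`k` submanifolds with smooth `C¹_ℍ`-regular boundaries and locally
finite measures in `O` such that `⟦S_h⟧(ω) → ⟦S⟧(ω)` for every `ω ∈ 𝒟^{2n+1−k}_ℍ(U)` and
`⟦∂S_h⟧(α) → ⟦∂S⟧(α)` for every `α ∈ 𝒟^{2n−k}_ℍ(U)`. -/
theorem approx_with_boundary_noncritical {n : ℕ} (hn : 1 ≤ n) (D : HomDist n)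
    (k : ℕ) (hk1 : 1 ≤ k) (hk2 : k ≤ n - 1)
    (O : Set (Hpt n)) (hO : IsOpen O) (S : Set (Hpt n)) (hSO : S ⊆ O)
    (hS : IsC1HSubWithBdry D k O S)
    (tS : Hpt n → MVec n (2*n+1-k)) (htS : IsHOrient k (2*n+1-k) (O ∩ S) tS)
    (tB : Hpt n → MVec n (2*n+1-(k+1)))
    (htB : IsHOrient (k+1) (2*n+1-(k+1)) (O ∩ bdry S) tB)
    (hfinS : LocFin (sphMeasure D ((2*n+2 : ℝ) - (k:ℝ))) S O)
    (hfinB : LocFin (sphMeasure D ((2*n+1 : ℝ) - (k:ℝ))) (bdry S) O) :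
    ∀ p ∈ O ∩ bdry S, ∃ U : Set (Hpt n), IsOpen U ∧ p ∈ U ∧
      ∃ (Sh : ℕ → Set (Hpt n)) (th : ℕ → Hpt n → MVec n (2*n+1-k))
        (tbh : ℕ → Hpt n → MVec n (2*n+1-(k+1))),
        (∀ h : ℕ,
          IsSmoothCodim k (O ∩ Sh h) ∧ IsC1HCodim k (O ∩ Sh h) ∧
          IsSmoothCodim (k+1) (O ∩ bdry (Sh h)) ∧ IsC1HCodim (k+1) (O ∩ bdry (Sh h)) ∧
          IsC1HSubWithBdry D k O (Sh h) ∧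
          IsHOrient k (2*n+1-k) (O ∩ Sh h) (th h) ∧
          IsHOrient (k+1) (2*n+1-(k+1)) (O ∩ bdry (Sh h)) (tbh h) ∧
          LocFin (sphMeasure D ((2*n+2 : ℝ) - (k:ℝ))) (Sh h) O ∧
          LocFin (sphMeasure D ((2*n+1 : ℝ) - (k:ℝ))) (bdry (Sh h)) O) ∧
        (∀ ω : Hpt n → Cov n (2*n+1-k), IsHFormD (2*n+1-k) U ω →
          Filter.Tendsto (fun h => currF D k (Sh h) (th h) (fun p v => ω p v)) Filter.atTop
            (𝓝 (currF D k S tS (fun p v => ω p v)))) ∧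
        (∀ α : Hpt n → Cov n (2*n+1-(k+1)), IsHFormD (2*n+1-(k+1)) U α →
          Filter.Tendsto (fun h => currF D (k+1) (bdry (Sh h)) (tbh h) (fun p v => α p v))
            Filter.atTop (𝓝 (currF D (k+1) (bdry S) tB (fun p v => α p v)))) := by
  exact main hn D k hk1 hk2 O hO S hS tS htS tB htB

end Heis
end
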